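/- Let d = 3 and define ω : ℝ³ → ℝ by ω(x) = √(1 + Σ_{j=1}^{3} 2(1 − cos x_j)). For λ ∈ ℝ and s ∈ ℝ³, set J(λ,s) = ∫_{[0,2π]³} e^{iλ(ω(x) − s·x)} dx. Then there exists a constant C > 0, independent of λ and s, such that |J(λ,s)| ≤ C(1 + |λ|)^{-7/6} for all λ ∈ ℝ and all s ∈ ℝ³. -/

import Mathlib

open MeasureTheory Real
open scoped ENNReal

noncomputable section

/-- Dispersion relation of the discrete Klein--Gordon equation on `ℤ^d`. -/
def omegaKG (d : ℕ) (x : Fin d → ℝ) : ℝ :=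
  Real.sqrt (1 + ∑ j : Fin d, 2 * (1 - Real.cos (x j)))

/-- The fundamental domain `[0, 2π]^d` of the torus. -/
def cube (d : ℕ) : Set (Fin d → ℝ) := Set.Icc 0 (fun _ => 2 * Real.pi)

/-- The oscillatory integral `J(λ,s) = ∫_{[0,2π]^d} e^{iλ(ω(x) − s·x)} dx`. -/
def oscIntJ (d : ℕ) (lam : ℝ) (s : Fin d → ℝ) : ℂ :=
  ∫ x in cube d,
    Complex.exp (Complex.I * ((lam * (omegaKG d x - ∑ j : Fin d, s j * x j) : ℝ) : ℂ))

namespace KG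

/-- The unimodular exponential `e^{it}`. -/
def cis (t : ℝ) : ℂ := Complex.exp (t * Complex.I)

@[simp] lemma norm_cis (t : ℝ) : ‖cis t‖ = 1 := Complex.norm_exp_ofReal_mul_I t

lemma cis_add (s t : ℝ) : cis (s + t) = cis s * cis t := by
  simp only [cis, ← Complex.exp_add]; congr 1; push_cast; ring

lemma cis_zero : cis 0 = 1 := by simp [cis]

lemma cis_neg_mul (s : ℝ) : cis (-s) * cis s = 1 := by
  rw [← cis_add]; simp [cis]

@[fun_prop] lemma continuous_cis : Continuous cis := by
  unfold cis; fun_prop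

lemma hasDerivAt_cis (t : ℝ) : HasDerivAt cis (cis t * Complex.I) t := by
  have h : HasDerivAt (fun t : ℝ => (t : ℂ) * Complex.I) Complex.I t := by
    simpa using (HasDerivAt.ofReal_comp (hasDerivAt_id t)).mul_const Complex.I
  exact h.cexp

lemma hasDerivAt_cis_comp {f : ℝ → ℝ} {f' x : ℝ} (h : HasDerivAt f f' x) :
    HasDerivAt (fun y => cis (f y)) (cis (f x) * (f' * Complex.I)) x := by
  have := (hasDerivAt_cis (f x)).scomp x h
  exact this.congr_deriv (by rw [Complex.real_smul]; ring)

/-- `Φ` is twice continuously differentiable on `[a, b]` with derivatives `F`, `F'`. -/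
structure IsPhase (Φ F F' : ℝ → ℝ) (a b : ℝ) : Prop where
  d1 : ∀ x ∈ Set.Icc a b, HasDerivAt Φ (F x) x
  d2 : ∀ x ∈ Set.Icc a b, HasDerivAt F (F' x) x
  cont : ContinuousOn F' (Set.Icc a b)

lemma IsPhase.mono {Φ F F' : ℝ → ℝ} {a b u v : ℝ} (h : IsPhase Φ F F' a b)
    (hu : a ≤ u) (hv : v ≤ b) : IsPhase Φ F F' u v :=
  have hs : Set.Icc u v ⊆ Set.Icc a b := Set.Icc_subset_Icc hu hv
  ⟨fun x hx => h.d1 x (hs hx), fun x hx => h.d2 x (hs hx), h.cont.mono hs⟩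

lemma IsPhase.continuousOn {Φ F F' : ℝ → ℝ} {a b : ℝ} (h : IsPhase Φ F F' a b) :
    ContinuousOn Φ (Set.Icc a b) := fun x hx => (h.d1 x hx).continuousAt.continuousWithinAt

lemma IsPhase.cis_continuousOn {Φ F F' : ℝ → ℝ} {a b : ℝ} (h : IsPhase Φ F F' a b) :
    ContinuousOn (fun x => cis (Φ x)) (Set.Icc a b) :=
  continuous_cis.comp_continuousOn h.continuousOn

lemma norm_integral_cis_le (Φ : ℝ → ℝ) {a b : ℝ} (hab : a ≤ b) :
    ‖∫ x in a..b, cis (Φ x)‖ ≤ b - a := by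
  have := intervalIntegral.norm_integral_le_of_norm_le_const (a := a) (b := b) (C := 1)
    (f := fun x => cis (Φ x)) (fun x _ => by simp)
  rwa [one_mul, abs_of_nonneg (by linarith)] at this

/-- First derivative test: a phase with monotone derivative bounded away from zero. -/
lemma vdc_first {Φ F F' : ℝ → ℝ} {a b δ : ℝ} (hab : a ≤ b) (h : IsPhase Φ F F' a b)
    (hs : (∀ x ∈ Set.Icc a b, 0 ≤ F' x) ∨ (∀ x ∈ Set.Icc a b, F' x ≤ 0))
    (hδ : 0 < δ) (hF : ∀ x ∈ Set.Icc a b, δ ≤ |F x|) :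
    ‖∫ x in a..b, cis (Φ x)‖ ≤ 4 / δ := by
  have hF0 : ∀ x ∈ Set.Icc a b, F x ≠ 0 := fun x hx h0 => by
    have := hF x hx; rw [h0, abs_zero] at this; linarith
  have hinv : ∀ x ∈ Set.Icc a b, HasDerivAt (fun y => (F y)⁻¹) (-F' x / F x ^ 2) x :=
    fun x hx => (h.d2 x hx).inv (hF0 x hx)
  have hFc : ContinuousOn F (Set.Icc a b) := fun x hx =>
    (h.d2 x hx).continuousAt.continuousWithinAt
  have hGc : ContinuousOn (fun x => -F' x / F x ^ 2) (Set.Icc a b) :=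
    h.cont.neg.div (hFc.pow 2) (fun x hx => pow_ne_zero 2 (hF0 x hx))
  have hu : Set.uIcc a b = Set.Icc a b := Set.uIcc_of_le hab
  have key := intervalIntegral.integral_mul_deriv_eq_deriv_mul (a := a) (b := b)
    (u := fun x => (((F x)⁻¹ : ℝ) : ℂ)) (u' := fun x => ((-F' x / F x ^ 2 : ℝ) : ℂ))
    (v := fun x => cis (Φ x)) (v' := fun x => cis (Φ x) * (F x * Complex.I))
    (fun x hx => (hinv x (hu ▸ hx)).ofReal_comp)
    (fun x hx => hasDerivAt_cis_comp (h.d1 x (hu ▸ hx)))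
    (ContinuousOn.intervalIntegrable_of_Icc hab (Complex.continuous_ofReal.comp_continuousOn hGc))
    (ContinuousOn.intervalIntegrable_of_Icc hab (h.cis_continuousOn.mul
      ((Complex.continuous_ofReal.comp_continuousOn hFc).mul continuousOn_const)))
  have e1 : ∫ x in a..b, (((F x)⁻¹ : ℝ) : ℂ) * (cis (Φ x) * (F x * Complex.I))
      = (∫ x in a..b, cis (Φ x)) * Complex.I := by
    rw [← intervalIntegral.integral_mul_const]
    apply intervalIntegral.integral_congr
    intro x hx
    have : (F x : ℂ) ≠ 0 := by exact_mod_cast hF0 x (hu ▸ hx)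
    simp only [Complex.ofReal_inv]
    field_simp
  have hn : ‖(∫ x in a..b, cis (Φ x)) * Complex.I‖ = ‖∫ x in a..b, cis (Φ x)‖ := by simp
  have hbd : ∀ x ∈ Set.Icc a b, |(F x)⁻¹| ≤ 1 / δ := fun x hx => by
    rw [abs_inv, inv_eq_one_div]; exact one_div_le_one_div_of_le hδ (hF x hx)
  have ha : a ∈ Set.Icc a b := ⟨le_rfl, hab⟩
  have hb : b ∈ Set.Icc a b := ⟨hab, le_rfl⟩
  have hint : ∫ x in a..b, (-F' x / F x ^ 2) = (F b)⁻¹ - (F a)⁻¹ :=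
    intervalIntegral.integral_eq_sub_of_hasDerivAt (fun x hx => hinv x (hu ▸ hx))
      (hGc.intervalIntegrable_of_Icc hab)
  have hIn : ∫ x in a..b, |(-F' x / F x ^ 2)| ≤ 2 / δ := by
    have h2 : |(F b)⁻¹ - (F a)⁻¹| ≤ 2 / δ := by
      have := abs_sub ((F b)⁻¹) ((F a)⁻¹)
      have h1 := hbd a ha; have h2 := hbd b hb
      have : 2 / δ = 1 / δ + 1 / δ := by ring
      linarith
    rcases hs with hs | hs
    · have : ∫ x in a..b, |(-F' x / F x ^ 2)| = ∫ x in a..b, -(-F' x / F x ^ 2) := by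
        apply intervalIntegral.integral_congr
        intro x hx
        exact abs_of_nonpos (div_nonpos_of_nonpos_of_nonneg (neg_nonpos.2 (hs x (hu ▸ hx)))
          (sq_nonneg _))
      rw [this, intervalIntegral.integral_neg, hint]
      exact (neg_le_abs _).trans h2
    · have : ∫ x in a..b, |(-F' x / F x ^ 2)| = ∫ x in a..b, (-F' x / F x ^ 2) := by
        apply intervalIntegral.integral_congr
        intro x hx
        exact abs_of_nonneg (div_nonneg (neg_nonneg.2 (hs x (hu ▸ hx))) (sq_nonneg _))
      rw [this, hint]
      exact (le_abs_self _).trans h2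
  have hlast : ‖∫ x in a..b, ((-F' x / F x ^ 2 : ℝ) : ℂ) * cis (Φ x)‖ ≤ 2 / δ := by
    refine (intervalIntegral.norm_integral_le_of_norm_le hab (g := fun x => |(-F' x / F x ^ 2)|)
      (Filter.Eventually.of_forall fun x _ => ?_)
      (hGc.abs.intervalIntegrable_of_Icc hab)).trans hIn
    rw [norm_mul, norm_cis, mul_one, Complex.norm_real, Real.norm_eq_abs]
  rw [← hn, ← e1, key]
  refine (norm_sub_le _ _).trans ?_
  have h3 := norm_sub_le ((((F b)⁻¹ : ℝ) : ℂ) * cis (Φ b)) ((((F a)⁻¹ : ℝ) : ℂ) * cis (Φ a))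
  simp only [norm_mul, norm_cis, mul_one, Complex.norm_real, Real.norm_eq_abs] at h3
  have h1 := hbd a ha; have h2 := hbd b hb
  have : 4 / δ = 1 / δ + 1 / δ + 2 / δ := by ring
  linarith

/-- If `|g'| ≥ ρ` on an interval, `g` grows linearly away from some point. -/
lemma exists_linear_growth {g g' : ℝ → ℝ} {a b ρ : ℝ} (hab : a ≤ b) (hρ : 0 < ρ)
    (hg : ∀ x ∈ Set.Icc a b, HasDerivAt g (g' x) x) (h : ∀ x ∈ Set.Icc a b, ρ ≤ |g' x|) :
    ∃ c ∈ Set.Icc a b, ∀ x ∈ Set.Icc a b, ρ * |x - c| ≤ |g x| := by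
  have main : ∀ {g g' : ℝ → ℝ}, (∀ x ∈ Set.Icc a b, HasDerivAt g (g' x) x) →
      (∀ x ∈ Set.Icc a b, ρ ≤ g' x) →
      ∃ c ∈ Set.Icc a b, ∀ x ∈ Set.Icc a b, ρ * |x - c| ≤ |g x| := by
    intro g g' hg h
    have hc : ContinuousOn g (Set.Icc a b) := fun x hx =>
      (hg x hx).continuousAt.continuousWithinAt
    have grow : ∀ x ∈ Set.Icc a b, ∀ y ∈ Set.Icc a b, x ≤ y → ρ * (y - x) ≤ g y - g x :=
      (convex_Icc a b).mul_sub_le_image_sub_of_le_deriv hc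
        (fun x hx => (hg x (interior_subset hx)).differentiableAt.differentiableWithinAt)
        (fun x hx => by rw [(hg x (interior_subset hx)).deriv]; exact h x (interior_subset hx))
    have ha : a ∈ Set.Icc a b := ⟨le_rfl, hab⟩
    have hb : b ∈ Set.Icc a b := ⟨hab, le_rfl⟩
    rcases le_or_gt 0 (g a) with h0 | h0
    · refine ⟨a, ha, fun x hx => ?_⟩
      have := grow a ha x hx hx.1
      rw [abs_of_nonneg (by linarith [hx.1])]
      exact le_trans (by linarith) (le_abs_self _)
    rcases le_or_gt (g b) 0 with h1 | h1
    · refine ⟨b, hb, fun x hx => ?_⟩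
      have := grow x hx b hb hx.2
      rw [abs_of_nonpos (by linarith [hx.2])]
      exact le_trans (by linarith) (neg_le_abs _)
    obtain ⟨c, hc1, hc2⟩ := intermediate_value_Icc hab hc ⟨h0.le, h1.le⟩
    refine ⟨c, hc1, fun x hx => ?_⟩
    rcases le_total x c with hx1 | hx1
    · have := grow x hx c hc1 hx1
      rw [abs_of_nonpos (by linarith)]
      exact le_trans (by linarith) (neg_le_abs _)
    · have := grow c hc1 x hx hx1
      rw [abs_of_nonneg (by linarith)]
      exact le_trans (by linarith) (le_abs_self _)
  have hne : ∀ x ∈ Set.Icc a b, g' x ≠ 0 := fun x hx h0 => by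
    have := h x hx; rw [h0, abs_zero] at this; linarith
  rcases hasDerivWithinAt_forall_lt_or_forall_gt_of_forall_ne (convex_Icc a b)
    (fun x hx => (hg x hx).hasDerivWithinAt) hne with h1 | h1
  · obtain ⟨c, hc, hc'⟩ := main (g := fun x => -g x) (g' := fun x => -g' x)
      (fun x hx => (hg x hx).neg) (fun x hx => by
        have := h x hx; rwa [abs_of_neg (h1 x hx)] at this)
    exact ⟨c, hc, fun x hx => by simpa using hc' x hx⟩
  · exact main hg (fun x hx => by
        have := h x hx; rwa [abs_of_pos (h1 x hx)] at this)

/-- Removing a `d`-neighbourhood of a point. -/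
lemma norm_integral_le_of_away {Φ F F' : ℝ → ℝ} {a b c d K : ℝ} (hab : a ≤ b)
    (h : IsPhase Φ F F' a b) (hd : 0 ≤ d) (hK : 0 ≤ K)
    (haway : ∀ u v, a ≤ u → u ≤ v → v ≤ b → (∀ x ∈ Set.Icc u v, d ≤ |x - c|) →
      ‖∫ x in u..v, cis (Φ x)‖ ≤ K) :
    ‖∫ x in a..b, cis (Φ x)‖ ≤ 2 * K + 2 * d := by
  set p := max a (min b (c - d)) with hp
  set q := max a (min b (c + d)) with hq
  have hap : a ≤ p := le_max_left _ _
  have hpb : p ≤ b := max_le hab (min_le_left _ _)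
  have hqb : q ≤ b := max_le hab (min_le_left _ _)
  have hpq : p ≤ q := max_le_max le_rfl (min_le_min le_rfl (by linarith))
  have hint : ∀ u v, a ≤ u → u ≤ v → v ≤ b →
      IntervalIntegrable (fun x => cis (Φ x)) volume u v := fun u v hu huv hv =>
    ((h.mono hu hv).cis_continuousOn).intervalIntegrable_of_Icc huv
  have h1 := intervalIntegral.integral_add_adjacent_intervals (hint a p le_rfl hap hpb)
    (hint p q hap hpq hqb)
  have h2 := intervalIntegral.integral_add_adjacent_intervals
    (hint a q le_rfl (hap.trans hpq) hqb) (hint q b (hap.trans hpq) hqb le_rfl)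
  have e1 : ‖∫ x in a..p, cis (Φ x)‖ ≤ K := by
    rcases le_or_gt (min b (c - d)) a with h0 | h0
    · have : p = a := max_eq_left h0
      rw [this, intervalIntegral.integral_same, norm_zero]; exact hK
    · refine haway a p le_rfl hap hpb fun x hx => ?_
      have : p ≤ c - d := by rw [hp, max_eq_right h0.le]; exact min_le_right _ _
      rw [abs_sub_comm]; exact le_trans (by linarith [hx.2]) (le_abs_self _)
  have e2 : ‖∫ x in q..b, cis (Φ x)‖ ≤ K := by
    rcases le_or_gt b (c + d) with h0 | h0
    · have : q = b := by rw [hq, min_eq_left h0, max_eq_right hab]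
      rw [this, intervalIntegral.integral_same, norm_zero]; exact hK
    · refine haway q b (hap.trans hpq) hqb le_rfl fun x hx => ?_
      have : c + d ≤ q := by rw [hq, min_eq_right h0.le]; exact le_max_right _ _
      exact le_trans (by linarith [hx.1]) (le_abs_self _)
  have e3 : ‖∫ x in p..q, cis (Φ x)‖ ≤ 2 * d := by
    refine (norm_integral_cis_le Φ hpq).trans ?_
    simp only [hp, hq]
    rcases max_cases a (min b (c - d)) with h5 | h5 <;>
    rcases max_cases a (min b (c + d)) with h6 | h6 <;>
    rcases min_cases b (c - d) with h7 | h7 <;>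
    rcases min_cases b (c + d) with h8 | h8 <;> linarith
  rw [← h2, ← h1]
  refine (norm_add_le _ _).trans ?_
  have := norm_add_le (∫ x in a..p, cis (Φ x)) (∫ x in p..q, cis (Φ x))
  linarith

/-- Second derivative test. -/
lemma vdc_second {Φ F F' : ℝ → ℝ} {a b η d : ℝ} (hab : a ≤ b) (h : IsPhase Φ F F' a b)
    (hη : ∀ x ∈ Set.Icc a b, η ≤ |F' x|) (hd : 0 < d) (hηd : 1 ≤ η * d ^ 2) :
    ‖∫ x in a..b, cis (Φ x)‖ ≤ 10 * d := by
  have hη0 : 0 < η := by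
    by_contra hc
    have : η * d ^ 2 ≤ 0 := mul_nonpos_of_nonpos_of_nonneg (not_lt.1 hc) (by positivity)
    linarith
  obtain ⟨c, -, hgrow⟩ := exists_linear_growth hab hη0 h.d2 hη
  have := norm_integral_le_of_away (c := c) (K := 4 * d) hab h hd.le (by positivity) ?_
  · linarith
  intro u v hu huv hv haw
  have hsub : Set.Icc u v ⊆ Set.Icc a b := Set.Icc_subset_Icc hu hv
  have hne : ∀ x ∈ Set.Icc u v, F' x ≠ 0 := fun x hx h0 => by
    have := hη x (hsub hx); rw [h0, abs_zero] at this; linarith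
  have hsg : (∀ x ∈ Set.Icc u v, 0 ≤ F' x) ∨ (∀ x ∈ Set.Icc u v, F' x ≤ 0) := by
    rcases hasDerivWithinAt_forall_lt_or_forall_gt_of_forall_ne (convex_Icc u v)
      (fun x hx => (h.d2 x (hsub hx)).hasDerivWithinAt) hne with h1 | h1
    · exact Or.inr fun x hx => (h1 x hx).le
    · exact Or.inl fun x hx => (h1 x hx).le
  refine (vdc_first huv (h.mono hu hv) hsg (mul_pos hη0 hd) fun x hx => ?_).trans ?_
  · exact (mul_le_mul_of_nonneg_left (haw x hx) hη0.le).trans (hgrow x (hsub hx))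
  · rw [div_le_iff₀ (mul_pos hη0 hd)]; nlinarith

/-- Third derivative test. -/
lemma vdc_third {Φ F F' g g' : ℝ → ℝ} {a b v0 ρ d : ℝ} (hab : a ≤ b) (h : IsPhase Φ F F' a b)
    (hv0 : 0 < v0) (hF : ∀ x ∈ Set.Icc a b, v0 * |g x| ≤ |F' x|)
    (hg : ∀ x ∈ Set.Icc a b, HasDerivAt g (g' x) x) (hρ0 : 0 < ρ)
    (hρ : ∀ x ∈ Set.Icc a b, ρ ≤ |g' x|) (hd : 0 < d) (hh : 1 ≤ v0 * ρ * d ^ 3) :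
    ‖∫ x in a..b, cis (Φ x)‖ ≤ 22 * d := by
  obtain ⟨c, -, hgrow⟩ := exists_linear_growth hab hρ0 hg hρ
  have := norm_integral_le_of_away (c := c) (K := 10 * d) hab h hd.le (by positivity) ?_
  · linarith
  intro u v hu huv hv haw
  have hsub : Set.Icc u v ⊆ Set.Icc a b := Set.Icc_subset_Icc hu hv
  refine vdc_second (η := v0 * (ρ * d)) huv (h.mono hu hv) (fun x hx => ?_) hd ?_
  · refine le_trans ?_ (hF x (hsub hx))
    gcongr
    exact (mul_le_mul_of_nonneg_left (haw x hx) hρ0.le).trans (hgrow x (hsub hx))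
  · calc _ ≤ _ := hh
      _ = _ := by ring

/-- Fourth derivative test. -/
lemma vdc_fourth {Φ F F' g g' P P' : ℝ → ℝ} {a b v0 w ρ d : ℝ} (hab : a ≤ b)
    (h : IsPhase Φ F F' a b)
    (hv0 : 0 < v0) (hF : ∀ x ∈ Set.Icc a b, v0 * |g x| ≤ |F' x|)
    (hg : ∀ x ∈ Set.Icc a b, HasDerivAt g (g' x) x) (hw : 0 < w)
    (hgP : ∀ x ∈ Set.Icc a b, w * |P x| ≤ |g' x|)
    (hP : ∀ x ∈ Set.Icc a b, HasDerivAt P (P' x) x) (hρ0 : 0 < ρ)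
    (hρ : ∀ x ∈ Set.Icc a b, ρ ≤ |P' x|) (hd : 0 < d) (hh : 1 ≤ v0 * w * ρ * d ^ 4) :
    ‖∫ x in a..b, cis (Φ x)‖ ≤ 46 * d := by
  obtain ⟨c, -, hgrow⟩ := exists_linear_growth hab hρ0 hP hρ
  have := norm_integral_le_of_away (c := c) (K := 22 * d) hab h hd.le (by positivity) ?_
  · linarith
  intro u v hu huv hv haw
  have hsub : Set.Icc u v ⊆ Set.Icc a b := Set.Icc_subset_Icc hu hv
  refine vdc_third (ρ := w * (ρ * d)) huv (h.mono hu hv) hv0 (fun x hx => hF x (hsub hx))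
    (fun x hx => hg x (hsub hx)) (by positivity) (fun x hx => ?_) hd ?_
  · refine le_trans ?_ (hgP x (hsub hx))
    gcongr
    exact (mul_le_mul_of_nonneg_left (haw x hx) hρ0.le).trans (hgrow x (hsub hx))
  · calc _ ≤ _ := hh
      _ = _ := by ring

/-- Summation by parts: an amplitude of bounded variation against a function with bounded
primitives. -/
lemma norm_integral_mul_le {f c c' : ℝ → ℂ} {a b K : ℝ} (hab : a ≤ b)
    (hf : ContinuousOn f (Set.Icc a b))
    (hK : ∀ x ∈ Set.Icc a b, ‖∫ y in a..x, f y‖ ≤ K)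
    (hc : ∀ x ∈ Set.Icc a b, HasDerivAt c (c' x) x) (hc' : ContinuousOn c' (Set.Icc a b)) :
    ‖∫ x in a..b, c x * f x‖ ≤ K * (‖c b‖ + ∫ x in a..b, ‖c' x‖) := by
  have hu : Set.uIcc a b = Set.Icc a b := Set.uIcc_of_le hab
  have hfi : IntervalIntegrable f volume a b := hf.intervalIntegrable_of_Icc hab
  have hprim : ContinuousOn (fun x => ∫ y in a..x, f y) (Set.uIcc a b) := by
    have := intervalIntegral.continuousOn_primitive_interval' hfi (a := a) (by simp)
    exact this
  have key := intervalIntegral.integral_mul_deriv_eq_deriv_mul_of_hasDeriv_right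
    (a := a) (b := b) (u := c) (u' := c') (v := fun x => ∫ y in a..x, f y) (v' := f)
    (fun x hx => (hc x (hu ▸ hx)).continuousAt.continuousWithinAt) hprim
    (fun x hx => by
      rw [min_eq_left hab, max_eq_right hab] at hx
      exact (hc x (Set.Ioo_subset_Icc_self hx)).hasDerivWithinAt)
    (fun x hx => by
      rw [min_eq_left hab, max_eq_right hab] at hx
      have hx' : x ∈ Set.Icc a b := Set.Ioo_subset_Icc_self hx
      have hn : Set.Icc a b ∈ nhds x := Icc_mem_nhds hx.1 hx.2
      have : HasDerivAt (fun x => ∫ y in a..x, f y) (f x) x :=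
        intervalIntegral.integral_hasDerivAt_right
          ((hf.mono (Set.Icc_subset_Icc le_rfl hx'.2)).intervalIntegrable_of_Icc hx'.1)
          (hf.stronglyMeasurableAtFilter_nhdsWithin measurableSet_Icc x |>.filter_mono
            (by rw [nhdsWithin_eq_nhds.2 hn])) (hf.continuousAt hn)
      exact this.hasDerivWithinAt)
    (hc'.intervalIntegrable_of_Icc hab) hfi
  rw [key, intervalIntegral.integral_same, mul_zero, sub_zero]
  refine (norm_sub_le _ _).trans ?_
  have hb : b ∈ Set.Icc a b := ⟨hab, le_rfl⟩
  have h1 : ‖∫ x in a..b, c' x * ∫ y in a..x, f y‖ ≤ ∫ x in a..b, ‖c' x‖ * K := by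
    refine intervalIntegral.norm_integral_le_of_norm_le hab
      (Filter.Eventually.of_forall fun x hx => ?_)
      ((hc'.norm.mul continuousOn_const).intervalIntegrable_of_Icc hab)
    rw [norm_mul]
    exact mul_le_mul_of_nonneg_left (hK x ⟨hx.1.le, hx.2⟩) (norm_nonneg _)
  rw [intervalIntegral.integral_mul_const] at h1
  rw [norm_mul]
  have h2 := mul_le_mul_of_nonneg_left (hK b hb) (norm_nonneg (c b))
  linarith

/-- The modulus `√(4 - q/τ²)` of the Bessel frequency for `q = s²`. -/
def mm (q τ : ℝ) : ℝ := √(4 - q / τ ^ 2)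

/-- The Bessel amplitude `m^{-1/2}`. -/
def amp (q τ : ℝ) : ℝ := (√(mm q τ))⁻¹

section mm
variable {q τ : ℝ}

lemma mm_nonneg (q τ : ℝ) : 0 ≤ mm q τ := Real.sqrt_nonneg _

lemma arg_pos (hτ : 0 < τ) (hq : q < 4 * τ ^ 2) : 0 < 4 - q / τ ^ 2 := by
  rw [sub_pos, div_lt_iff₀ (by positivity)]; linarith

lemma mm_pos (hτ : 0 < τ) (hq : q < 4 * τ ^ 2) : 0 < mm q τ := Real.sqrt_pos.2 (arg_pos hτ hq)

lemma mm_sq (hτ : 0 < τ) (hq : q < 4 * τ ^ 2) : mm q τ ^ 2 = 4 - q / τ ^ 2 :=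
  Real.sq_sqrt (arg_pos hτ hq).le

lemma mm_le_two (hτ : 0 < τ) (hq : 0 ≤ q) : mm q τ ≤ 2 := by
  unfold mm
  rw [Real.sqrt_le_left (by norm_num)]
  have : 0 ≤ q / τ ^ 2 := by positivity
  linarith

lemma mm_anti {q' : ℝ} (hτ : 0 < τ) (h : q' ≤ q) : mm q τ ≤ mm q' τ := by
  unfold mm; gcongr

lemma mm_mono {τ' : ℝ} (hτ : 0 < τ) (hq : 0 ≤ q) (h : τ ≤ τ') : mm q τ ≤ mm q τ' := by
  unfold mm; gcongr

lemma hasDerivAt_mm (hτ : 0 < τ) (hq : q < 4 * τ ^ 2) :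
    HasDerivAt (mm q) (q / (τ ^ 3 * mm q τ)) τ := by
  have h1 : HasDerivAt (fun t : ℝ => 4 - q / t ^ 2) (2 * q / τ ^ 3) τ := by
    have := ((hasDerivAt_const τ q).div (hasDerivAt_pow 2 τ) (by positivity)).const_sub 4
    refine this.congr_deriv ?_
    field_simp
    simp
    ring
  have h2 := h1.sqrt (arg_pos hτ hq).ne'
  refine h2.congr_deriv ?_
  have := mm_pos hτ hq
  change 2 * q / τ ^ 3 / (2 * mm q τ) = _
  field_simp

lemma continuousAt_mm (hτ : 0 < τ) (hq : q < 4 * τ ^ 2) : ContinuousAt (mm q) τ :=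
  (hasDerivAt_mm hτ hq).continuousAt

lemma amp_pos (hτ : 0 < τ) (hq : q < 4 * τ ^ 2) : 0 < amp q τ :=
  inv_pos.2 (Real.sqrt_pos.2 (mm_pos hτ hq))

lemma amp_nonneg (q τ : ℝ) : 0 ≤ amp q τ := inv_nonneg.2 (Real.sqrt_nonneg _)

lemma amp_sq (q τ : ℝ) : amp q τ ^ 2 = (mm q τ)⁻¹ := by
  rw [amp, inv_pow, Real.sq_sqrt (mm_nonneg _ _)]

lemma amp_le_of_le_sq {c : ℝ} (hc : 0 < c) (h : c ^ 2 ≤ mm q τ) : amp q τ ≤ 1 / c := by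
  rw [amp, ← one_div]
  exact one_div_le_one_div_of_le hc (Real.le_sqrt_of_sq_le h)

lemma amp_mono {q' : ℝ} (hτ : 0 < τ) (hq : q < 4 * τ ^ 2) (h : q' ≤ q) :
    amp q' τ ≤ amp q τ := by
  unfold amp
  have := mm_pos hτ hq
  have := mm_anti hτ h
  gcongr

lemma hasDerivAt_amp (hτ : 0 < τ) (hq : q < 4 * τ ^ 2) :
    HasDerivAt (amp q) (-(q / (τ ^ 3 * mm q τ)) / (2 * √(mm q τ)) / mm q τ) τ := by
  have hm := mm_pos hτ hq
  have := ((hasDerivAt_mm hτ hq).sqrt hm.ne').inv (Real.sqrt_pos.2 hm).ne'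
  refine this.congr_deriv ?_
  rw [Real.sq_sqrt hm.le]
  ring

end mm

/-- A function that stays below a level once it has reached it splits an interval in two. -/
lemma level_split {g : ℝ → ℝ} {u v c : ℝ} (huv : u ≤ v) (hg : ContinuousOn g (Set.Icc u v))
    (h : ∀ x ∈ Set.Icc u v, ∀ y ∈ Set.Icc u v, x ≤ y → g x ≤ c → g y ≤ c) :
    ∃ w ∈ Set.Icc u v, (w = u ∨ ∀ x ∈ Set.Icc u w, c ≤ g x) ∧
      (w = v ∨ ∀ x ∈ Set.Icc w v, g x ≤ c) := by
  by_cases hex : ∃ x ∈ Set.Icc u v, g x ≤ c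
  swap
  · push Not at hex
    exact ⟨v, ⟨huv, le_rfl⟩, Or.inr fun x hx => (hex x hx).le, Or.inl rfl⟩
  set S := Set.Icc u v ∩ g ⁻¹' Set.Iic c with hS
  have hcl : IsClosed S := hg.preimage_isClosed_of_isClosed isClosed_Icc isClosed_Iic
  have hne : S.Nonempty := by obtain ⟨x, hx, hx'⟩ := hex; exact ⟨x, hx, hx'⟩
  have hbd : BddBelow S := ⟨u, fun x hx => hx.1.1⟩
  have hw : sInf S ∈ S := hcl.csInf_mem hne hbd
  set w := sInf S
  have hlt : ∀ x ∈ Set.Ico u w, c ≤ g x := fun x hx => by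
    by_contra hcon
    have : x ∈ S := ⟨⟨hx.1, hx.2.le.trans hw.1.2⟩, (not_le.1 hcon).le⟩
    exact absurd (csInf_le hbd this) (not_le.2 hx.2)
  refine ⟨w, hw.1, ?_, Or.inr fun x hx => h w hw.1 x ⟨hw.1.1.trans hx.1, hx.2⟩ hx.1 hw.2⟩
  rcases eq_or_lt_of_le hw.1.1 with he | hl
  · exact Or.inl he.symm
  · right
    have hcw : ContinuousOn g (closure (Set.Ico u w)) := by
      rw [closure_Ico hl.ne]; exact hg.mono (Set.Icc_subset_Icc le_rfl hw.1.2)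
    have := le_on_closure (f := fun _ => c) (g := g) (s := Set.Ico u w) hlt continuousOn_const hcw
    intro x hx
    exact this (by rwa [closure_Ico hl.ne])

/-- A function with negative derivative on a level set stays below that level. -/
lemma stays_below {g g' : ℝ → ℝ} {u v c : ℝ}
    (hg : ∀ x ∈ Set.Icc u v, HasDerivAt g (g' x) x)
    (hneg : ∀ x ∈ Set.Icc u v, g x = c → g' x < 0) :
    ∀ x ∈ Set.Icc u v, ∀ y ∈ Set.Icc u v, x ≤ y → g x ≤ c → g y ≤ c := by
  intro x hx y hy hxy hgx
  have hsub : Set.Icc x y ⊆ Set.Icc u v := Set.Icc_subset_Icc hx.1 hy.2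
  exact image_le_of_deriv_right_lt_deriv_boundary (f := g) (f' := g') (B := fun _ => c)
    (B' := fun _ => 0)
    (fun z hz => (hg z (hsub hz)).continuousAt.continuousWithinAt)
    (fun z hz => (hg z (hsub ⟨hz.1, hz.2.le⟩)).hasDerivWithinAt) hgx
    (fun z => hasDerivAt_const z c)
    (fun z hz he => hneg z (hsub ⟨hz.1, hz.2.le⟩) he) ⟨hxy, le_rfl⟩

/-- Parameters of the reduced one-dimensional integral: the scale `l = lam^{-1/6}`, three squared
velocities and three signs. -/
structure CorePar where
  (l lam q1 q2 q3 e1 e2 e3 : ℝ)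

namespace CorePar
variable (p : CorePar)

/-- Derivative of the phase. -/
def F (x : ℝ) : ℝ :=
  p.lam * (7 - 1 / (4 * x ^ 2) + p.e1 * mm p.q1 x + p.e2 * mm p.q2 x + p.e3 * mm p.q3 x)

/-- Normalised second derivative of the phase. -/
def g (x : ℝ) : ℝ :=
  -1 / 4 - (p.e1 * (p.q1 / mm p.q1 x) + p.e2 * (p.q2 / mm p.q2 x) + p.e3 * (p.q3 / mm p.q3 x)) / 2

/-- Second derivative of the phase. -/
def F' (x : ℝ) : ℝ := p.lam * (-2 / x ^ 3) * p.g x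

/-- Normalised third derivative of the phase. -/
def N (x : ℝ) : ℝ :=
  p.e1 * (p.q1 ^ 2 / mm p.q1 x ^ 3) + p.e2 * (p.q2 ^ 2 / mm p.q2 x ^ 3)
    + p.e3 * (p.q3 ^ 2 / mm p.q3 x ^ 3)

/-- The total amplitude. -/
def A (x : ℝ) : ℝ := amp p.q1 x * amp p.q2 x * amp p.q3 x

end CorePar

/-- Standing hypotheses for the reduced one-dimensional integral. -/
structure CoreHyp (p : CorePar) (Φ : ℝ → ℝ) (a b : ℝ) : Prop where
  l_pos : 0 < p.l
  l_le : p.l ≤ 1 / 2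
  lam_l : p.lam * p.l ^ 6 = 1
  q3_nonneg : 0 ≤ p.q3
  q32 : p.q3 ≤ p.q2
  q21 : p.q2 ≤ p.q1
  ha : 1 / 10 ≤ a
  hab : a ≤ b
  hb : b ≤ 2
  hq : p.q1 < 4 * a ^ 2
  he1 : p.e1 = 1 ∨ p.e1 = -1
  he2 : p.e2 = 1 ∨ p.e2 = -1
  he3 : p.e3 = 1 ∨ p.e3 = -1
  hΦ : ∀ x ∈ Set.Icc a b, HasDerivAt Φ (p.F x) x

namespace CoreHyp
variable {p : CorePar} {Φ : ℝ → ℝ} {a b : ℝ}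

lemma mono (h : CoreHyp p Φ a b) {u v : ℝ} (hu : a ≤ u) (huv : u ≤ v) (hv : v ≤ b) :
    CoreHyp p Φ u v :=
  { h with
    ha := h.ha.trans hu
    hab := huv
    hb := hv.trans h.hb
    hq := by
      have := h.ha
      nlinarith [h.hq]
    hΦ := fun x hx => h.hΦ x ⟨hu.trans hx.1, hx.2.trans hv⟩ }

lemma lam_pos (h : CoreHyp p Φ a b) : 0 < p.lam := by
  have := h.lam_l
  have h6 : 0 < p.l ^ 6 := pow_pos h.l_pos 6
  by_contra hc
  nlinarith

lemma pos (h : CoreHyp p Φ a b) {x : ℝ} (hx : x ∈ Set.Icc a b) : 0 < x := by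
  linarith [h.ha, hx.1]

lemma q2_nonneg (h : CoreHyp p Φ a b) : 0 ≤ p.q2 := h.q3_nonneg.trans h.q32
lemma q1_nonneg (h : CoreHyp p Φ a b) : 0 ≤ p.q1 := h.q2_nonneg.trans h.q21

lemma q1_lt (h : CoreHyp p Φ a b) {x : ℝ} (hx : x ∈ Set.Icc a b) : p.q1 < 4 * x ^ 2 := by
  have := h.ha; have := hx.1
  nlinarith [h.hq]
lemma q2_lt (h : CoreHyp p Φ a b) {x : ℝ} (hx : x ∈ Set.Icc a b) : p.q2 < 4 * x ^ 2 :=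
  h.q21.trans_lt (h.q1_lt hx)
lemma q3_lt (h : CoreHyp p Φ a b) {x : ℝ} (hx : x ∈ Set.Icc a b) : p.q3 < 4 * x ^ 2 :=
  h.q32.trans_lt (h.q2_lt hx)

lemma m1_pos (h : CoreHyp p Φ a b) {x : ℝ} (hx : x ∈ Set.Icc a b) : 0 < mm p.q1 x :=
  mm_pos (h.pos hx) (h.q1_lt hx)
lemma m2_pos (h : CoreHyp p Φ a b) {x : ℝ} (hx : x ∈ Set.Icc a b) : 0 < mm p.q2 x :=
  mm_pos (h.pos hx) (h.q2_lt hx)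
lemma m3_pos (h : CoreHyp p Φ a b) {x : ℝ} (hx : x ∈ Set.Icc a b) : 0 < mm p.q3 x :=
  mm_pos (h.pos hx) (h.q3_lt hx)
lemma m12 (h : CoreHyp p Φ a b) {x : ℝ} (hx : x ∈ Set.Icc a b) : mm p.q1 x ≤ mm p.q2 x :=
  mm_anti (h.pos hx) h.q21
lemma m23 (h : CoreHyp p Φ a b) {x : ℝ} (hx : x ∈ Set.Icc a b) : mm p.q2 x ≤ mm p.q3 x :=
  mm_anti (h.pos hx) h.q32
lemma m3_le (h : CoreHyp p Φ a b) {x : ℝ} (hx : x ∈ Set.Icc a b) : mm p.q3 x ≤ 2 :=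
  mm_le_two (h.pos hx) h.q3_nonneg

lemma hasDerivAt_m1 (h : CoreHyp p Φ a b) {x : ℝ} (hx : x ∈ Set.Icc a b) :
    HasDerivAt (mm p.q1) (p.q1 / (x ^ 3 * mm p.q1 x)) x := hasDerivAt_mm (h.pos hx) (h.q1_lt hx)
lemma hasDerivAt_m2 (h : CoreHyp p Φ a b) {x : ℝ} (hx : x ∈ Set.Icc a b) :
    HasDerivAt (mm p.q2) (p.q2 / (x ^ 3 * mm p.q2 x)) x := hasDerivAt_mm (h.pos hx) (h.q2_lt hx)
lemma hasDerivAt_m3 (h : CoreHyp p Φ a b) {x : ℝ} (hx : x ∈ Set.Icc a b) :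
    HasDerivAt (mm p.q3) (p.q3 / (x ^ 3 * mm p.q3 x)) x := hasDerivAt_mm (h.pos hx) (h.q3_lt hx)

lemma hasDerivAt_F (h : CoreHyp p Φ a b) {x : ℝ} (hx : x ∈ Set.Icc a b) :
    HasDerivAt p.F (p.F' x) x := by
  have hx0 := h.pos hx
  have h1 := h.m1_pos hx; have h2 := h.m2_pos hx; have h3 := h.m3_pos hx
  have hd : HasDerivAt (fun y : ℝ => 1 / (4 * y ^ 2)) (-1 / (2 * x ^ 3)) x := by
    have := (hasDerivAt_const x (1 : ℝ)).div ((hasDerivAt_pow 2 x).const_mul 4) (by positivity)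
    refine this.congr_deriv ?_
    field_simp
    simp
    ring
  have := (((((hd.const_sub 7).add ((h.hasDerivAt_m1 hx).const_mul p.e1)).add
    ((h.hasDerivAt_m2 hx).const_mul p.e2)).add ((h.hasDerivAt_m3 hx).const_mul p.e3))).const_mul
    p.lam
  refine this.congr_deriv ?_
  unfold CorePar.F' CorePar.g
  field_simp
  ring

lemma hasDerivAt_div {q x : ℝ} (hx : 0 < x) (hq : q < 4 * x ^ 2) :
    HasDerivAt (fun y => q / mm q y) (-(q ^ 2 / mm q x ^ 3) / x ^ 3) x := by
  have hm := mm_pos hx hq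
  refine ((hasDerivAt_const x q).div (hasDerivAt_mm hx hq) hm.ne').congr_deriv ?_
  field_simp
  ring

lemma hasDerivAt_g (h : CoreHyp p Φ a b) {x : ℝ} (hx : x ∈ Set.Icc a b) :
    HasDerivAt p.g (p.N x / (2 * x ^ 3)) x := by
  have hx0 := h.pos hx
  have := (((((hasDerivAt_div hx0 (h.q1_lt hx)).const_mul p.e1).add
    ((hasDerivAt_div hx0 (h.q2_lt hx)).const_mul p.e2)).add
    ((hasDerivAt_div hx0 (h.q3_lt hx)).const_mul p.e3)).div_const 2).const_sub (-1 / 4)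
  refine this.congr_deriv ?_
  unfold CorePar.N
  field_simp
  ring

lemma continuousOn_g (h : CoreHyp p Φ a b) : ContinuousOn p.g (Set.Icc a b) := fun _ hx =>
  (h.hasDerivAt_g hx).continuousAt.continuousWithinAt

lemma isPhase (h : CoreHyp p Φ a b) : IsPhase Φ p.F p.F' a b where
  d1 := h.hΦ
  d2 := fun _ hx => h.hasDerivAt_F hx
  cont := by
    unfold CorePar.F'
    refine ContinuousOn.mul (continuousOn_const.mul (continuousOn_const.div
      (continuousOn_pow 3) fun x hx => ?_)) h.continuousOn_g
    have := h.pos hx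
    positivity

lemma F'_lower (h : CoreHyp p Φ a b) {x : ℝ} (hx : x ∈ Set.Icc a b) :
    p.lam / 4 * |p.g x| ≤ |p.F' x| := by
  have hx0 := h.pos hx
  have hl := h.lam_pos
  have hx2 : x ≤ 2 := hx.2.trans h.hb
  unfold CorePar.F'
  rw [abs_mul]
  gcongr
  rw [abs_mul, abs_of_pos hl, abs_div, abs_neg, abs_two, abs_of_pos (by positivity : 0 < x ^ 3)]
  rw [div_eq_mul_inv]
  gcongr
  rw [inv_eq_one_div, div_le_div_iff₀ (by norm_num) (by positivity)]
  have : x ^ 3 ≤ 2 ^ 3 := by gcongr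
  linarith

lemma g'_lower (h : CoreHyp p Φ a b) {x : ℝ} (hx : x ∈ Set.Icc a b) :
    |p.N x| / 16 ≤ |p.N x / (2 * x ^ 3)| := by
  have hx0 := h.pos hx
  have hx2 : x ≤ 2 := hx.2.trans h.hb
  rw [abs_div, abs_of_pos (by positivity : 0 < 2 * x ^ 3)]
  gcongr
  have : x ^ 3 ≤ 2 ^ 3 := by gcongr
  linarith

lemma A_pos (h : CoreHyp p Φ a b) {x : ℝ} (hx : x ∈ Set.Icc a b) : 0 < p.A x :=
  mul_pos (mul_pos (amp_pos (h.pos hx) (h.q1_lt hx)) (amp_pos (h.pos hx) (h.q2_lt hx)))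
    (amp_pos (h.pos hx) (h.q3_lt hx))

/-- Derivative of the amplitude. -/
lemma exists_A' (h : CoreHyp p Φ a b) : ∃ A' : ℝ → ℝ, (∀ x ∈ Set.Icc a b, HasDerivAt p.A (A' x) x)
    ∧ ContinuousOn A' (Set.Icc a b) ∧ ∀ x ∈ Set.Icc a b, A' x ≤ 0 := by
  have hc : ∀ q, 0 ≤ q → (∀ x ∈ Set.Icc a b, q < 4 * x ^ 2) → ContinuousOn (fun x =>
      -(q / (x ^ 3 * mm q x)) / (2 * √(mm q x)) / mm q x) (Set.Icc a b) := by
    intro q _ hq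
    have hm : ContinuousOn (mm q) (Set.Icc a b) := fun x hx =>
      (continuousAt_mm (h.pos hx) (hq x hx)).continuousWithinAt
    have hm0 : ∀ x ∈ Set.Icc a b, 0 < mm q x := fun x hx => mm_pos (h.pos hx) (hq x hx)
    refine ((continuousOn_const.div ((continuousOn_pow 3).mul hm) fun x hx => ?_).neg.div
      (continuousOn_const.mul hm.sqrt) fun x hx => ?_).div hm fun x hx => (hm0 x hx).ne'
    · exact (mul_pos (pow_pos (h.pos hx) 3) (hm0 x hx)).ne'
    · exact (mul_pos two_pos (Real.sqrt_pos.2 (hm0 x hx))).ne'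
  have hneg : ∀ q, 0 ≤ q → ∀ x ∈ Set.Icc a b,
      -(q / (x ^ 3 * mm q x)) / (2 * √(mm q x)) / mm q x ≤ 0 := by
    intro q hq x hx
    have := h.pos hx
    have := mm_nonneg q x
    refine div_nonpos_of_nonpos_of_nonneg (div_nonpos_of_nonpos_of_nonneg ?_ (by positivity)) this
    rw [neg_nonpos]; positivity
  have hca : ∀ q, (∀ x ∈ Set.Icc a b, q < 4 * x ^ 2) → ContinuousOn (amp q) (Set.Icc a b) :=
    fun q hq x hx => (hasDerivAt_amp (h.pos hx) (hq x hx)).continuousAt.continuousWithinAt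
  refine ⟨_, fun x hx => ((hasDerivAt_amp (h.pos hx) (h.q1_lt hx)).mul
    (hasDerivAt_amp (h.pos hx) (h.q2_lt hx))).mul (hasDerivAt_amp (h.pos hx) (h.q3_lt hx)), ?_, ?_⟩
  · exact (((hc _ h.q1_nonneg fun x => h.q1_lt).mul (hca _ fun x => h.q2_lt)).add
      ((hca _ fun x => h.q1_lt).mul (hc _ h.q2_nonneg fun x => h.q2_lt))).mul
      (hca _ fun x => h.q3_lt) |>.add (((hca _ fun x => h.q1_lt).mul (hca _ fun x => h.q2_lt)).mul
      (hc _ h.q3_nonneg fun x => h.q3_lt))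
  · intro x hx
    have a1 := amp_nonneg p.q1 x; have a2 := amp_nonneg p.q2 x; have a3 := amp_nonneg p.q3 x
    have b1 := hneg _ h.q1_nonneg x hx
    have b2 := hneg _ h.q2_nonneg x hx
    have b3 := hneg _ h.q3_nonneg x hx
    exact add_nonpos (mul_nonpos_of_nonpos_of_nonneg (add_nonpos
      (mul_nonpos_of_nonpos_of_nonneg b1 a2) (mul_nonpos_of_nonneg_of_nonpos a1 b2)) a3)
      (mul_nonpos_of_nonneg_of_nonpos (mul_nonneg a1 a2) b3)

lemma continuousOn_A (h : CoreHyp p Φ a b) : ContinuousOn p.A (Set.Icc a b) := by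
  obtain ⟨A', hA, -⟩ := h.exists_A'
  exact fun x hx => (hA x hx).continuousAt.continuousWithinAt

lemma continuousOn_integrand (h : CoreHyp p Φ a b) :
    ContinuousOn (fun x => (p.A x : ℂ) * cis (Φ x)) (Set.Icc a b) :=
  (Complex.continuous_ofReal.comp_continuousOn h.continuousOn_A).mul h.isPhase.cis_continuousOn

/-- Second mean value estimate for the decreasing amplitude. -/
lemma norm_integral_le (h : CoreHyp p Φ a b) {K : ℝ}
    (hK : ∀ x ∈ Set.Icc a b, ‖∫ y in a..x, cis (Φ y)‖ ≤ K) :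
    ‖∫ x in a..b, (p.A x : ℂ) * cis (Φ x)‖ ≤ K * p.A a := by
  obtain ⟨A', hA, hA'c, hA'⟩ := h.exists_A'
  have hab := h.hab
  have := norm_integral_mul_le hab h.isPhase.cis_continuousOn hK
    (fun x hx => (hA x hx).ofReal_comp) (Complex.continuous_ofReal.comp_continuousOn hA'c)
  refine this.trans (le_of_eq ?_)
  have hu : Set.uIcc a b = Set.Icc a b := Set.uIcc_of_le hab
  have hi : ∫ x in a..b, ‖((A' x : ℝ) : ℂ)‖ = p.A a - p.A b := by
    have : ∫ x in a..b, ‖((A' x : ℝ) : ℂ)‖ = ∫ x in a..b, -A' x := by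
      refine intervalIntegral.integral_congr fun x hx => ?_
      simp only [Complex.norm_real, Real.norm_eq_abs]
      exact abs_of_nonpos (hA' x (hu ▸ hx))
    rw [this, intervalIntegral.integral_neg, intervalIntegral.integral_eq_sub_of_hasDerivAt
      (fun x hx => hA x (hu ▸ hx)) (hA'c.intervalIntegrable_of_Icc hab)]
    ring
  have hi' : ∫ x in a..b, ‖(Complex.ofReal ∘ A') x‖ = p.A a - p.A b := hi
  simp only [Function.comp] at hi' ⊢
  rw [hi', Complex.norm_real, Real.norm_eq_abs, abs_of_pos (h.A_pos ⟨hab, le_rfl⟩)]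
  ring

lemma integral_split (h : CoreHyp p Φ a b) {w : ℝ} (hw : w ∈ Set.Icc a b) :
    ∫ x in a..b, (p.A x : ℂ) * cis (Φ x) =
      (∫ x in a..w, (p.A x : ℂ) * cis (Φ x)) + ∫ x in w..b, (p.A x : ℂ) * cis (Φ x) :=
  (intervalIntegral.integral_add_adjacent_intervals
    ((h.mono le_rfl hw.1 hw.2).continuousOn_integrand.intervalIntegrable_of_Icc hw.1)
    ((h.mono hw.1 hw.2 le_rfl).continuousOn_integrand.intervalIntegrable_of_Icc hw.2)).symm

lemma cis_integral_split (h : CoreHyp p Φ a b) {w : ℝ} (hw : w ∈ Set.Icc a b) :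
    ∫ x in a..b, cis (Φ x) = (∫ x in a..w, cis (Φ x)) + ∫ x in w..b, cis (Φ x) :=
  (intervalIntegral.integral_add_adjacent_intervals
    ((h.mono le_rfl hw.1 hw.2).isPhase.cis_continuousOn.intervalIntegrable_of_Icc hw.1)
    ((h.mono hw.1 hw.2 le_rfl).isPhase.cis_continuousOn.intervalIntegrable_of_Icc hw.2)).symm

/-- Splitting at a level of `m₁`. -/
lemma split_m1 (h : CoreHyp p Φ a b) (c : ℝ) :
    ∃ w ∈ Set.Icc a b, (w = a ∨ ∀ x ∈ Set.Icc a w, mm p.q1 x ≤ c) ∧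
      (w = b ∨ ∀ x ∈ Set.Icc w b, c ≤ mm p.q1 x) := by
  obtain ⟨w, hw, h1, h2⟩ := level_split (g := fun x => -mm p.q1 x) (c := -c) h.hab
    (fun x hx => (h.hasDerivAt_m1 hx).continuousAt.neg.continuousWithinAt)
    (fun x hx y hy hxy hxc => by
      have := mm_mono (h.pos hx) h.q1_nonneg hxy
      linarith)
  exact ⟨w, hw, h1.imp_right fun h x hx => neg_le_neg_iff.1 (h x hx),
    h2.imp_right fun h x hx => neg_le_neg_iff.1 (h x hx)⟩

/-- The trivial estimate for the amplitude. -/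
lemma norm_integral_le_integral (h : CoreHyp p Φ a b) {B B' : ℝ → ℝ}
    (hB : ∀ x ∈ Set.Icc a b, HasDerivAt B (B' x) x) (hB' : ContinuousOn B' (Set.Icc a b))
    (hA : ∀ x ∈ Set.Icc a b, p.A x ≤ B' x) :
    ‖∫ x in a..b, (p.A x : ℂ) * cis (Φ x)‖ ≤ B b - B a := by
  have hab := h.hab
  have hu : Set.uIcc a b = Set.Icc a b := Set.uIcc_of_le hab
  rw [← intervalIntegral.integral_eq_sub_of_hasDerivAt (fun x hx => hB x (hu ▸ hx))
    (hB'.intervalIntegrable_of_Icc hab)]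
  refine intervalIntegral.norm_integral_le_of_norm_le hab
    (Filter.Eventually.of_forall fun x hx => ?_) (hB'.intervalIntegrable_of_Icc hab)
  have hx' : x ∈ Set.Icc a b := ⟨hx.1.le, hx.2⟩
  rw [norm_mul, norm_cis, mul_one, Complex.norm_real, Real.norm_eq_abs, abs_of_pos (h.A_pos hx')]
  exact hA x hx'

end CoreHyp

namespace CoreHyp
variable {p : CorePar} {Φ : ℝ → ℝ} {a b : ℝ}

lemma m3_large (h : CoreHyp p Φ a b) (hq3 : p.q3 < 1 / 100) {x : ℝ} (hx : x ∈ Set.Icc a b) :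
    17 / 10 ≤ mm p.q3 x := by
  have hx0 := h.pos hx
  refine Real.le_sqrt_of_sq_le ?_
  have : p.q3 / x ^ 2 ≤ 1 := by
    rw [div_le_one (by positivity)]
    have := h.ha.trans hx.1
    nlinarith
  linarith

lemma r3_small (h : CoreHyp p Φ a b) (hq3 : p.q3 < 1 / 100) {x : ℝ} (hx : x ∈ Set.Icc a b) :
    p.q3 / mm p.q3 x ≤ 6 / 1000 := by
  have := h.m3_large hq3 hx
  rw [div_le_iff₀ (by linarith)]
  linarith

lemma r_mono (h : CoreHyp p Φ a b) {x : ℝ} (hx : x ∈ Set.Icc a b) :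
    0 ≤ p.q3 / mm p.q3 x ∧ p.q3 / mm p.q3 x ≤ p.q2 / mm p.q2 x ∧
      p.q2 / mm p.q2 x ≤ p.q1 / mm p.q1 x :=
  ⟨div_nonneg h.q3_nonneg (mm_nonneg _ _),
    div_le_div₀ h.q2_nonneg h.q32 (h.m2_pos hx) (h.m23 hx),
    div_le_div₀ h.q1_nonneg h.q21 (h.m1_pos hx) (h.m12 hx)⟩

lemma t_mono (h : CoreHyp p Φ a b) {x : ℝ} (hx : x ∈ Set.Icc a b) :
    0 ≤ p.q3 ^ 2 / mm p.q3 x ^ 3 ∧ p.q3 ^ 2 / mm p.q3 x ^ 3 ≤ p.q2 ^ 2 / mm p.q2 x ^ 3 ∧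
      p.q2 ^ 2 / mm p.q2 x ^ 3 ≤ p.q1 ^ 2 / mm p.q1 x ^ 3 := by
  have h1 := h.m1_pos hx; have h2 := h.m2_pos hx; have h3 := h.m3_pos hx
  refine ⟨by positivity, div_le_div₀ (by positivity) ?_ (by positivity) ?_,
    div_le_div₀ (by positivity) ?_ (by positivity) ?_⟩
  · have := h.q32; have := h.q3_nonneg; gcongr
  · have := h.m23 hx; gcongr
  · have := h.q21; have := h.q2_nonneg; gcongr
  · have := h.m12 hx; gcongr

lemma N_le_of_g_small (h : CoreHyp p Φ a b) (hq3 : p.q3 < 1 / 100) (he : p.e1 = -1) {x : ℝ}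
    (hx : x ∈ Set.Icc a b) (hg : -(1 / 16) ≤ p.g x) : p.N x ≤ -(1 / 100) := by
  have h1 := h.m1_pos hx; have h2 := h.m2_pos hx; have h3 := h.m3_large hq3 hx
  have h12 := h.m12 hx; have h23 := h.m23 hx; have h32 := h.m3_le hx
  obtain ⟨r0, r1, r2⟩ := h.r_mono hx
  have r3 := h.r3_small hq3 hx
  obtain ⟨t0, t1, t2⟩ := h.t_mono hx
  have tr : ∀ q m : ℝ, 0 < m → q ^ 2 / m ^ 3 = (q / m) ^ 2 / m := fun q m hm => by field_simp
  unfold CorePar.g at hg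
  unfold CorePar.N
  have t3 : p.q3 ^ 2 / mm p.q3 x ^ 3 ≤ 1 / 1000 := by
    rw [tr _ _ (by linarith), div_le_iff₀ (by linarith)]
    nlinarith
  rw [he] at hg ⊢
  have key1 : 34 / 1000 ≤ (p.q1 / mm p.q1 x) ^ 2 →
      17 / 1000 ≤ p.q1 ^ 2 / mm p.q1 x ^ 3 := fun hh => by
    rw [tr _ _ h1, le_div_iff₀ h1]
    nlinarith
  have key2 : 34 / 1000 ≤ (p.q1 / mm p.q1 x) ^ 2 - (p.q2 / mm p.q2 x) ^ 2 →
      17 / 1000 ≤ p.q1 ^ 2 / mm p.q1 x ^ 3 - p.q2 ^ 2 / mm p.q2 x ^ 3 := fun hh => by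
    rw [tr _ _ h1, tr _ _ h2]
    have e1 : (p.q2 / mm p.q2 x) ^ 2 / mm p.q2 x ≤ (p.q2 / mm p.q2 x) ^ 2 / mm p.q1 x := by gcongr
    have e2 : 17 / 1000 ≤ ((p.q1 / mm p.q1 x) ^ 2 - (p.q2 / mm p.q2 x) ^ 2) / mm p.q1 x := by
      rw [le_div_iff₀ h1]
      nlinarith
    rw [sub_div] at e2
    linarith
  rcases h.he2 with e2 | e2 <;> rcases h.he3 with e3 | e3 <;> rw [e2, e3] at hg ⊢
  · have := key2 (by nlinarith); linarith
  · have := key2 (by nlinarith); linarith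
  · have := key1 (by nlinarith); linarith
  · have := key1 (by nlinarith); linarith

/-- Where the normalised second derivative is bounded below the second derivative test gives a
gain of `l ^ 2`. -/
lemma cis_bound_of_g_large (h : CoreHyp p Φ a b) (hg : ∀ x ∈ Set.Icc a b, 1 / 16 ≤ |p.g x|) :
    ‖∫ x in a..b, cis (Φ x)‖ ≤ 80 * p.l ^ 2 := by
  have hl := h.l_pos; have hl2 := h.l_le; have hL := h.lam_pos
  have := vdc_second (η := p.lam / 64) (d := 8 * p.l ^ 2) h.hab h.isPhase (fun x hx => ?_)
    (by positivity) ?_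
  · linarith
  · have h1 := h.F'_lower hx
    have h2 := hg x hx
    nlinarith
  · have h6 := h.lam_l
    have : p.l ^ 6 ≤ p.l ^ 4 := pow_le_pow_of_le_one hl.le (by linarith) (by norm_num)
    nlinarith

lemma cis_bound_of_N_large (h : CoreHyp p Φ a b) (hg : ∀ x ∈ Set.Icc a b, 1 / 100 ≤ |p.N x|) :
    ‖∫ x in a..b, cis (Φ x)‖ ≤ 440 * p.l ^ 2 := by
  have hl := h.l_pos; have hl2 := h.l_le; have hL := h.lam_pos
  have := vdc_third (v0 := p.lam / 4) (ρ := 1 / 1600) (d := 20 * p.l ^ 2) h.hab h.isPhase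
    (by positivity) (fun x hx => h.F'_lower hx) (fun x hx => h.hasDerivAt_g hx) (by norm_num)
    (fun x hx => ?_) (by positivity) ?_
  · linarith
  · have h1 := h.g'_lower hx
    have h2 := hg x hx
    linarith
  · have h6 := h.lam_l
    calc (1 : ℝ) ≤ 8000 / 6400 * (p.lam * p.l ^ 6) := by rw [h6]; norm_num
      _ = _ := by ring

lemma cis_bound_caseB (h : CoreHyp p Φ a b) (hq3 : p.q3 < 1 / 100) :
    ‖∫ x in a..b, cis (Φ x)‖ ≤ 600 * p.l ^ 2 := by
  have hl := h.l_pos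
  rcases h.he1 with he | he
  · refine (h.cis_bound_of_g_large fun x hx => ?_).trans (by nlinarith)
    have r3 := h.r3_small hq3 hx
    obtain ⟨r0, r1, r2⟩ := h.r_mono hx
    rw [abs_of_nonpos]
    all_goals
      unfold CorePar.g
      rw [he]
      rcases h.he2 with e2 | e2 <;> rcases h.he3 with e3 | e3 <;> rw [e2, e3] <;> linarith
  have hdec : ∀ c : ℝ, -(1 / 16) ≤ c → ∀ u v, a ≤ u → v ≤ b →
      ∀ x ∈ Set.Icc u v, ∀ y ∈ Set.Icc u v, x ≤ y → p.g x ≤ c → p.g y ≤ c := by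
    intro c hc u v hu hv
    refine stays_below (g' := fun x => p.N x / (2 * x ^ 3))
      (fun x hx => h.hasDerivAt_g ⟨hu.trans hx.1, hx.2.trans hv⟩) fun x hx hxc => ?_
    have hx' : x ∈ Set.Icc a b := ⟨hu.trans hx.1, hx.2.trans hv⟩
    have := h.N_le_of_g_small hq3 he hx' (by linarith)
    have := h.pos hx'
    exact div_neg_of_neg_of_pos (by linarith) (by positivity)
  obtain ⟨w, hw, h1, h2⟩ := level_split h.hab h.continuousOn_g (c := 1 / 16)
    (hdec _ (by norm_num) a b le_rfl le_rfl)
  have hwb := h.mono hw.1 hw.2 le_rfl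
  obtain ⟨y, hy, h3, h4⟩ := level_split hw.2 hwb.continuousOn_g (c := -(1 / 16))
    (hdec _ le_rfl w b hw.1 le_rfl)
  have i1 : ‖∫ x in a..w, cis (Φ x)‖ ≤ 80 * p.l ^ 2 := by
    rcases h1 with h1 | h1
    · rw [h1, intervalIntegral.integral_same, norm_zero]; positivity
    · exact (h.mono le_rfl hw.1 hw.2).cis_bound_of_g_large fun x hx =>
        (h1 x hx).trans (le_abs_self _)
  have i2 : ‖∫ x in w..y, cis (Φ x)‖ ≤ 440 * p.l ^ 2 := by
    rcases h3 with h3 | h3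
    · rw [h3, intervalIntegral.integral_same, norm_zero]; positivity
    · refine (hwb.mono le_rfl hy.1 hy.2).cis_bound_of_N_large fun x hx => ?_
      have := hwb.N_le_of_g_small hq3 he ⟨hx.1, hx.2.trans hy.2⟩ (h3 x hx)
      exact le_trans (by linarith) (neg_le_abs _)
  have i3 : ‖∫ x in y..b, cis (Φ x)‖ ≤ 80 * p.l ^ 2 := by
    rcases h4 with h4 | h4
    · rw [h4, intervalIntegral.integral_same, norm_zero]; positivity
    · refine (hwb.mono hy.1 hy.2 le_rfl).cis_bound_of_g_large fun x hx => ?_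
      have := h4 x hx
      exact le_trans (by linarith) (neg_le_abs _)
  rw [h.cis_integral_split hw, hwb.cis_integral_split hy]
  refine (norm_add_le _ _).trans ?_
  have := norm_add_le (∫ x in w..y, cis (Φ x)) (∫ x in y..b, cis (Φ x))
  linarith

lemma inv_m1_le (h : CoreHyp p Φ a b) {x κ : ℝ} (hx : x ∈ Set.Icc a b) (hκ : 0 < κ)
    (hq : κ ≤ p.q1) :
    (mm p.q1 x)⁻¹ ≤ 8 / κ * (p.q1 / (x ^ 3 * mm p.q1 x)) := by
  have hx0 := h.pos hx
  have hx2 : x ≤ 2 := hx.2.trans h.hb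
  have hm := h.m1_pos hx
  rw [div_mul_div_comm, inv_eq_one_div, div_le_div_iff₀ hm (by positivity)]
  have h3 : x ^ 3 ≤ 2 ^ 3 := by gcongr
  have : κ * x ^ 3 ≤ p.q1 * 8 := by nlinarith
  nlinarith

lemma continuousOn_m1' (h : CoreHyp p Φ a b) :
    ContinuousOn (fun x => p.q1 / (x ^ 3 * mm p.q1 x)) (Set.Icc a b) := by
  refine continuousOn_const.div ((continuousOn_pow 3).mul fun x hx =>
    (h.hasDerivAt_m1 hx).continuousAt.continuousWithinAt) fun x hx => ?_
  exact (mul_pos (pow_pos (h.pos hx) 3) (h.m1_pos hx)).ne'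

lemma amp12_le (h : CoreHyp p Φ a b) {x : ℝ} (hx : x ∈ Set.Icc a b) :
    amp p.q1 x * amp p.q2 x ≤ (mm p.q1 x)⁻¹ := by
  rw [← amp_sq, pow_two]
  exact mul_le_mul_of_nonneg_left (amp_mono (h.pos hx) (h.q1_lt hx) h.q21) (amp_nonneg _ _)

lemma core_caseB (h : CoreHyp p Φ a b) (hq3 : p.q3 < 1 / 100) :
    ‖∫ x in a..b, (p.A x : ℂ) * cis (Φ x)‖ ≤ 1000 * p.l := by
  have hl := h.l_pos
  obtain ⟨w, hw, h1, h2⟩ := h.split_m1 p.l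
  rw [h.integral_split hw]
  have hA3 : ∀ x ∈ Set.Icc a b, amp p.q3 x ≤ 1 := fun x hx => by
    have := h.m3_large hq3 hx
    have := amp_le_of_le_sq (c := 1) (q := p.q3) (τ := x) one_pos (by linarith)
    linarith
  have hA : ∀ x ∈ Set.Icc a b, p.A x ≤ (mm p.q1 x)⁻¹ := fun x hx => by
    have e1 := h.amp12_le hx
    have e2 := hA3 x hx
    have := mul_le_mul e1 e2 (amp_nonneg _ _) (inv_nonneg.2 (mm_nonneg _ _))
    rw [mul_one] at this
    exact this
  have i1 : ‖∫ x in a..w, (p.A x : ℂ) * cis (Φ x)‖ ≤ 400 * p.l := by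
    rcases h1 with h1 | h1
    · rw [h1, intervalIntegral.integral_same, norm_zero]; positivity
    have hlow := h.mono le_rfl hw.1 hw.2
    have haw : a ∈ Set.Icc a w := ⟨le_rfl, hw.1⟩
    have hww : w ∈ Set.Icc a w := ⟨hw.1, le_rfl⟩
    have hq1 : 2 / 100 ≤ p.q1 := by
      have hs := mm_sq (hlow.pos haw) (hlow.q1_lt haw)
      have : mm p.q1 a ≤ 1 / 2 := (h1 a haw).trans h.l_le
      have hm := hlow.m1_pos haw
      have h3 : 3 ≤ p.q1 / a ^ 2 := by nlinarith
      rw [le_div_iff₀ (pow_pos (hlow.pos haw) 2)] at h3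
      have := h.ha
      nlinarith
    have := hlow.norm_integral_le_integral (B := fun x => 8 / (2 / 100) * mm p.q1 x)
      (fun x hx => (hlow.hasDerivAt_m1 hx).const_mul _)
      (continuousOn_const.mul hlow.continuousOn_m1') (fun x hx =>
        (hA x ⟨hx.1, hx.2.trans hw.2⟩).trans (hlow.inv_m1_le hx (by norm_num) hq1))
    have e1 := h1 w hww
    have e2 := hlow.m1_pos haw
    refine this.trans ?_
    linarith
  have i2 : ‖∫ x in w..b, (p.A x : ℂ) * cis (Φ x)‖ ≤ 600 * p.l := by
    rcases h2 with h2 | h2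
    · rw [h2, intervalIntegral.integral_same, norm_zero]; positivity
    have hhi := h.mono hw.1 hw.2 le_rfl
    have hwm : w ∈ Set.Icc w b := ⟨le_rfl, hw.2⟩
    refine (hhi.norm_integral_le (K := 600 * p.l ^ 2) fun x hx =>
      (hhi.mono le_rfl hx.1 hx.2).cis_bound_caseB hq3).trans ?_
    have : p.A w ≤ p.l⁻¹ := (hA w hw).trans (inv_anti₀ hl (h2 w hwm))
    calc 600 * p.l ^ 2 * p.A w ≤ 600 * p.l ^ 2 * p.l⁻¹ := by gcongr
      _ = 600 * p.l := by field_simp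
  refine (norm_add_le _ _).trans ?_
  linarith

end CoreHyp

namespace CoreHyp
variable {p : CorePar} {Φ : ℝ → ℝ} {a b : ℝ}

lemma m3_sq (h : CoreHyp p Φ a b) {x : ℝ} (hx : x ∈ Set.Icc a b) :
    mm p.q1 x ^ 2 + (p.q1 - p.q3) / 4 ≤ mm p.q3 x ^ 2 ∧
      mm p.q3 x ^ 2 ≤ mm p.q1 x ^ 2 + 100 * (p.q1 - p.q3) := by
  have hx0 := h.pos hx
  have hx2 : x ≤ 2 := hx.2.trans h.hb
  have hx1 := h.ha.trans hx.1
  rw [mm_sq hx0 (h.q1_lt hx), mm_sq hx0 (h.q3_lt hx)]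
  have hκ : 0 ≤ p.q1 - p.q3 := by linarith [h.q21, h.q32]
  have e : (p.q1 - p.q3) / x ^ 2 = p.q1 / x ^ 2 - p.q3 / x ^ 2 := sub_div _ _ _
  have e1 : (p.q1 - p.q3) / 4 ≤ (p.q1 - p.q3) / x ^ 2 := by
    gcongr
    nlinarith
  have e2 : (p.q1 - p.q3) / x ^ 2 ≤ 100 * (p.q1 - p.q3) := by
    rw [div_le_iff₀ (by positivity)]
    have : 1 ≤ 100 * x ^ 2 := by nlinarith
    nlinarith
  constructor <;> linarith

/-- The ratio of two frequencies is increasing. -/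
lemma hasDerivAt_ratio {q q' x : ℝ} (hx : 0 < x) (hq : q < 4 * x ^ 2) (hq' : q' < 4 * x ^ 2) :
    HasDerivAt (fun y => (mm q y / mm q' y) ^ 3)
      (12 * (q - q') / x ^ 3 * (mm q x / mm q' x ^ 5)) x := by
  have hm := mm_pos hx hq
  have hm' := mm_pos hx hq'
  have h1 := mm_sq hx hq
  have h2 := mm_sq hx hq'
  refine (((hasDerivAt_mm hx hq).div (hasDerivAt_mm hx hq') hm'.ne').pow 3).congr_deriv ?_
  have e : q * mm q' x ^ 2 - q' * mm q x ^ 2 = 4 * (q - q') := by rw [h1, h2]; ring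
  rw [show 12 * (q - q') = 3 * (4 * (q - q')) by ring, ← e]
  simp
  field_simp

/-- `m₁³ N`. -/
def _root_.KG.CorePar.P (p : CorePar) (x : ℝ) : ℝ :=
  p.e1 * p.q1 ^ 2 + p.e2 * p.q2 ^ 2 * (mm p.q1 x / mm p.q2 x) ^ 3
    + p.e3 * p.q3 ^ 2 * (mm p.q1 x / mm p.q3 x) ^ 3

lemma P_eq (h : CoreHyp p Φ a b) {x : ℝ} (hx : x ∈ Set.Icc a b) :
    p.P x = mm p.q1 x ^ 3 * p.N x := by
  have h1 := h.m1_pos hx; have h2 := h.m2_pos hx; have h3 := h.m3_pos hx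
  unfold CorePar.P CorePar.N
  field_simp

lemma hasDerivAt_P (h : CoreHyp p Φ a b) {x : ℝ} (hx : x ∈ Set.Icc a b) :
    HasDerivAt p.P (p.e2 * p.q2 ^ 2 * (12 * (p.q1 - p.q2) / x ^ 3 * (mm p.q1 x / mm p.q2 x ^ 5))
      + p.e3 * p.q3 ^ 2 * (12 * (p.q1 - p.q3) / x ^ 3 * (mm p.q1 x / mm p.q3 x ^ 5))) x := by
  have hx0 := h.pos hx
  exact (((hasDerivAt_ratio hx0 (h.q1_lt hx) (h.q2_lt hx)).const_mul _).const_add _).add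
    ((hasDerivAt_ratio hx0 (h.q1_lt hx) (h.q3_lt hx)).const_mul _)

/-- Comparison of the frequencies on a dyadic chunk. -/
structure Chunk (p : CorePar) (a b μ B e : ℝ) : Prop where
  q3 : 1 / 100 ≤ p.q3
  μ_pos : 0 < μ
  B_pos : 0 < B
  e_pos : 0 < e
  e_le : e ≤ 1
  B4 : B ^ 4 = μ ^ 2 + (p.q1 - p.q3)
  key : p.l ^ 2 * B ^ 2 ≤ μ ^ 2 * e ^ 4
  lo : ∀ x ∈ Set.Icc a b, μ ≤ mm p.q1 x
  hi : ∀ x ∈ Set.Icc a b, mm p.q1 x ≤ 16 * μ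

lemma Chunk.mono {μ B e u v : ℝ} (c : Chunk p a b μ B e) (hu : a ≤ u) (hv : v ≤ b) :
    Chunk p u v μ B e :=
  { c with
    lo := fun x hx => c.lo x ⟨hu.trans hx.1, hx.2.trans hv⟩
    hi := fun x hx => c.hi x ⟨hu.trans hx.1, hx.2.trans hv⟩ }

lemma chunk_m3 (h : CoreHyp p Φ a b) {μ B e x : ℝ} (c : Chunk p a b μ B e)
    (hx : x ∈ Set.Icc a b) : B ^ 2 / 2 ≤ mm p.q3 x ∧ mm p.q3 x ≤ 16 * B ^ 2 := by
  have hm := h.m3_pos hx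
  obtain ⟨h1, h2⟩ := h.m3_sq hx
  have hκ : 0 ≤ p.q1 - p.q3 := by linarith [h.q21, h.q32]
  have hB := c.B4; have hB0 := c.B_pos; have hμ := c.μ_pos
  have lo := c.lo x hx; have hi := c.hi x hx
  constructor
  · refine le_of_sq_le_sq₀ ?_ hm.le
    nlinarith
  · refine le_of_sq_le_sq₀ ?_ (by positivity)
    have : mm p.q1 x ^ 2 ≤ (16 * μ) ^ 2 := by
      have := h.m1_pos hx
      gcongr
    nlinarith
where
  le_of_sq_le_sq₀ {x y : ℝ} (h : x ^ 2 ≤ y ^ 2) (hy : 0 ≤ y) : x ≤ y := by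
    nlinarith [abs_le_of_sq_le_sq h hy, le_abs_self x]

lemma chunk_third (h : CoreHyp p Φ a b) {μ B e : ℝ} (c : Chunk p a b μ B e)
    (hN : ∀ x ∈ Set.Icc a b, p.q3 ^ 2 / mm p.q3 x ^ 3 / 2 ≤ |p.N x|) :
    ‖∫ x in a..b, cis (Φ x)‖ ≤ 4600000 * (p.l * μ * B * e) := by
  have hl := h.l_pos; have hL := h.lam_pos; have hB0 := c.B_pos; have hμ := c.μ_pos
  have he := c.e_pos
  have := vdc_third (v0 := p.lam / 4) (ρ := 1 / (1310720000 * B ^ 6))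
    (d := 2000 * (p.l * μ * B * e)) h.hab h.isPhase (by positivity)
    (fun x hx => h.F'_lower hx) (fun x hx => h.hasDerivAt_g hx) (by positivity)
    (fun x hx => ?_) (by positivity) ?_
  · have : 0 < p.l * μ * B * e := by positivity
    linarith
  · refine le_trans ?_ (h.g'_lower hx)
    have h1 := hN x hx
    have h3 := (h.chunk_m3 c hx).2
    have hm3 := h.m3_pos hx
    have : (1 / 100) ^ 2 / (16 * B ^ 2) ^ 3 ≤ p.q3 ^ 2 / mm p.q3 x ^ 3 := by
      have := c.q3
      gcongr
    have e : (1 / 100 : ℝ) ^ 2 / (16 * B ^ 2) ^ 3 = 32 * (1 / (1310720000 * B ^ 6)) := by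
      field_simp; norm_num
    rw [e] at this
    linarith
  · have k1 : p.l * B ≤ μ * e := by
      have k2 : p.l * B ≤ μ * e ^ 2 := by
        have := c.key
        refine abs_le_of_sq_le_sq' ?_ (by positivity) |>.2
        calc _ = p.l ^ 2 * B ^ 2 := by ring
          _ ≤ _ := this
          _ = _ := by ring
      have := c.e_le
      have : μ * e ^ 2 ≤ μ * e := by
        gcongr; nlinarith
      linarith
    have k3 : (p.l * B) ^ 3 ≤ (μ * e) ^ 3 := by gcongr
    have k4 : p.lam * p.l ^ 3 * (p.l * B) ^ 3 ≤ p.lam * p.l ^ 3 * (μ * e) ^ 3 := by gcongr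
    have k5 : p.lam * p.l ^ 3 * (p.l * B) ^ 3 = B ^ 3 := by
      calc _ = p.lam * p.l ^ 6 * B ^ 3 := by ring
        _ = _ := by rw [h.lam_l, one_mul]
    rw [k5] at k4
    have : p.lam / 4 * (1 / (1310720000 * B ^ 6)) * (2000 * (p.l * μ * B * e)) ^ 3
      = 8000000000 / 5242880000 * ((p.lam * p.l ^ 3 * (μ * e) ^ 3) / B ^ 3) := by
      field_simp; norm_num
    rw [this]
    have : 1 ≤ (p.lam * p.l ^ 3 * (μ * e) ^ 3) / B ^ 3 := by
      rw [one_le_div (by positivity)]; exact k4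
    linarith

lemma chunk_fourth (h : CoreHyp p Φ a b) {μ B e : ℝ} (c : Chunk p a b μ B e)
    (he2 : p.e2 = -p.e1) (he3 : p.e3 = -p.e1) (hκ : μ ^ 2 / 10000 ≤ p.q1 - p.q3) :
    ‖∫ x in a..b, cis (Φ x)‖ ≤ 4600000 * (p.l * μ * B * e) := by
  have hl := h.l_pos; have hL := h.lam_pos; have hB0 := c.B_pos; have hμ := c.μ_pos
  have he := c.e_pos
  have := vdc_fourth (v0 := p.lam / 4) (w := 1 / (65536 * μ ^ 3)) (ρ := μ / (10 ^ 14 * B ^ 6))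
    (d := 100000 * (p.l * μ * B * e)) h.hab h.isPhase (by positivity)
    (fun x hx => h.F'_lower hx) (fun x hx => h.hasDerivAt_g hx) (by positivity)
    (fun x hx => ?_) (fun x hx => h.hasDerivAt_P hx) (by positivity) (fun x hx => ?_)
    (by positivity) ?_
  · linarith
  · refine le_trans ?_ (h.g'_lower hx)
    have hm1 := h.m1_pos hx
    rw [h.P_eq hx, abs_mul, abs_of_pos (by positivity), ← mul_assoc, div_eq_mul_inv |p.N x|,
      mul_comm |p.N x|]
    gcongr
    have : mm p.q1 x ^ 3 ≤ (16 * μ) ^ 3 := by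
      have := c.hi x hx
      gcongr
    rw [div_mul_eq_mul_div, one_mul, div_le_iff₀ (by positivity)]
    nlinarith
  · have hx0 := h.pos hx
    have hx2 : x ≤ 2 := hx.2.trans h.hb
    have hm1 := h.m1_pos hx; have hm2 := h.m2_pos hx; have hm3 := h.m3_pos hx
    have h21 := h.q21; have h32 := h.q32
    have hq3 := c.q3
    have n2 : 0 ≤ p.q2 ^ 2 * (12 * (p.q1 - p.q2) / x ^ 3 * (mm p.q1 x / mm p.q2 x ^ 5)) := by
      have : 0 ≤ p.q1 - p.q2 := by linarith
      positivity
    have n3 : 0 ≤ p.q3 ^ 2 * (12 * (p.q1 - p.q3) / x ^ 3 * (mm p.q1 x / mm p.q3 x ^ 5)) := by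
      have : 0 ≤ p.q1 - p.q3 := by linarith
      positivity
    have n4 : μ / (10 ^ 14 * B ^ 6) ≤
        p.q3 ^ 2 * (12 * (p.q1 - p.q3) / x ^ 3 * (mm p.q1 x / mm p.q3 x ^ 5)) := by
      have i1 : B ^ 4 / 10001 ≤ p.q1 - p.q3 := by rw [c.B4]; linarith
      have i2 : x ^ 3 ≤ 2 ^ 3 := by gcongr
      have i3 := c.lo x hx
      have i4 := (h.chunk_m3 c hx).2
      calc μ / (10 ^ 14 * B ^ 6)
          ≤ (1 / 100) ^ 2 * (12 * (B ^ 4 / 10001) / 2 ^ 3 * (μ / (16 * B ^ 2) ^ 5)) := by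
            have : (1 / 100 : ℝ) ^ 2 * (12 * (B ^ 4 / 10001) / 2 ^ 3 * (μ / (16 * B ^ 2) ^ 5))
              = (12 / (10000 * 10001 * 8 * 1048576)) * (μ / B ^ 6) := by
              field_simp; norm_num
            rw [this, show μ / (10 ^ 14 * B ^ 6) = 1 / 10 ^ 14 * (μ / B ^ 6) by field_simp]
            have : (1 : ℝ) / 10 ^ 14 ≤ 12 / (10000 * 10001 * 8 * 1048576) := by norm_num
            gcongr
        _ ≤ _ := by
          have : 0 ≤ p.q1 - p.q3 := by linarith
          gcongr
    have : ∀ e u v : ℝ, (e = 1 ∨ e = -1) → 0 ≤ u → 0 ≤ v → v ≤ |-e * u + -e * v| := by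
      intro e u v he hu hv
      rcases he with rfl | rfl
      · rw [abs_of_nonpos (by linarith)]; linarith
      · rw [abs_of_nonneg (by linarith)]; linarith
    refine n4.trans ?_
    rw [he2, he3, mul_assoc, mul_assoc (-p.e1) (p.q3 ^ 2)]
    exact this _ _ _ h.he1 n2 n3
  · have k4 : B ^ 2 ≤ p.lam * p.l ^ 4 * (μ ^ 2 * e ^ 4) := by
      calc B ^ 2 = p.lam * p.l ^ 4 * (p.l ^ 2 * B ^ 2) := by
            rw [show p.lam * p.l ^ 4 * (p.l ^ 2 * B ^ 2) = p.lam * p.l ^ 6 * B ^ 2 by ring,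
              h.lam_l, one_mul]
        _ ≤ _ := by have := c.key; gcongr
    have : p.lam / 4 * (1 / (65536 * μ ^ 3)) * (μ / (10 ^ 14 * B ^ 6)) *
        (100000 * (p.l * μ * B * e)) ^ 4
      = 10 ^ 6 / 262144 * ((p.lam * p.l ^ 4 * (μ ^ 2 * e ^ 4)) / B ^ 2) := by
      field_simp; norm_num
    rw [this]
    have : 1 ≤ (p.lam * p.l ^ 4 * (μ ^ 2 * e ^ 4)) / B ^ 2 := by
      rw [one_le_div (by positivity)]; exact k4
    linarith

lemma chunk_cis (h : CoreHyp p Φ a b) {μ B e : ℝ} (c : Chunk p a b μ B e) :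
    ‖∫ x in a..b, cis (Φ x)‖ ≤ 4600000 * (p.l * μ * B * e) := by
  have hμ := c.μ_pos
  by_cases hcase : p.e2 = -p.e1 ∧ p.e3 = -p.e1
  · obtain ⟨he2, he3⟩ := hcase
    rcases le_total (μ ^ 2 / 10000) (p.q1 - p.q3) with hκ | hκ
    · exact h.chunk_fourth c he2 he3 hκ
    refine h.chunk_third c fun x hx => ?_
    obtain ⟨t0, t1, t2⟩ := h.t_mono hx
    have hm1 := h.m1_pos hx; have hm3 := h.m3_pos hx
    have hq3 := c.q3
    have h21 := h.q21; have h32 := h.q32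
    have hlo := c.lo x hx
    have hμ2 : μ ≤ 2 := hlo.trans (mm_le_two (h.pos hx) h.q1_nonneg)
    have key : p.q1 ^ 2 / mm p.q1 x ^ 3 ≤ 3 / 2 * (p.q3 ^ 2 / mm p.q3 x ^ 3) := by
      have hq : p.q1 ≤ 104 / 100 * p.q3 := by nlinarith
      have hm : mm p.q3 x ≤ 101 / 100 * mm p.q1 x := by
        have h2 := (h.m3_sq hx).2
        refine (abs_le_of_sq_le_sq' ?_ (by positivity)).2
        nlinarith
      have hq' : p.q1 ^ 2 ≤ (104 / 100 * p.q3) ^ 2 := by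
        have := h.q1_nonneg
        gcongr
      have hm' : mm p.q3 x ^ 3 ≤ (101 / 100 * mm p.q1 x) ^ 3 := by gcongr
      rw [mul_div_assoc', div_le_div_iff₀ (by positivity) (by positivity)]
      calc p.q1 ^ 2 * mm p.q3 x ^ 3
          ≤ (104 / 100 * p.q3) ^ 2 * (101 / 100 * mm p.q1 x) ^ 3 := by gcongr
        _ = (104 / 100) ^ 2 * (101 / 100) ^ 3 * (p.q3 ^ 2 * mm p.q1 x ^ 3) := by ring
        _ ≤ 3 / 2 * (p.q3 ^ 2 * mm p.q1 x ^ 3) := by gcongr; norm_num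
        _ = _ := by ring
    unfold CorePar.N
    rw [he2, he3]
    rcases h.he1 with e1 | e1 <;> rw [e1]
    · exact le_trans (by linarith) (neg_le_abs _)
    · exact le_trans (by linarith) (le_abs_self _)
  · refine h.chunk_third c fun x hx => ?_
    obtain ⟨t0, t1, t2⟩ := h.t_mono hx
    unfold CorePar.N
    rcases h.he1 with e1 | e1 <;> rcases h.he2 with e2 | e2 <;> rcases h.he3 with e3 | e3 <;>
      rw [e1, e2, e3] <;> rw [e1, e2, e3] at hcase
    all_goals first
      | exact le_trans (by linarith) (le_abs_self _)
      | exact le_trans (by linarith) (neg_le_abs _)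
      | exact absurd ⟨by norm_num, by norm_num⟩ hcase

lemma chunk_core (h : CoreHyp p Φ a b) {μ B e : ℝ} (c : Chunk p a b μ B e) :
    ‖∫ x in a..b, (p.A x : ℂ) * cis (Φ x)‖ ≤ 10 ^ 7 * (p.l * e) := by
  have hl := h.l_pos; have hB0 := c.B_pos; have hμ := c.μ_pos
  have he := c.e_pos
  have ha : a ∈ Set.Icc a b := ⟨le_rfl, h.hab⟩
  have hA : p.A a ≤ μ⁻¹ * (1 / (B / 2)) := by
    refine mul_le_mul ((h.amp12_le ha).trans (inv_anti₀ hμ (c.lo a ha))) ?_ (amp_nonneg _ _)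
      (by positivity)
    refine amp_le_of_le_sq (by positivity) ?_
    have := (h.chunk_m3 c ha).1
    nlinarith
  refine (h.norm_integral_le (K := 4600000 * (p.l * μ * B * e)) fun x hx =>
    (h.mono le_rfl hx.1 hx.2).chunk_cis (c.mono le_rfl hx.2)).trans ?_
  calc 4600000 * (p.l * μ * B * e) * p.A a
      ≤ 4600000 * (p.l * μ * B * e) * (μ⁻¹ * (1 / (B / 2))) := by gcongr
    _ = 9200000 * (p.l * e) := by field_simp; norm_num
    _ ≤ _ := by gcongr; norm_num

lemma exists_chunk (h : CoreHyp p Φ a b) (hq3 : 1 / 100 ≤ p.q3) {k : ℝ} (hk : 0 ≤ k)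
    (hk4 : k ^ 4 = p.q1 - p.q3) (n : ℕ)
    (hlo : ∀ x ∈ Set.Icc a b, 16 ^ n * (p.l * (p.l + k)) ≤ mm p.q1 x)
    (hhi : ∀ x ∈ Set.Icc a b, mm p.q1 x ≤ 16 ^ (n + 1) * (p.l * (p.l + k))) :
    ∃ B, Chunk p a b (16 ^ n * (p.l * (p.l + k))) B ((1 / 2) ^ n) := by
  have hl := h.l_pos
  set μ₀ := p.l * (p.l + k) with hμ₀
  have hμ0 : 0 < μ₀ := by positivity
  have h16 : (1 : ℝ) ≤ 16 ^ n := one_le_pow₀ (by norm_num)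
  set μ := 16 ^ n * μ₀ with hμ
  have hμp : 0 < μ := by positivity
  have hp : 0 < μ ^ 2 + k ^ 4 := by positivity
  have hB : 0 < √√(μ ^ 2 + k ^ 4) := Real.sqrt_pos.2 (Real.sqrt_pos.2 hp)
  have hB2 : √√(μ ^ 2 + k ^ 4) ^ 2 = √(μ ^ 2 + k ^ 4) := Real.sq_sqrt (Real.sqrt_nonneg _)
  refine ⟨√√(μ ^ 2 + k ^ 4), hq3, hμp, hB, by positivity, pow_le_one₀ (by norm_num) (by norm_num),
    ?_, ?_, hlo, fun x hx => (hhi x hx).trans (le_of_eq (by rw [hμ, pow_succ]; ring))⟩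
  · rw [show √√(μ ^ 2 + k ^ 4) ^ 4 = (√√(μ ^ 2 + k ^ 4) ^ 2) ^ 2 by ring, hB2,
      Real.sq_sqrt hp.le, hk4]
  · rw [hB2]
    have e1 : √(μ ^ 2 + k ^ 4) ≤ μ + k ^ 2 := by
      rw [Real.sqrt_le_left (by positivity)]
      have : 0 ≤ μ * k ^ 2 := by positivity
      nlinarith
    have e2 : μ ^ 2 * ((1 / 2) ^ n) ^ 4 = 16 ^ n * μ₀ ^ 2 := by
      rw [hμ, mul_pow, ← pow_mul, ← pow_mul, mul_comm n 2, mul_comm n 4, pow_mul, pow_mul]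
      have : ((1 / 2 : ℝ) ^ 4) ^ n * (16 ^ 2) ^ n = 16 ^ n := by
        rw [← mul_pow]; norm_num
      calc _ = ((1 / 2 : ℝ) ^ 4) ^ n * (16 ^ 2) ^ n * μ₀ ^ 2 := by ring
        _ = _ := by rw [this]
    rw [e2]
    calc p.l ^ 2 * √(μ ^ 2 + k ^ 4) ≤ p.l ^ 2 * (16 ^ n * μ₀ + 16 ^ n * k ^ 2) := by
          gcongr
          refine e1.trans ?_
          rw [hμ]
          have : 0 ≤ k ^ 2 := by positivity
          nlinarith
      _ = 16 ^ n * (p.l ^ 2 * (p.l * (p.l + k) + k ^ 2)) := by rw [hμ₀]; ring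
      _ ≤ 16 ^ n * (p.l ^ 2 * (p.l + k) ^ 2) := by
          gcongr
          nlinarith [mul_nonneg hl.le hk]
      _ = _ := by rw [hμ₀]; ring

lemma core_high (hq3 : 1 / 100 ≤ p.q3) {k : ℝ} (hk : 0 ≤ k) (hk4 : k ^ 4 = p.q1 - p.q3) (n : ℕ) :
    ∀ a b : ℝ, CoreHyp p Φ a b → (∀ x ∈ Set.Icc a b, p.l * (p.l + k) ≤ mm p.q1 x) →
      (∀ x ∈ Set.Icc a b, mm p.q1 x ≤ 16 ^ n * (p.l * (p.l + k))) →
      ‖∫ x in a..b, (p.A x : ℂ) * cis (Φ x)‖ ≤ 10 ^ 7 * p.l * (3 - 2 * (1 / 2) ^ n) := by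
  induction n with
  | zero =>
    intro a b h hlo hhi
    have hl := h.l_pos
    obtain ⟨B, hB⟩ := h.exists_chunk hq3 hk hk4 0 (by simpa using hlo) (fun x hx => by
      have e := hhi x hx
      rw [pow_zero, one_mul] at e
      have : 0 < p.l * (p.l + k) := by positivity
      norm_num
      linarith)
    refine (h.chunk_core hB).trans (le_of_eq ?_)
    norm_num
  | succ n ih =>
    intro a b h hlo hhi
    have hl := h.l_pos
    obtain ⟨w, hw, h1, h2⟩ := h.split_m1 (16 ^ n * (p.l * (p.l + k)))
    have i1 : ‖∫ x in a..w, (p.A x : ℂ) * cis (Φ x)‖ ≤ 10 ^ 7 * p.l * (3 - 2 * (1 / 2) ^ n) := by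
      rcases h1 with h1 | h1
      · rw [h1, intervalIntegral.integral_same, norm_zero]
        have : (1 / 2 : ℝ) ^ n ≤ 1 := pow_le_one₀ (by norm_num) (by norm_num)
        have : 0 ≤ 3 - 2 * (1 / 2 : ℝ) ^ n := by linarith
        positivity
      · exact ih a w (h.mono le_rfl hw.1 hw.2) (fun x hx => hlo x ⟨hx.1, hx.2.trans hw.2⟩) h1
    have i2 : ‖∫ x in w..b, (p.A x : ℂ) * cis (Φ x)‖ ≤ 10 ^ 7 * (p.l * (1 / 2) ^ n) := by
      rcases h2 with h2 | h2
      · rw [h2, intervalIntegral.integral_same, norm_zero]; positivity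
      · have h' := h.mono hw.1 hw.2 le_rfl
        obtain ⟨B, hB⟩ := h'.exists_chunk hq3 hk hk4 n h2
          (fun x hx => hhi x ⟨hw.1.trans hx.1, hx.2⟩)
        exact h'.chunk_core hB
    rw [h.integral_split hw]
    refine (norm_add_le _ _).trans ((add_le_add i1 i2).trans (le_of_eq ?_))
    rw [pow_succ]
    ring

lemma core_low (h : CoreHyp p Φ a b) (hq3 : 1 / 100 ≤ p.q3) {k : ℝ} (hk : 0 ≤ k)
    (hk4 : k ^ 4 = p.q1 - p.q3) (hhi : ∀ x ∈ Set.Icc a b, mm p.q1 x ≤ p.l * (p.l + k)) :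
    ‖∫ x in a..b, (p.A x : ℂ) * cis (Φ x)‖ ≤ 3200 * p.l := by
  have hl := h.l_pos
  have hq1 : 1 / 100 ≤ p.q1 := hq3.trans (h.q32.trans h.q21)
  have ha : a ∈ Set.Icc a b := ⟨le_rfl, h.hab⟩
  have hb : b ∈ Set.Icc a b := ⟨h.hab, le_rfl⟩
  have hA : ∀ x ∈ Set.Icc a b, p.A x ≤ (mm p.q1 x)⁻¹ * amp p.q3 x := fun x hx =>
    mul_le_mul_of_nonneg_right (h.amp12_le hx) (amp_nonneg _ _)
  rcases le_total p.l k with hlk | hlk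
  · have hk0 : 0 < k := hl.trans_le hlk
    have := h.norm_integral_le_integral (B := fun x => 2 / k * (8 / (1 / 100) * mm p.q1 x))
      (fun x hx => ((h.hasDerivAt_m1 hx).const_mul _).const_mul _)
      (continuousOn_const.mul (continuousOn_const.mul h.continuousOn_m1')) (fun x hx => by
        refine (hA x hx).trans ?_
        rw [mul_comm]
        refine mul_le_mul ?_ (h.inv_m1_le hx (by norm_num) hq1) (inv_nonneg.2 (mm_nonneg _ _))
          (by positivity)
        refine (amp_le_of_le_sq (c := k / 2) (by positivity) ?_).trans (le_of_eq (by field_simp))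
        have h3 := (h.m3_sq hx).1
        rw [← hk4] at h3
        refine (abs_le_of_sq_le_sq' ?_ (mm_nonneg _ _)).2
        have : 0 ≤ mm p.q1 x ^ 2 := sq_nonneg _
        nlinarith [pow_pos hk0 4])
    refine this.trans ?_
    have e1 := hhi b hb
    have e2 := mm_nonneg p.q1 a
    calc 2 / k * (8 / (1 / 100) * mm p.q1 b) - 2 / k * (8 / (1 / 100) * mm p.q1 a)
        ≤ 2 / k * (8 / (1 / 100) * (p.l * (p.l + k))) - 0 := by gcongr; positivity
      _ ≤ 2 / k * (8 / (1 / 100) * (p.l * (k + k))) - 0 := by gcongr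
      _ = 3200 * p.l := by field_simp; ring
  · have hsq : ∀ x ∈ Set.Icc a b, HasDerivAt (fun x => √(mm p.q1 x))
        (p.q1 / (x ^ 3 * mm p.q1 x) / (2 * √(mm p.q1 x))) x := fun x hx =>
      (h.hasDerivAt_m1 hx).sqrt (h.m1_pos hx).ne'
    have := h.norm_integral_le_integral (B := fun x => 1600 * √(mm p.q1 x))
      (fun x hx => (hsq x hx).const_mul _)
      (continuousOn_const.mul (h.continuousOn_m1'.div (continuousOn_const.mul
        (fun x hx => (hsq x hx).continuousAt.continuousWithinAt)) fun x hx =>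
          (mul_pos two_pos (Real.sqrt_pos.2 (h.m1_pos hx))).ne')) (fun x hx => by
        refine (hA x hx).trans ?_
        have hs := Real.sqrt_pos.2 (h.m1_pos hx)
        have e1 := h.inv_m1_le hx (by norm_num) hq1
        have e2 : amp p.q3 x ≤ (√(mm p.q1 x))⁻¹ :=
          amp_mono (h.pos hx) (h.q1_lt hx) (h.q32.trans h.q21)
        calc (mm p.q1 x)⁻¹ * amp p.q3 x
            ≤ 8 / (1 / 100) * (p.q1 / (x ^ 3 * mm p.q1 x)) * (√(mm p.q1 x))⁻¹ :=
              mul_le_mul e1 e2 (amp_nonneg _ _) ((inv_nonneg.2 (mm_nonneg _ _)).trans e1)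
          _ = _ := by ring)
    refine this.trans ?_
    have e1 : √(mm p.q1 b) ≤ 2 * p.l := by
      rw [Real.sqrt_le_left (by positivity)]
      have := hhi b hb
      nlinarith
    have e2 := Real.sqrt_nonneg (mm p.q1 a)
    linarith

lemma core_caseA (h : CoreHyp p Φ a b) (hq3 : 1 / 100 ≤ p.q3) :
    ‖∫ x in a..b, (p.A x : ℂ) * cis (Φ x)‖ ≤ 4 * 10 ^ 7 * p.l := by
  have hl := h.l_pos
  have hκ : 0 ≤ p.q1 - p.q3 := by linarith [h.q21, h.q32]
  set k := √√(p.q1 - p.q3) with hkdef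
  have hk : 0 ≤ k := Real.sqrt_nonneg _
  have hk4 : k ^ 4 = p.q1 - p.q3 := by
    rw [show k ^ 4 = (k ^ 2) ^ 2 by ring, hkdef, Real.sq_sqrt (Real.sqrt_nonneg _),
      Real.sq_sqrt hκ]
  have hμ : 0 < p.l * (p.l + k) := by positivity
  obtain ⟨w, hw, h1, h2⟩ := h.split_m1 (p.l * (p.l + k))
  obtain ⟨n, hn⟩ := pow_unbounded_of_one_lt (2 / (p.l * (p.l + k))) (by norm_num : (1 : ℝ) < 16)
  rw [div_lt_iff₀ hμ] at hn
  have i1 : ‖∫ x in a..w, (p.A x : ℂ) * cis (Φ x)‖ ≤ 3200 * p.l := by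
    rcases h1 with h1 | h1
    · rw [h1, intervalIntegral.integral_same, norm_zero]; positivity
    · exact (h.mono le_rfl hw.1 hw.2).core_low hq3 hk hk4 h1
  have i2 : ‖∫ x in w..b, (p.A x : ℂ) * cis (Φ x)‖ ≤ 3 * 10 ^ 7 * p.l := by
    rcases h2 with h2 | h2
    · rw [h2, intervalIntegral.integral_same, norm_zero]; positivity
    · refine (core_high hq3 hk hk4 n w b (h.mono hw.1 hw.2 le_rfl) h2 fun x hx => ?_).trans ?_
      · exact (mm_le_two (h.pos ⟨hw.1.trans hx.1, hx.2⟩) h.q1_nonneg).trans hn.le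
      · have : 0 ≤ (1 / 2 : ℝ) ^ n := by positivity
        nlinarith
  rw [h.integral_split hw]
  refine (norm_add_le _ _).trans ?_
  linarith

/-- The reduced one-dimensional integral is bounded by the scale `l`. -/
theorem core_bound (h : CoreHyp p Φ a b) :
    ‖∫ x in a..b, (p.A x : ℂ) * cis (Φ x)‖ ≤ 4 * 10 ^ 7 * p.l := by
  have hl := h.l_pos
  rcases le_or_gt (1 / 100) p.q3 with hq3 | hq3
  · exact h.core_caseA hq3
  · exact (h.core_caseB hq3).trans (by linarith)

end CoreHyp

/-- The bound `CoreHyp.core_bound` without an ordering of the three velocities. -/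
theorem core_bound_perm {l lam a b : ℝ} {q e : Fin 3 → ℝ} {Φ : ℝ → ℝ} (hl : 0 < l)
    (hl2 : l ≤ 1 / 2) (hlam : lam * l ^ 6 = 1) (hq0 : ∀ j, 0 ≤ q j)
    (he : ∀ j, e j = 1 ∨ e j = -1) (ha : 1 / 10 ≤ a) (hab : a ≤ b) (hb : b ≤ 2)
    (hq : ∀ j, q j < 4 * a ^ 2)
    (hΦ : ∀ x ∈ Set.Icc a b,
      HasDerivAt Φ (lam * (7 - 1 / (4 * x ^ 2) + ∑ j, e j * mm (q j) x)) x) :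
    ‖∫ x in a..b, ((∏ j, amp (q j) x : ℝ) : ℂ) * cis (Φ x)‖ ≤ 4 * 10 ^ 7 * l := by
  set σ := Tuple.sort q
  have hm : Monotone (q ∘ σ) := Tuple.monotone_sort q
  let p : CorePar := ⟨l, lam, q (σ 2), q (σ 1), q (σ 0), e (σ 2), e (σ 1), e (σ 0)⟩
  have h : CoreHyp p Φ a b :=
    { l_pos := hl
      l_le := hl2
      lam_l := hlam
      q3_nonneg := hq0 _
      q32 := hm (by decide : (0 : Fin 3) ≤ 1)
      q21 := hm (by decide : (1 : Fin 3) ≤ 2)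
      ha := ha
      hab := hab
      hb := hb
      hq := hq _
      he1 := he _
      he2 := he _
      he3 := he _
      hΦ := fun x hx => by
        refine (hΦ x hx).congr_deriv ?_
        rw [← Equiv.sum_comp σ, Fin.sum_univ_three]
        simp only [CorePar.F, p]
        ring }
  have e1 : ∀ x, ∏ j, amp (q j) x = p.A x := fun x => by
    rw [← Equiv.prod_comp σ, Fin.prod_univ_three]
    simp only [CorePar.A, p]
    ring
  simp only [e1]
  exact h.core_bound

/-- A continuously differentiable amplitude on `[a, b]` with modulus and variation at most `M`. -/
structure BVOn (c c' : ℝ → ℂ) (a b M : ℝ) : Prop where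
  deriv : ∀ x ∈ Set.Icc a b, HasDerivAt c (c' x) x
  cont' : ContinuousOn c' (Set.Icc a b)
  bound : ∀ x ∈ Set.Icc a b, ‖c x‖ ≤ M
  var : ∫ x in a..b, ‖c' x‖ ≤ M

namespace BVOn
variable {c c' c₁ c₁' c₂ c₂' : ℝ → ℂ} {a b M M₁ M₂ : ℝ}

lemma continuousOn (h : BVOn c c' a b M) : ContinuousOn c (Set.Icc a b) := fun x hx =>
  (h.deriv x hx).continuousAt.continuousWithinAt

lemma mono (h : BVOn c c' a b M) {u v : ℝ} (hu : a ≤ u) (huv : u ≤ v) (hv : v ≤ b) :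
    BVOn c c' u v M where
  deriv x hx := h.deriv x ⟨hu.trans hx.1, hx.2.trans hv⟩
  cont' := h.cont'.mono (Set.Icc_subset_Icc hu hv)
  bound x hx := h.bound x ⟨hu.trans hx.1, hx.2.trans hv⟩
  var := by
    refine le_trans ?_ h.var
    exact intervalIntegral.integral_mono_interval hu huv hv
      (Filter.Eventually.of_forall fun x => norm_nonneg _)
      (h.cont'.norm.intervalIntegrable_of_Icc (hu.trans (huv.trans hv)))

lemma le (h : BVOn c c' a b M) (hM : M ≤ M₁) : BVOn c c' a b M₁ :=
  ⟨h.deriv, h.cont', fun x hx => (h.bound x hx).trans hM, h.var.trans hM⟩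

lemma mul (hab : a ≤ b) (h₁ : BVOn c₁ c₁' a b M₁) (h₂ : BVOn c₂ c₂' a b M₂) :
    BVOn (fun x => c₁ x * c₂ x) (fun x => c₁' x * c₂ x + c₁ x * c₂' x) a b (2 * M₁ * M₂) := by
  have ha : a ∈ Set.Icc a b := ⟨le_rfl, hab⟩
  have hM₁ : 0 ≤ M₁ := (norm_nonneg _).trans (h₁.bound a ha)
  have hM₂ : 0 ≤ M₂ := (norm_nonneg _).trans (h₂.bound a ha)
  refine ⟨fun x hx => (h₁.deriv x hx).mul (h₂.deriv x hx),
    (h₁.cont'.mul h₂.continuousOn).add (h₁.continuousOn.mul h₂.cont'), fun x hx => ?_, ?_⟩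
  · rw [norm_mul]
    have := mul_le_mul (h₁.bound x hx) (h₂.bound x hx) (norm_nonneg _) hM₁
    nlinarith [mul_nonneg hM₁ hM₂]
  · have i₁ := h₁.cont'.norm.intervalIntegrable_of_Icc (μ := volume) hab
    have i₂ := h₂.cont'.norm.intervalIntegrable_of_Icc (μ := volume) hab
    calc ∫ x in a..b, ‖c₁' x * c₂ x + c₁ x * c₂' x‖
        ≤ ∫ x in a..b, (‖c₁' x‖ * M₂ + M₁ * ‖c₂' x‖) := by
          refine intervalIntegral.integral_mono_on hab
            (((h₁.cont'.mul h₂.continuousOn).add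
              (h₁.continuousOn.mul h₂.cont')).norm.intervalIntegrable_of_Icc hab)
            ((i₁.mul_const _).add (i₂.const_mul _)) fun x hx => ?_
          refine (norm_add_le _ _).trans ?_
          rw [norm_mul, norm_mul]
          exact add_le_add (mul_le_mul_of_nonneg_left (h₂.bound x hx) (norm_nonneg _))
            (mul_le_mul_of_nonneg_right (h₁.bound x hx) (norm_nonneg _))
      _ = (∫ x in a..b, ‖c₁' x‖) * M₂ + M₁ * ∫ x in a..b, ‖c₂' x‖ := by
          rw [intervalIntegral.integral_add (i₁.mul_const _) (i₂.const_mul _),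
            intervalIntegral.integral_mul_const, intervalIntegral.integral_const_mul]
      _ ≤ M₁ * M₂ + M₁ * M₂ := by
          gcongr
          · exact h₁.var
          · exact h₂.var
      _ = 2 * M₁ * M₂ := by ring

lemma const (z : ℂ) (a b : ℝ) : BVOn (fun _ => z) (fun _ => 0) a b ‖z‖ :=
  ⟨fun x _ => hasDerivAt_const x z, continuousOn_const, fun _ _ => le_rfl, by simp⟩

lemma conj (h : BVOn c c' a b M) :
    BVOn (fun x => starRingEnd ℂ (c x)) (fun x => starRingEnd ℂ (c' x)) a b M where
  deriv x hx := (Complex.conjCLE.toContinuousLinearMap.hasFDerivAt.comp_hasDerivAt x (h.deriv x hx))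
  cont' := Complex.continuous_conj.comp_continuousOn h.cont'
  bound x hx := by rw [RCLike.norm_conj]; exact h.bound x hx
  var := by simpa only [RCLike.norm_conj] using h.var

lemma norm_integral_mul_le (h : BVOn c c' a b M) {f : ℝ → ℂ} {K : ℝ} (hab : a ≤ b)
    (hf : ContinuousOn f (Set.Icc a b)) (hK : ∀ x ∈ Set.Icc a b, ‖∫ y in a..x, f y‖ ≤ K) :
    ‖∫ x in a..b, c x * f x‖ ≤ 2 * K * M := by
  refine (KG.norm_integral_mul_le hab hf hK h.deriv h.cont').trans ?_
  have hK0 : 0 ≤ K := (norm_nonneg _).trans (hK a ⟨le_rfl, hab⟩)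
  have := h.bound b ⟨hab, le_rfl⟩
  nlinarith [h.var]

end BVOn

/-- Differentiation of an oscillatory integral with respect to a linear parameter. -/
lemma hasDerivAt_integral_cis {k : ℝ → ℂ} {f g : ℝ → ℝ} {a b : ℝ} (hk : Continuous k)
    (hf : Continuous f) (hg : Continuous g) (z : ℝ) :
    HasDerivAt (fun z : ℝ => ∫ θ in a..b, k θ * cis (f θ + z * g θ))
      (∫ θ in a..b, (Complex.I * g θ * k θ) * cis (f θ + z * g θ)) z := by
  have hc := continuous_cis
  refine (intervalIntegral.hasDerivAt_integral_of_dominated_loc_of_deriv_le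
    (F := fun z θ => k θ * cis (f θ + z * g θ))
    (F' := fun z θ => (Complex.I * g θ * k θ) * cis (f θ + z * g θ))
    (s := Set.univ) (bound := fun θ => ‖g θ‖ * ‖k θ‖)
    Filter.univ_mem ?_ ?_ ?_ ?_ ?_ ?_).2
  · exact Filter.Eventually.of_forall fun z =>
      (Continuous.aestronglyMeasurable (by fun_prop))
  · exact Continuous.intervalIntegrable (by fun_prop) _ _
  · exact (Continuous.aestronglyMeasurable (by fun_prop))
  · refine Filter.Eventually.of_forall fun θ _ x _ => ?_
    simp [norm_cis]
  · exact Continuous.intervalIntegrable (by fun_prop) _ _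
  · refine Filter.Eventually.of_forall fun θ _ x _ => ?_
    have := (hasDerivAt_cis_comp (((hasDerivAt_id x).mul_const (g θ)).const_add (f θ))).const_mul
      (k θ)
    refine this.congr_deriv ?_
    simp
    ring

/-- Integration by parts against `e^{iΦ}`. -/
lemma integral_mul_deriv_cis {Φ F u u' : ℝ → ℝ} {a b : ℝ} (hab : a ≤ b)
    (hΦ : ∀ x ∈ Set.Icc a b, HasDerivAt Φ (F x) x) (hF : ContinuousOn F (Set.Icc a b))
    (hu : ∀ x ∈ Set.Icc a b, HasDerivAt u (u' x) x) (hu' : ContinuousOn u' (Set.Icc a b)) :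
    Complex.I * ∫ x in a..b, ((u x * F x : ℝ) : ℂ) * cis (Φ x)
      = u b * cis (Φ b) - u a * cis (Φ a) - ∫ x in a..b, (u' x : ℂ) * cis (Φ x) := by
  have hU : Set.uIcc a b = Set.Icc a b := Set.uIcc_of_le hab
  have hΦc : ContinuousOn Φ (Set.Icc a b) := fun x hx => (hΦ x hx).continuousAt.continuousWithinAt
  have hcis : ContinuousOn (fun x => cis (Φ x)) (Set.Icc a b) :=
    continuous_cis.comp_continuousOn hΦc
  have key := intervalIntegral.integral_mul_deriv_eq_deriv_mul (a := a) (b := b)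
    (u := fun x => ((u x : ℝ) : ℂ)) (u' := fun x => ((u' x : ℝ) : ℂ))
    (v := fun x => cis (Φ x)) (v' := fun x => cis (Φ x) * (F x * Complex.I))
    (fun x hx => (hu x (hU ▸ hx)).ofReal_comp)
    (fun x hx => hasDerivAt_cis_comp (hΦ x (hU ▸ hx)))
    ((Complex.continuous_ofReal.comp_continuousOn hu').intervalIntegrable_of_Icc hab)
    ((hcis.mul ((Complex.continuous_ofReal.comp_continuousOn hF).mul
      continuousOn_const)).intervalIntegrable_of_Icc hab)
  rw [← key, ← intervalIntegral.integral_const_mul]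
  congr 1
  ext x
  push_cast
  ring

lemma norm_integral_mul_deriv_cis_le {Φ F u u' : ℝ → ℝ} {a b : ℝ} (hab : a ≤ b)
    (hΦ : ∀ x ∈ Set.Icc a b, HasDerivAt Φ (F x) x) (hF : ContinuousOn F (Set.Icc a b))
    (hu : ∀ x ∈ Set.Icc a b, HasDerivAt u (u' x) x) (hu' : ContinuousOn u' (Set.Icc a b)) :
    ‖∫ x in a..b, ((u x * F x : ℝ) : ℂ) * cis (Φ x)‖
      ≤ |u b| + |u a| + ∫ x in a..b, |u' x| := by
  have h := congrArg norm (integral_mul_deriv_cis hab hΦ hF hu hu')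
  rw [norm_mul, Complex.norm_I, one_mul] at h
  rw [h]
  refine (norm_sub_le _ _).trans (add_le_add ((norm_sub_le _ _).trans ?_) ?_)
  · simp
  · refine (intervalIntegral.norm_integral_le_integral_norm hab).trans (le_of_eq ?_)
    simp

/-- The cotangent of the half sum. -/
def ct (t θ : ℝ) : ℝ := cos ((θ + t) / 2) / sin ((θ + t) / 2)

section ct
variable {t θ : ℝ}

lemma half_sin_pos (ht : 0 < t) (ht2 : t ≤ π / 2) (hθ : θ ∈ Set.Icc 0 π) :
    0 < sin ((θ + t) / 2) :=
  sin_pos_of_pos_of_lt_pi (by linarith [hθ.1]) (by linarith [hθ.2, pi_pos])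

lemma sin_le_two_half (ht : 0 < t) (ht2 : t ≤ π / 2) (hθ : θ ∈ Set.Icc 0 π) :
    sin t ≤ 2 * sin ((θ + t) / 2) := by
  have h1 : sin t = 2 * sin (t / 2) * cos (t / 2) := by
    rw [← sin_two_mul]; congr 1; ring
  have h0 : 0 ≤ sin (t / 2) := sin_nonneg_of_nonneg_of_le_pi (by linarith) (by linarith [pi_pos])
  have h2 : sin (t / 2) ≤ sin ((θ + t) / 2) := by
    rcases le_total ((θ + t) / 2) (π / 2) with h | h
    · exact sin_le_sin_of_le_of_le_pi_div_two (by linarith [pi_pos]) h (by linarith [hθ.1])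
    · rw [← sin_pi_sub ((θ + t) / 2)]
      exact sin_le_sin_of_le_of_le_pi_div_two (by linarith [pi_pos]) (by linarith)
        (by linarith [hθ.2])
  have h3 := cos_le_one (t / 2)
  nlinarith

lemma hasDerivAt_ct (ht : 0 < t) (ht2 : t ≤ π / 2) (hθ : θ ∈ Set.Icc 0 π) :
    HasDerivAt (ct t) (-((1 + ct t θ ^ 2) / 2)) θ := by
  have hs := half_sin_pos ht ht2 hθ
  have h0 : HasDerivAt (fun x : ℝ => (x + t) / 2) (1 / 2) θ :=
    ((hasDerivAt_id θ).add_const t).div_const 2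
  refine (h0.cos.div h0.sin hs.ne').congr_deriv ?_
  unfold ct
  field_simp
  ring

lemma sin_sub_eq_ct (ht : 0 < t) (ht2 : t ≤ π / 2) (hθ : θ ∈ Set.Icc 0 π) :
    sin t - sin θ = -ct t θ * (cos t - cos θ) := by
  have hs := half_sin_pos ht ht2 hθ
  unfold ct
  rw [sin_sub_sin, cos_sub_cos, show (t + θ) / 2 = (θ + t) / 2 by ring]
  field_simp

/-- The quotient of `(1 + cot²)/2 - 1/(2 sin² t)` by `cos t - cos θ`. -/
def etaQ (t θ : ℝ) : ℝ :=
  -(1 / (4 * sin t ^ 2)) * (cos t * (1 + ct t θ ^ 2) + sin t * (ct t θ + ct t θ ^ 3))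

lemma etaQ_mul (ht : 0 < t) (ht2 : t ≤ π / 2) (hθ : θ ∈ Set.Icc 0 π) :
    (1 + ct t θ ^ 2) / 2 - 1 / (2 * sin t ^ 2) = etaQ t θ * (cos t - cos θ) := by
  have hs := half_sin_pos ht ht2 hθ
  have hst : 0 < sin t := sin_pos_of_pos_of_lt_pi ht (by linarith [pi_pos])
  have h1 : cos θ = cos (2 * ((θ + t) / 2) - t) := by congr 1; ring
  rw [h1, cos_sub, cos_two_mul, sin_two_mul]
  unfold etaQ ct
  set A := sin ((θ + t) / 2)
  set B := cos ((θ + t) / 2)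
  have hAB : B ^ 2 = 1 - A ^ 2 := by have := sin_sq_add_cos_sq ((θ + t) / 2); linarith
  have ht' : cos t ^ 2 = 1 - sin t ^ 2 := by have := sin_sq_add_cos_sq t; linarith
  have hB3 : B ^ 3 = B * (1 - A ^ 2) := by rw [← hAB]; ring
  rw [div_pow, div_pow, hB3, hAB]
  field_simp
  ring_nf
  simp only [hAB, ht']
  ring

lemma abs_ct_le (ht : 0 < t) (ht2 : t ≤ π / 2) (hθ : θ ∈ Set.Icc 0 π) :
    |ct t θ| ≤ 2 / sin t := by
  have hs := half_sin_pos ht ht2 hθ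
  have hst : 0 < sin t := sin_pos_of_pos_of_lt_pi ht (by linarith [pi_pos])
  unfold ct
  rw [abs_div, abs_of_pos hs, div_le_div_iff₀ hs hst]
  have := sin_le_two_half ht ht2 hθ
  have h1 := abs_cos_le_one ((θ + t) / 2)
  nlinarith [abs_nonneg (cos ((θ + t) / 2))]

lemma abs_etaQ_le (ht : 0 < t) (ht2 : t ≤ π / 2) (hθ : θ ∈ Set.Icc 0 π) :
    |etaQ t θ| ≤ 4 / sin t ^ 4 := by
  have hst : 0 < sin t := sin_pos_of_pos_of_lt_pi ht (by linarith [pi_pos])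
  have hs1 := sin_le_one t
  have hc := abs_ct_le ht ht2 hθ
  have hct := abs_cos_le_one t
  have h2 : ct t θ ^ 2 ≤ 4 / sin t ^ 2 := by
    rw [← sq_abs]
    refine (pow_le_pow_left₀ (abs_nonneg _) hc 2).trans (le_of_eq ?_)
    rw [div_pow]; norm_num
  unfold etaQ
  rw [abs_mul, abs_neg, abs_of_pos (by positivity : 0 < 1 / (4 * sin t ^ 2))]
  have h3 : |cos t * (1 + ct t θ ^ 2) + sin t * (ct t θ + ct t θ ^ 3)|
      ≤ 1 * (1 + 4 / sin t ^ 2) + sin t * (2 / sin t * (1 + 4 / sin t ^ 2)) := by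
    refine (abs_add_le _ _).trans (add_le_add ?_ ?_)
    · rw [abs_mul, abs_of_pos (by positivity : 0 < 1 + ct t θ ^ 2)]
      gcongr
    · rw [abs_mul, abs_of_pos hst, show ct t θ + ct t θ ^ 3 = ct t θ * (1 + ct t θ ^ 2) by ring,
        abs_mul, abs_of_pos (by positivity : 0 < 1 + ct t θ ^ 2)]
      gcongr
  calc _ ≤ 1 / (4 * sin t ^ 2) *
        (1 * (1 + 4 / sin t ^ 2) + sin t * (2 / sin t * (1 + 4 / sin t ^ 2))) := by gcongr
    _ = (3 * sin t ^ 2 + 12) / (4 * sin t ^ 4) := by field_simp; ring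
    _ ≤ 4 / sin t ^ 4 := by
        rw [div_le_div_iff₀ (by positivity) (by positivity)]
        have : 0 ≤ sin t ^ 4 := by positivity
        nlinarith [pow_le_one₀ hst.le hs1 (n := 2)]

/-- Derivative of `etaQ`. -/
def etaQ' (t θ : ℝ) : ℝ :=
  1 / (4 * sin t ^ 2) * (2 * cos t * ct t θ + sin t * (1 + 3 * ct t θ ^ 2))
    * ((1 + ct t θ ^ 2) / 2)

lemma hasDerivAt_etaQ (ht : 0 < t) (ht2 : t ≤ π / 2) (hθ : θ ∈ Set.Icc 0 π) :
    HasDerivAt (etaQ t) (etaQ' t θ) θ := by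
  have h := hasDerivAt_ct ht ht2 hθ
  have := ((((h.pow 2).const_add 1).const_mul (cos t)).add
    ((h.add (h.pow 3)).const_mul (sin t))).const_mul (-(1 / (4 * sin t ^ 2)))
  refine this.congr_deriv ?_
  unfold etaQ'
  simp
  ring

lemma continuousOn_ct (ht : 0 < t) (ht2 : t ≤ π / 2) : ContinuousOn (ct t) (Set.Icc 0 π) :=
  fun _ hx => (hasDerivAt_ct ht ht2 hx).continuousAt.continuousWithinAt

lemma continuousOn_etaQ' (ht : 0 < t) (ht2 : t ≤ π / 2) :
    ContinuousOn (etaQ' t) (Set.Icc 0 π) := by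
  have := continuousOn_ct ht ht2
  unfold etaQ'
  fun_prop

lemma integral_abs_etaQ'_le (ht : 0 < t) (ht2 : t ≤ π / 2) :
    ∫ θ in (0 : ℝ)..π, |etaQ' t θ| ≤ 17 / sin t ^ 4 := by
  have hst : 0 < sin t := sin_pos_of_pos_of_lt_pi ht (by linarith [pi_pos])
  have hs1 := sin_le_one t
  have hc := continuousOn_ct ht ht2
  have hi : IntervalIntegrable (fun θ => (1 + ct t θ ^ 2) / 2) volume 0 π :=
    ContinuousOn.intervalIntegrable_of_Icc pi_pos.le (by fun_prop)
  have hftc : ∫ θ in (0 : ℝ)..π, (1 + ct t θ ^ 2) / 2 = ct t 0 - ct t π := by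
    have := intervalIntegral.integral_eq_sub_of_hasDerivAt (f := fun θ => -ct t θ)
      (f' := fun θ => (1 + ct t θ ^ 2) / 2) (a := 0) (b := π) (fun x hx => by
        rw [Set.uIcc_of_le pi_pos.le] at hx
        exact (hasDerivAt_ct ht ht2 hx).neg.congr_deriv (by ring)) hi
    rw [this]; ring
  calc ∫ θ in (0 : ℝ)..π, |etaQ' t θ|
      ≤ ∫ θ in (0 : ℝ)..π, 17 / (4 * sin t ^ 3) * ((1 + ct t θ ^ 2) / 2) := by
        refine intervalIntegral.integral_mono_on pi_pos.le
          ((continuousOn_etaQ' ht ht2).abs.intervalIntegrable_of_Icc pi_pos.le)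
          (hi.const_mul _) fun θ hθ => ?_
        unfold etaQ'
        rw [abs_mul, abs_of_nonneg (by positivity : 0 ≤ (1 + ct t θ ^ 2) / 2), abs_mul,
          abs_of_pos (by positivity : 0 < 1 / (4 * sin t ^ 2))]
        gcongr
        have hcc := abs_ct_le ht ht2 hθ
        have h2 : ct t θ ^ 2 ≤ 4 / sin t ^ 2 := by
          rw [← sq_abs]
          refine (pow_le_pow_left₀ (abs_nonneg _) hcc 2).trans (le_of_eq ?_)
          rw [div_pow]; norm_num
        have h3 : |2 * cos t * ct t θ + sin t * (1 + 3 * ct t θ ^ 2)|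
            ≤ 2 * 1 * (2 / sin t) + sin t * (1 + 3 * (4 / sin t ^ 2)) := by
          refine (abs_add_le _ _).trans (add_le_add ?_ ?_)
          · rw [abs_mul, abs_mul, abs_two]
            gcongr
            exact abs_cos_le_one t
          · rw [abs_of_nonneg (by positivity)]
            gcongr
        calc _ ≤ 1 / (4 * sin t ^ 2) *
              (2 * 1 * (2 / sin t) + sin t * (1 + 3 * (4 / sin t ^ 2))) := by gcongr
          _ = (16 + sin t ^ 2) / (4 * sin t ^ 3) := by field_simp; ring
          _ ≤ 17 / (4 * sin t ^ 3) := by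
              gcongr
              nlinarith
    _ = 17 / (4 * sin t ^ 3) * (ct t 0 - ct t π) := by
        rw [intervalIntegral.integral_const_mul, hftc]
    _ ≤ 17 / (4 * sin t ^ 3) * (2 / sin t + 2 / sin t) := by
        have h0 := (abs_le.1 (abs_ct_le ht ht2 ⟨le_rfl, pi_pos.le⟩)).2
        have h1 := (abs_le.1 (abs_ct_le ht ht2 ⟨pi_pos.le, le_rfl⟩)).1
        gcongr
        linarith
    _ = 17 / sin t ^ 4 := by field_simp; ring

end ct

/-- The integral of `(1 + cot²)/2` against the Bessel phase is, up to a small error, the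
stationary value times the integral of the exponential. -/
lemma norm_integral_ct_sub_le {t z : ℝ} (ht : 0 < t) (ht2 : t ≤ π / 2) (hz : 0 < z) (φ : ℝ) :
    ‖(∫ θ in (0 : ℝ)..π, (((1 + ct t θ ^ 2) / 2 : ℝ) : ℂ) * cis (z * cos t * θ - z * sin θ + φ))
      - ((1 / (2 * sin t ^ 2) : ℝ) : ℂ) * ∫ θ in (0 : ℝ)..π, cis (z * cos t * θ - z * sin θ + φ)‖
      ≤ 25 / (z * sin t ^ 4) := by
  have hst : 0 < sin t := sin_pos_of_pos_of_lt_pi ht (by linarith [pi_pos])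
  set Φ : ℝ → ℝ := fun θ => z * cos t * θ - z * sin θ + φ with hΦdef
  have hΦ : ∀ θ, HasDerivAt Φ (z * (cos t - cos θ)) θ := fun θ => by
    have := (((hasDerivAt_id θ).const_mul (z * cos t)).sub ((hasDerivAt_sin θ).const_mul z)).add_const φ
    refine this.congr_deriv ?_
    ring
  have hcis : Continuous fun θ => cis (Φ θ) := by fun_prop
  have hc := continuousOn_ct ht ht2
  have hi : IntervalIntegrable (fun θ => (((1 + ct t θ ^ 2) / 2 : ℝ) : ℂ) * cis (Φ θ))
      volume 0 π := by
    refine ContinuousOn.intervalIntegrable_of_Icc pi_pos.le (ContinuousOn.mul ?_ hcis.continuousOn)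
    exact Complex.continuous_ofReal.comp_continuousOn (by fun_prop)
  have h := norm_integral_mul_deriv_cis_le (Φ := Φ) (F := fun θ => z * (cos t - cos θ))
    (u := etaQ t) (u' := etaQ' t) pi_pos.le (fun θ _ => hΦ θ) (by fun_prop)
    (fun θ hθ => hasDerivAt_etaQ ht ht2 hθ) (continuousOn_etaQ' ht ht2)
  have e1 := abs_etaQ_le ht ht2 (θ := 0) ⟨le_rfl, pi_pos.le⟩
  have e2 := abs_etaQ_le ht ht2 (θ := π) ⟨pi_pos.le, le_rfl⟩
  have e3 := integral_abs_etaQ'_le ht ht2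
  have e4 : (∫ θ in (0 : ℝ)..π, (((1 + ct t θ ^ 2) / 2 : ℝ) : ℂ) * cis (Φ θ))
      - ((1 / (2 * sin t ^ 2) : ℝ) : ℂ) * ∫ θ in (0 : ℝ)..π, cis (Φ θ)
      = ((1 / z : ℝ) : ℂ)
        * ∫ θ in (0 : ℝ)..π, ((etaQ t θ * (z * (cos t - cos θ)) : ℝ) : ℂ) * cis (Φ θ) := by
    rw [← intervalIntegral.integral_const_mul, ← intervalIntegral.integral_const_mul,
      ← intervalIntegral.integral_sub hi ((hcis.intervalIntegrable _ _).const_mul _)]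
    refine intervalIntegral.integral_congr fun θ hθ => ?_
    rw [Set.uIcc_of_le pi_pos.le] at hθ
    rw [← sub_mul, ← mul_assoc, ← Complex.ofReal_sub, ← Complex.ofReal_mul, etaQ_mul ht ht2 hθ]
    congr 2
    field_simp
  rw [e4, norm_mul, Complex.norm_real, Real.norm_of_nonneg (by positivity)]
  calc _ ≤ 1 / z * (4 / sin t ^ 4 + 4 / sin t ^ 4 + 17 / sin t ^ 4) := by
        gcongr
        linarith
    _ = _ := by field_simp; norm_num

/-- The upper half of Bessel's integral. -/
def bP (ν z : ℝ) : ℂ := ∫ θ in (0 : ℝ)..π, (1 : ℂ) * cis (ν * θ + z * (-sin θ))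

/-- Derivative of `bP` in `z`. -/
def bP' (ν z : ℝ) : ℂ :=
  ∫ θ in (0 : ℝ)..π, (Complex.I * ((-sin θ : ℝ) : ℂ) * 1) * cis (ν * θ + z * (-sin θ))

lemma hasDerivAt_bP (ν z : ℝ) : HasDerivAt (bP ν) (bP' ν z) z :=
  hasDerivAt_integral_cis (k := fun _ => 1) (f := fun θ => ν * θ) (g := fun θ => -sin θ)
    continuous_const (by fun_prop) (by fun_prop) z

lemma continuous_bP (ν : ℝ) : Continuous (bP ν) :=
  continuous_iff_continuousAt.2 fun z => (hasDerivAt_bP ν z).continuousAt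

lemma continuous_bP' (ν : ℝ) : Continuous (bP' ν) :=
  continuous_iff_continuousAt.2 fun z =>
    (hasDerivAt_integral_cis (k := fun θ => Complex.I * ((-sin θ : ℝ) : ℂ) * 1)
      (f := fun θ => ν * θ) (g := fun θ => -sin θ) (by fun_prop) (by fun_prop) (by fun_prop)
      z).continuousAt

/-- The square root `√(z² - ν²)`. -/
def br (ν z : ℝ) : ℝ := √(z ^ 2 - ν ^ 2)

/-- The stationary value of the phase of Bessel's integral. -/
def bph (ν z : ℝ) : ℝ := br ν z - ν * arccos (ν / z)

section
variable {ν z : ℝ}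

lemma br_arg_pos (hν : 0 ≤ ν) (hz : ν < z) : 0 < z ^ 2 - ν ^ 2 := by nlinarith

lemma br_pos (hν : 0 ≤ ν) (hz : ν < z) : 0 < br ν z := Real.sqrt_pos.2 (br_arg_pos hν hz)

lemma br_sq (hν : 0 ≤ ν) (hz : ν < z) : br ν z ^ 2 = (z - ν) * (z + ν) := by
  rw [br, Real.sq_sqrt (br_arg_pos hν hz).le]; ring

lemma hasDerivAt_br (hν : 0 ≤ ν) (hz : ν < z) : HasDerivAt (br ν) (z / br ν z) z := by
  have := ((hasDerivAt_pow 2 z).sub_const (ν ^ 2)).sqrt (br_arg_pos hν hz).ne'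
  refine this.congr_deriv ?_
  have := br_pos hν hz
  change _ / (2 * br ν z) = _
  field_simp
  simp

lemma sqrt_one_sub (hν : 0 ≤ ν) (hz : ν < z) : √(1 - (ν / z) ^ 2) = br ν z / z := by
  have h0 : 0 < z := hν.trans_lt hz
  rw [Real.sqrt_eq_iff_mul_self_eq_of_pos (div_pos (br_pos hν hz) h0), ← sq, div_pow,
    br_sq hν hz]
  field_simp
  ring

lemma hasDerivAt_bph (hν : 0 ≤ ν) (hz : ν < z) : HasDerivAt (bph ν) (br ν z / z) z := by
  have h0 : 0 < z := hν.trans_lt hz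
  have hr := br_pos hν hz
  have h1 : HasDerivAt (fun z => ν / z) (-ν / z ^ 2) z := by
    refine ((hasDerivAt_const z ν).div (hasDerivAt_id z) h0.ne').congr_deriv ?_
    simp
  have hne1 : ν / z ≠ -1 := by
    have : 0 ≤ ν / z := by positivity
    linarith
  have hne2 : ν / z ≠ 1 := ((div_lt_one h0).2 hz).ne
  have h2 := (hasDerivAt_arccos hne1 hne2).comp z h1
  refine ((hasDerivAt_br hν hz).sub (h2.const_mul ν)).congr_deriv ?_
  rw [sqrt_one_sub hν hz]
  have hsq := br_sq hν hz
  field_simp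
  rw [hsq]
  ring

/-- Bessel's half integral with the stationary oscillation and the end point terms removed. -/
def bt (ν z : ℝ) : ℂ :=
  cis (bph ν z) * bP ν z + cis (ν * π + bph ν z) * (Complex.I * ((ν + z)⁻¹ : ℝ))
    + cis (bph ν z) * (Complex.I * ((z - ν)⁻¹ : ℝ))

/-- Derivative of `bt`. -/
def bt' (ν z : ℝ) : ℂ :=
  cis (bph ν z) * ((br ν z / z : ℝ) * Complex.I) * bP ν z + cis (bph ν z) * bP' ν z
    + (cis (ν * π + bph ν z) * ((br ν z / z : ℝ) * Complex.I) * (Complex.I * ((ν + z)⁻¹ : ℝ))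
      + cis (ν * π + bph ν z) * (Complex.I * (-1 / (ν + z) ^ 2 : ℝ)))
    + (cis (bph ν z) * ((br ν z / z : ℝ) * Complex.I) * (Complex.I * ((z - ν)⁻¹ : ℝ))
      + cis (bph ν z) * (Complex.I * (-1 / (z - ν) ^ 2 : ℝ)))

lemma hasDerivAt_bt (hν : 0 ≤ ν) (hz : ν < z) : HasDerivAt (bt ν) (bt' ν z) z := by
  have h0 : 0 < z := hν.trans_lt hz
  have hp := hasDerivAt_bph hν hz
  have h1 := hasDerivAt_cis_comp hp
  have h2 := hasDerivAt_cis_comp (hp.const_add (ν * π))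
  have i1 : HasDerivAt (fun z : ℝ => (ν + z)⁻¹) (-1 / (ν + z) ^ 2) z := by
    exact ((hasDerivAt_id z).const_add ν).fun_inv (by simp; positivity)
  have i2 : HasDerivAt (fun z : ℝ => (z - ν)⁻¹) (-1 / (z - ν) ^ 2) z := by
    exact ((hasDerivAt_id z).sub_const ν).fun_inv (by simp; linarith)
  exact ((h1.mul (hasDerivAt_bP ν z)).add (h2.mul (i1.ofReal_comp.const_mul Complex.I))).add
    (h1.mul (i2.ofReal_comp.const_mul Complex.I))

/-- The normalised amplitude of Bessel's half integral. -/
def am (ν z : ℝ) : ℂ := (√(br ν z) : ℝ) * bt ν z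

/-- Derivative of `am`. -/
def am' (ν z : ℝ) : ℂ :=
  ((z / br ν z / (2 * √(br ν z)) : ℝ) : ℂ) * bt ν z + (√(br ν z) : ℝ) * bt' ν z

lemma hasDerivAt_am (hν : 0 ≤ ν) (hz : ν < z) : HasDerivAt (am ν) (am' ν z) z :=
  ((hasDerivAt_br hν hz).sqrt (br_pos hν hz).ne').ofReal_comp.mul (hasDerivAt_bt hν hz)

lemma continuousOn_am' (hν : 0 ≤ ν) : ContinuousOn (am' ν) (Set.Ioi ν) := by
  have hbt : ContinuousOn (bt ν) (Set.Ioi ν) := fun z hz =>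
    (hasDerivAt_bt hν hz).continuousAt.continuousWithinAt
  have hr : ContinuousOn (br ν) (Set.Ioi ν) := fun z hz =>
    (hasDerivAt_br hν hz).continuousAt.continuousWithinAt
  have hp : ContinuousOn (bph ν) (Set.Ioi ν) := fun z hz =>
    (hasDerivAt_bph hν hz).continuousAt.continuousWithinAt
  have hr0 : ∀ z ∈ Set.Ioi ν, br ν z ≠ 0 := fun z hz => (br_pos hν hz).ne'
  have hs0 : ∀ z ∈ Set.Ioi ν, 2 * √(br ν z) ≠ 0 := fun z hz => by
    have := Real.sqrt_pos.2 (br_pos hν hz); positivity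
  have hz0 : ∀ z ∈ Set.Ioi ν, z ≠ 0 := fun z hz => (hν.trans_lt hz).ne'
  have hp1 : ∀ z ∈ Set.Ioi ν, ν + z ≠ 0 := fun z hz => by
    have : ν < z := hz
    linarith
  have hp2 : ∀ z ∈ Set.Ioi ν, z - ν ≠ 0 := fun z hz => by
    have : ν < z := hz
    linarith
  have hp3 : ∀ z ∈ Set.Ioi ν, (ν + z) ^ 2 ≠ 0 := fun z hz => pow_ne_zero _ (hp1 z hz)
  have hp4 : ∀ z ∈ Set.Ioi ν, (z - ν) ^ 2 ≠ 0 := fun z hz => pow_ne_zero _ (hp2 z hz)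
  have hof := Complex.continuous_ofReal
  have hP := continuous_bP ν
  have hP' := continuous_bP' ν
  have g1 : ContinuousOn (fun z => ((br ν z / z : ℝ) : ℂ)) (Set.Ioi ν) :=
    hof.comp_continuousOn (hr.div continuousOn_id hz0)
  have g2 : ContinuousOn (fun z => (((ν + z)⁻¹ : ℝ) : ℂ)) (Set.Ioi ν) :=
    hof.comp_continuousOn ((by fun_prop : ContinuousOn (fun z => ν + z) (Set.Ioi ν)).inv₀ hp1)
  have g3 : ContinuousOn (fun z => (((z - ν)⁻¹ : ℝ) : ℂ)) (Set.Ioi ν) :=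
    hof.comp_continuousOn ((by fun_prop : ContinuousOn (fun z => z - ν) (Set.Ioi ν)).inv₀ hp2)
  have g4 : ContinuousOn (fun z => ((-1 / (ν + z) ^ 2 : ℝ) : ℂ)) (Set.Ioi ν) :=
    hof.comp_continuousOn (ContinuousOn.div (by fun_prop) (by fun_prop) hp3)
  have g5 : ContinuousOn (fun z => ((-1 / (z - ν) ^ 2 : ℝ) : ℂ)) (Set.Ioi ν) :=
    hof.comp_continuousOn (ContinuousOn.div (by fun_prop) (by fun_prop) hp4)
  have g6 : ContinuousOn (fun z => ((z / br ν z / (2 * √(br ν z)) : ℝ) : ℂ)) (Set.Ioi ν) :=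
    hof.comp_continuousOn ((continuousOn_id.div hr hr0).div
      (continuousOn_const.mul (continuous_sqrt.comp_continuousOn hr)) hs0)
  have g7 : ContinuousOn (fun z => ((√(br ν z) : ℝ) : ℂ)) (Set.Ioi ν) :=
    hof.comp_continuousOn (continuous_sqrt.comp_continuousOn hr)
  have g8 : ContinuousOn (fun z => cis (bph ν z)) (Set.Ioi ν) :=
    continuous_cis.comp_continuousOn hp
  have g9 : ContinuousOn (fun z => cis (ν * π + bph ν z)) (Set.Ioi ν) :=
    continuous_cis.comp_continuousOn (continuousOn_const.add hp)
  unfold am' bt'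
  fun_prop

/-- The angle of the stationary point. -/
lemma exists_angle (hν : 0 ≤ ν) (hz : ν < z) : ∃ t : ℝ, 0 < t ∧ t ≤ π / 2 ∧ z * cos t = ν ∧
    z * sin t = br ν z ∧ bph ν z = br ν z - ν * t := by
  have h0 : 0 < z := hν.trans_lt hz
  have h1 : ν / z < 1 := (div_lt_one h0).2 hz
  have h2 : 0 ≤ ν / z := by positivity
  refine ⟨arccos (ν / z), arccos_pos.2 h1, arccos_le_pi_div_two.2 h2, ?_, ?_, rfl⟩
  · rw [cos_arccos (by linarith) h1.le]; field_simp
  · rw [sin_arccos, sqrt_one_sub hν hz]; field_simp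

lemma norm_am'_le (hν : 0 ≤ ν) (hz : ν < z) :
    ‖am' ν z‖ ≤ 35 * (√(br ν z) * z ^ 2 / br ν z ^ 4) := by
  have h0 : 0 < z := hν.trans_lt hz
  have hr := br_pos hν hz
  have hrsq := br_sq hν hz
  obtain ⟨t, ht, ht2, hc, hs, hφ⟩ := exists_angle hν hz
  set r := br ν z
  set φ := bph ν z
  have hst : 0 < sin t := sin_pos_of_pos_of_lt_pi ht (by linarith [pi_pos])
  have hsin : r / z = sin t := by rw [← hs]; field_simp
  have hzm : 0 < z - ν := by linarith
  have hzp : 0 < ν + z := by linarith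
  set Φ : ℝ → ℝ := fun θ => z * cos t * θ - z * sin θ + φ with hΦdef
  have hΦ : ∀ θ, HasDerivAt Φ (z * (cos t - cos θ)) θ := fun θ => by
    have := (((hasDerivAt_id θ).const_mul (z * cos t)).sub
      ((hasDerivAt_sin θ).const_mul z)).add_const φ
    refine this.congr_deriv ?_
    ring
  have hcis : Continuous fun θ => cis (Φ θ) := by fun_prop
  have hrw : ∀ θ, cis φ * cis (ν * θ + z * (-sin θ)) = cis (Φ θ) := fun θ => by
    rw [← cis_add, hΦdef, hc]; congr 1; ring
  have hb : cis φ * bP ν z = ∫ θ in (0 : ℝ)..π, cis (Φ θ) := by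
    rw [bP, ← intervalIntegral.integral_const_mul]
    simp only [one_mul, hrw]
  have hb' : cis φ * bP' ν z = ∫ θ in (0 : ℝ)..π, (Complex.I * ((-sin θ : ℝ) : ℂ)) * cis (Φ θ) := by
    rw [bP', ← intervalIntegral.integral_const_mul]
    refine intervalIntegral.integral_congr fun θ _ => ?_
    simp only [← hrw]
    ring
  set b := ∫ θ in (0 : ℝ)..π, cis (Φ θ) with hbdef
  set K := ∫ θ in (0 : ℝ)..π, (((1 + ct t θ ^ 2) / 2 : ℝ) : ℂ) * cis (Φ θ) with hKdef
  have hK := norm_integral_ct_sub_le ht ht2 h0 φ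
  have hmain : (sin t : ℂ) * Complex.I * b + cis φ * bP' ν z
      = -((1 / z : ℝ) : ℂ) * (Complex.I * ∫ θ in (0 : ℝ)..π,
        ((ct t θ * (z * (cos t - cos θ)) : ℝ) : ℂ) * cis (Φ θ)) := by
    rw [hb', hbdef, ← intervalIntegral.integral_const_mul, ← intervalIntegral.integral_add
      ((hcis.intervalIntegrable _ _).const_mul _)
      (Continuous.intervalIntegrable (by fun_prop) _ _), ← mul_assoc,
      ← intervalIntegral.integral_const_mul]
    refine intervalIntegral.integral_congr fun θ hθ => ?_
    rw [Set.uIcc_of_le pi_pos.le] at hθ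
    have := sin_sub_eq_ct ht ht2 hθ
    have e : sin t = sin θ - ct t θ * (cos t - cos θ) := by linarith
    have hzc : (z : ℂ) ≠ 0 := by exact_mod_cast h0.ne'
    rw [e]
    push_cast
    field_simp
    ring
  rw [integral_mul_deriv_cis pi_pos.le (fun θ _ => hΦ θ) (by fun_prop)
    (fun θ hθ => hasDerivAt_ct ht ht2 hθ) (by
      have := continuousOn_ct ht ht2
      fun_prop)] at hmain
  have hK2 : ∫ θ in (0 : ℝ)..π, ((-((1 + ct t θ ^ 2) / 2) : ℝ) : ℂ) * cis (Φ θ) = -K := by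
    rw [hKdef, ← intervalIntegral.integral_neg]
    refine intervalIntegral.integral_congr fun θ _ => ?_
    push_cast
    ring
  rw [hK2] at hmain
  have hΦ0 : Φ 0 = φ := by simp [hΦdef]
  have hΦπ : Φ π = ν * π + φ := by simp [hΦdef, hc]
  rw [hΦ0, hΦπ] at hmain
  have hc0 : ct t 0 / z = sin t / (z - ν) := by
    unfold ct
    rw [zero_add, ← hc, show z - z * cos t = z * (1 - cos (2 * (t / 2))) by
      rw [show 2 * (t / 2) = t by ring]; ring, cos_two_mul, show sin t = sin (2 * (t / 2)) by
      rw [show 2 * (t / 2) = t by ring], sin_two_mul]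
    have hh := half_sin_pos ht ht2 (θ := 0) ⟨le_rfl, pi_pos.le⟩
    rw [zero_add] at hh
    rw [show 1 - (2 * cos (t / 2) ^ 2 - 1) = 2 * sin (t / 2) ^ 2 by
      have := sin_sq_add_cos_sq (t / 2); linarith]
    field_simp
  have hcπ : ct t π / z = - (sin t / (ν + z)) := by
    unfold ct
    rw [show (π + t) / 2 = t / 2 + π / 2 by ring, cos_add_pi_div_two, sin_add_pi_div_two, ← hc,
      show z * cos t + z = z * (1 + cos (2 * (t / 2))) by
      rw [show 2 * (t / 2) = t by ring]; ring, cos_two_mul, show sin t = sin (2 * (t / 2)) by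
      rw [show 2 * (t / 2) = t by ring], sin_two_mul]
    have hh : 0 < cos (t / 2) := cos_pos_of_mem_Ioo ⟨by linarith [pi_pos], by linarith⟩
    field_simp
    ring
  have hbt' : bt' ν z = -((1 / z : ℝ) : ℂ) * K
      + cis (ν * π + φ) * (Complex.I * (-1 / (ν + z) ^ 2 : ℝ))
      + cis φ * (Complex.I * (-1 / (z - ν) ^ 2 : ℝ)) := by
    have e1 : bt' ν z = ((sin t : ℂ) * Complex.I * b + cis φ * bP' ν z)
        - cis (ν * π + φ) * ((sin t / (ν + z) : ℝ) : ℂ)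
        - cis φ * ((sin t / (z - ν) : ℝ) : ℂ)
      + cis (ν * π + φ) * (Complex.I * (-1 / (ν + z) ^ 2 : ℝ))
      + cis φ * (Complex.I * (-1 / (z - ν) ^ 2 : ℝ)) := by
      rw [← hb]
      unfold bt'
      rw [show br ν z / z = sin t from hsin, show bph ν z = φ from rfl]
      generalize sin t = S
      push_cast
      linear_combination (cis (ν * π + φ) * S / (ν + z) + cis φ * S / (z - ν)) * Complex.I_sq
    rw [e1, hmain, ← hc0, show sin t / (ν + z) = -(ct t π / z) by rw [hcπ]; ring]
    push_cast
    ring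
  have hκ : z / r / (2 * √r) = √r * (1 / z * (1 / (2 * sin t ^ 2))) := by
    rw [← hsin]
    have : √r * √r = r := Real.mul_self_sqrt hr.le
    have hsr := Real.sqrt_pos.2 hr
    field_simp
    rw [sq, this]
  have hfin : am' ν z = (√r : ℝ) *
      (((1 / z * (1 / (2 * sin t ^ 2)) : ℝ) : ℂ) *
          (cis (ν * π + φ) * (Complex.I * ((ν + z)⁻¹ : ℝ)) + cis φ * (Complex.I * ((z - ν)⁻¹ : ℝ)))
        - ((1 / z : ℝ) : ℂ) * (K - ((1 / (2 * sin t ^ 2) : ℝ) : ℂ) * b)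
        + cis (ν * π + φ) * (Complex.I * (-1 / (ν + z) ^ 2 : ℝ))
        + cis φ * (Complex.I * (-1 / (z - ν) ^ 2 : ℝ))) := by
    unfold am'
    rw [hbt', show bt ν z = b + cis (ν * π + φ) * (Complex.I * ((ν + z)⁻¹ : ℝ))
      + cis φ * (Complex.I * ((z - ν)⁻¹ : ℝ)) by rw [← hb]; rfl,
      show br ν z = r from rfl, hκ]
    push_cast
    ring
  have hq1 : (z - ν)⁻¹ ≤ 2 * z / r ^ 2 := by
    rw [hrsq, inv_eq_one_div, div_le_div_iff₀ hzm (by positivity)]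
    nlinarith
  have hq2 : (ν + z)⁻¹ ≤ 2 * z / r ^ 2 := (inv_anti₀ hzm (by linarith)).trans hq1
  have hq3 : 1 / (z - ν) ^ 2 ≤ (2 * z / r ^ 2) ^ 2 := by
    rw [one_div, ← inv_pow]; exact pow_le_pow_left₀ (by positivity) hq1 2
  have hq4 : 1 / (ν + z) ^ 2 ≤ (2 * z / r ^ 2) ^ 2 := by
    rw [one_div, ← inv_pow]; exact pow_le_pow_left₀ (by positivity) hq2 2
  rw [hfin, norm_mul, Complex.norm_real, Real.norm_of_nonneg (Real.sqrt_nonneg _)]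
  have hn : ∀ (x : ℝ) (w : ℝ), ‖cis x * (Complex.I * (w : ℂ))‖ = |w| := fun x w => by
    simp [norm_cis]
  calc _ ≤ √r * (1 / z * (1 / (2 * sin t ^ 2)) * (2 * z / r ^ 2 + 2 * z / r ^ 2)
        + 1 / z * (25 / (z * sin t ^ 4)) + (2 * z / r ^ 2) ^ 2 + (2 * z / r ^ 2) ^ 2) := by
        refine mul_le_mul_of_nonneg_left ?_ (Real.sqrt_nonneg _)
        refine (norm_add_le _ _).trans (add_le_add ((norm_add_le _ _).trans (add_le_add
          ((norm_sub_le _ _).trans (add_le_add ?_ ?_)) ?_)) ?_)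
        · rw [norm_mul, Complex.norm_real, Real.norm_of_nonneg (by positivity)]
          refine mul_le_mul_of_nonneg_left ((norm_add_le _ _).trans ?_) (by positivity)
          rw [hn, hn, abs_of_pos (inv_pos.2 hzp), abs_of_pos (inv_pos.2 hzm)]
          exact add_le_add hq2 hq1
        · rw [norm_mul, Complex.norm_real, Real.norm_of_nonneg (by positivity)]
          exact mul_le_mul_of_nonneg_left hK (by positivity)
        · rw [hn, abs_div, abs_neg, abs_one, abs_of_pos (by positivity)]
          exact hq4
        · rw [hn, abs_div, abs_neg, abs_one, abs_of_pos (by positivity)]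
          exact hq3
    _ = _ := by
        rw [← hsin]
        field_simp
        ring

end

section
variable {ν z : ℝ}

lemma isPhase_bP (ν z a b : ℝ) :
    IsPhase (fun θ => ν * θ + z * (-sin θ)) (fun θ => ν - z * cos θ) (fun θ => z * sin θ) a b where
  d1 θ _ := by
    refine (((hasDerivAt_id θ).const_mul ν).add
      ((hasDerivAt_sin θ).neg.const_mul z)).congr_deriv ?_
    ring
  d2 θ _ := by
    refine (((hasDerivAt_cos θ).const_mul z).const_sub ν).congr_deriv ?_
    ring
  cont := by fun_prop

lemma bP_eq (ν z : ℝ) : bP ν z = ∫ θ in (0 : ℝ)..π, cis (ν * θ + z * (-sin θ)) := by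
  simp [bP]

lemma norm_bP_le_split (ν z u v : ℝ) :
    ‖bP ν z‖ ≤ ‖∫ θ in (0 : ℝ)..u, cis (ν * θ + z * (-sin θ))‖
      + ‖∫ θ in u..v, cis (ν * θ + z * (-sin θ))‖
      + ‖∫ θ in v..π, cis (ν * θ + z * (-sin θ))‖ := by
  have hi : ∀ a b, IntervalIntegrable (fun θ => cis (ν * θ + z * (-sin θ))) volume a b :=
    fun a b => Continuous.intervalIntegrable (by fun_prop) _ _
  rw [bP_eq, ← intervalIntegral.integral_add_adjacent_intervals (hi 0 v) (hi v π),
    ← intervalIntegral.integral_add_adjacent_intervals (hi 0 u) (hi u v)]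
  exact (norm_add_le _ _).trans (add_le_add (norm_add_le _ _) le_rfl)

/-- Nonstationary regime. -/
lemma norm_bP_le_of_lt (hz : 0 ≤ z) (h : z < ν) : ‖bP ν z‖ ≤ 4 / (ν - z) := by
  rw [bP_eq]
  refine vdc_first pi_pos.le (isPhase_bP ν z 0 π) (Or.inl fun θ hθ =>
    mul_nonneg hz (sin_nonneg_of_mem_Icc hθ)) (by linarith) fun θ _ => ?_
  refine le_trans ?_ (le_abs_self _)
  have := cos_le_one θ
  nlinarith

/-- Uniform bound. -/
lemma norm_bP_le_uniform {d : ℝ} (hν : 0 ≤ ν) (hd : 0 < d) (hd1 : d ≤ 1) (hz : 1 ≤ z * d ^ 3) :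
    ‖bP ν z‖ ≤ 72 * d := by
  have hpi := pi_pos
  have hz0 : 0 < z := by
    by_contra hc
    have : z * d ^ 3 ≤ 0 := mul_nonpos_of_nonpos_of_nonneg (not_lt.1 hc) (by positivity)
    linarith
  have h1 : ‖∫ θ in (0 : ℝ)..(π / 3), cis (ν * θ + z * (-sin θ))‖ ≤ 22 * (2 * d) := by
    refine vdc_third (v0 := z) (g := sin) (g' := cos) (ρ := 1 / 2) (by positivity)
      (isPhase_bP ν z _ _) hz0 (fun θ _ => ?_) (fun θ _ => hasDerivAt_sin θ) (by norm_num)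
      (fun θ hθ => ?_) (by positivity) ?_
    · rw [abs_mul, abs_of_pos hz0]
    · refine le_trans ?_ (le_abs_self _)
      rw [← cos_pi_div_three]
      exact cos_le_cos_of_nonneg_of_le_pi hθ.1 (by linarith) hθ.2
    · nlinarith
  have h2 : ‖∫ θ in (π / 3)..(2 * π / 3), cis (ν * θ + z * (-sin θ))‖ ≤ 10 * (2 * d) := by
    refine vdc_second (η := z * (1 / 2)) (by linarith) (isPhase_bP ν z _ _) (fun θ hθ => ?_)
      (by positivity) ?_
    · rw [abs_mul, abs_of_pos hz0]
      refine mul_le_mul_of_nonneg_left (le_trans ?_ (le_abs_self _)) hz0.le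
      have hc : |cos θ| ≤ 1 / 2 := by
        rw [abs_le]
        constructor
        · have : cos (2 * π / 3) = -(1 / 2) := by
            rw [show 2 * π / 3 = π - π / 3 by ring, cos_pi_sub, cos_pi_div_three]
          rw [← this]
          exact cos_le_cos_of_nonneg_of_le_pi (by linarith [hθ.1]) (by linarith) hθ.2
        · rw [← cos_pi_div_three]
          exact cos_le_cos_of_nonneg_of_le_pi (by positivity) (by linarith [hθ.2]) hθ.1
      have hs : 0 ≤ sin θ := sin_nonneg_of_nonneg_of_le_pi (by linarith [hθ.1]) (by linarith [hθ.2])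
      have h1 := sin_sq_add_cos_sq θ
      have h2 : cos θ ^ 2 ≤ (1 / 2) ^ 2 := by rw [← sq_abs]; gcongr
      nlinarith
    · have : z * d ^ 3 ≤ z * d ^ 2 * 1 := by
        rw [show z * d ^ 3 = z * d ^ 2 * d by ring]; gcongr
      nlinarith
  have h3 : ‖∫ θ in (2 * π / 3)..π, cis (ν * θ + z * (-sin θ))‖ ≤ 4 / (z / 2) := by
    refine vdc_first (by linarith) (isPhase_bP ν z _ _) (Or.inl fun θ hθ =>
      mul_nonneg hz0.le (sin_nonneg_of_nonneg_of_le_pi (by linarith [hθ.1]) hθ.2))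
      (by positivity) fun θ hθ => ?_
    have : cos θ ≤ -(1 / 2) := by
      have h : cos (2 * π / 3) = -(1 / 2) := by
        rw [show 2 * π / 3 = π - π / 3 by ring, cos_pi_sub, cos_pi_div_three]
      rw [← h]
      exact cos_le_cos_of_nonneg_of_le_pi (by linarith) hθ.2 hθ.1
    refine le_trans ?_ (le_abs_self _)
    nlinarith
  have h4 : 4 / (z / 2) ≤ 8 * d := by
    rw [div_le_iff₀ (by positivity)]
    have : z * d ^ 3 ≤ z * d * 1 := by
      rw [show z * d ^ 3 = z * d * d ^ 2 by ring]
      have : d ^ 2 ≤ 1 := pow_le_one₀ hd.le hd1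
      gcongr
    nlinarith
  have := norm_bP_le_split ν z (π / 3) (2 * π / 3)
  linarith

/-- Stationary regime. -/
lemma norm_bP_le_of_gt (hν : 0 ≤ ν) (hz : ν < z) :
    ‖bP ν z‖ ≤ 32 / (z - ν) + 15 / √(br ν z) := by
  have hpi := pi_pos
  have h0 : 0 < z := hν.trans_lt hz
  have hr := br_pos hν hz
  obtain ⟨t, ht, ht2, hc, hs, -⟩ := exists_angle hν hz
  have hzm : 0 < z - ν := by linarith
  set x := cos (t / 2) with hx
  have hcx : cos t = 2 * x ^ 2 - 1 := by
    rw [hx, ← cos_two_mul]; congr 1; ring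
  have hx1 : x ≤ 1 := cos_le_one _
  have hx0 : 1 / 2 ≤ x := by
    rw [hx, ← cos_pi_div_three]
    exact cos_le_cos_of_nonneg_of_le_pi (by linarith) (by linarith) (by linarith)
  have hνx : ν = z * (2 * x ^ 2 - 1) := by rw [← hcx, hc]
  have h1 : ‖∫ θ in (0 : ℝ)..(t / 2), cis (ν * θ + z * (-sin θ))‖ ≤ 4 / ((z - ν) / 4) := by
    refine vdc_first (by linarith) (isPhase_bP ν z _ _) (Or.inl fun θ hθ =>
      mul_nonneg h0.le (sin_nonneg_of_nonneg_of_le_pi hθ.1 (by linarith [hθ.2])))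
      (by positivity) fun θ hθ => ?_
    rw [abs_sub_comm]
    refine le_trans ?_ (le_abs_self _)
    have : x ≤ cos θ := cos_le_cos_of_nonneg_of_le_pi hθ.1 (by linarith) hθ.2
    have e : z * x ≤ z * cos θ := by gcongr
    have e2 : 0 ≤ z * ((1 - x) * (1 / 2 * x + 1 / 2)) := by
      have : 0 ≤ 1 - x := by linarith
      positivity
    have e3 : z * x - ν - (z - ν) / 4 = z * ((1 - x) * (3 / 2 * x + 1 / 2)) := by
      rw [hνx]; ring
    have e4 : 0 ≤ z * ((1 - x) * (3 / 2 * x + 1 / 2)) := by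
      have : 0 ≤ 1 - x := by linarith
      positivity
    linarith
  have h2 : ‖∫ θ in (t / 2)..(π - t / 2), cis (ν * θ + z * (-sin θ))‖
      ≤ 10 * (√2 / √(br ν z)) := by
    have hsr := Real.sqrt_pos.2 hr
    refine vdc_second (η := br ν z / 2) (by linarith) (isPhase_bP ν z _ _) (fun θ hθ => ?_)
      (by positivity) ?_
    · refine le_trans ?_ (le_abs_self _)
      have hst : sin (t / 2) ≤ sin θ := by
        rcases le_total θ (π / 2) with h | h
        · exact sin_le_sin_of_le_of_le_pi_div_two (by linarith) h hθ.1
        · rw [← sin_pi_sub θ]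
          exact sin_le_sin_of_le_of_le_pi_div_two (by linarith) (by linarith) (by linarith [hθ.2])
      have h3 : sin t = 2 * sin (t / 2) * x := by
        rw [hx, ← sin_two_mul]; congr 1; ring
      have h4 : 0 ≤ sin (t / 2) := sin_nonneg_of_nonneg_of_le_pi (by linarith) (by linarith)
      have h5 : sin t / 2 ≤ sin θ := by nlinarith
      rw [← hs]
      nlinarith
    · rw [div_pow, Real.sq_sqrt (by norm_num), Real.sq_sqrt hr.le]
      field_simp
      rfl
  have h3 : ‖∫ θ in (π - t / 2)..π, cis (ν * θ + z * (-sin θ))‖ ≤ 4 / ((z - ν) / 4) := by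
    refine vdc_first (by linarith) (isPhase_bP ν z _ _) (Or.inl fun θ hθ =>
      mul_nonneg h0.le (sin_nonneg_of_nonneg_of_le_pi (by linarith [hθ.1]) hθ.2))
      (by positivity) fun θ hθ => ?_
    have : cos θ ≤ -x := by
      rw [hx, ← cos_pi_sub]
      exact cos_le_cos_of_nonneg_of_le_pi (by linarith) hθ.2 hθ.1
    refine le_trans ?_ (le_abs_self _)
    have e : z * cos θ ≤ z * -x := by gcongr
    nlinarith
  have h4 : 10 * (√2 / √(br ν z)) ≤ 15 / √(br ν z) := by
    have : √2 ≤ 3 / 2 := by rw [Real.sqrt_le_left (by norm_num)]; norm_num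
    rw [← mul_div_assoc]
    gcongr
    linarith
  have h5 : 4 / ((z - ν) / 4) = 16 / (z - ν) := by field_simp; norm_num
  have h6 : 32 / (z - ν) = 16 / (z - ν) + 16 / (z - ν) := by ring
  have := norm_bP_le_split ν z (t / 2) (π - t / 2)
  rw [h5] at h1 h3
  linarith

lemma norm_am_le (hν : 0 ≤ ν) (hz : ν < z) (h : z ≤ 4 * (z - ν) ^ 3) : ‖am ν z‖ ≤ 83 := by
  have hr := br_pos hν hz
  have hrsq := br_sq hν hz
  have hsr := Real.sqrt_pos.2 hr
  have h0 : 0 < z := hν.trans_lt hz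
  have hzm : 0 < z - ν := by linarith
  have hP := norm_bP_le_of_gt hν hz
  have hbt : ‖bt ν z‖ ≤ 34 / (z - ν) + 15 / √(br ν z) := by
    have e1 : (ν + z)⁻¹ ≤ 1 / (z - ν) := by
      rw [one_div]; exact inv_anti₀ hzm (by linarith)
    have e2 : 34 / (z - ν) + 15 / √(br ν z)
        = (32 / (z - ν) + 15 / √(br ν z)) + 1 / (z - ν) + 1 / (z - ν) := by ring
    rw [e2]
    unfold bt
    refine (norm_add_le _ _).trans (add_le_add ((norm_add_le _ _).trans (add_le_add ?_ ?_)) ?_)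
    · rw [norm_mul, norm_cis, one_mul]; exact hP
    · rw [norm_mul, norm_cis, one_mul, norm_mul, Complex.norm_I, one_mul, Complex.norm_real,
        Real.norm_of_nonneg (by positivity)]
      exact e1
    · rw [norm_mul, norm_cis, one_mul, norm_mul, Complex.norm_I, one_mul, Complex.norm_real,
        Real.norm_of_nonneg (by positivity), one_div]
  have key : √(br ν z) ≤ 2 * (z - ν) := by
    have e : √(br ν z) ^ 4 ≤ (2 * (z - ν)) ^ 4 := by
      rw [show √(br ν z) ^ 4 = (√(br ν z) ^ 2) ^ 2 by ring, Real.sq_sqrt hr.le, hrsq]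
      have e1 : (z - ν) * (z + ν) ≤ (z - ν) * (8 * (z - ν) ^ 3) := by gcongr; linarith
      have : 0 ≤ (z - ν) ^ 4 := by positivity
      nlinarith
    exact le_of_pow_le_pow_left₀ (by norm_num) (by positivity) e
  unfold am
  rw [norm_mul, Complex.norm_real, Real.norm_of_nonneg hsr.le]
  calc √(br ν z) * ‖bt ν z‖ ≤ √(br ν z) * (34 / (z - ν) + 15 / √(br ν z)) := by gcongr
    _ = √(br ν z) * (34 / (z - ν)) + 15 := by field_simp
    _ ≤ 2 * (z - ν) * (34 / (z - ν)) + 15 := by gcongr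
    _ = 83 := by field_simp; norm_num

end

/-- The quarter period integral with nondegenerate critical point at its end. -/
def qB (ν z : ℝ) : ℂ := ∫ y in (0 : ℝ)..(π / 2), (1 : ℂ) * cis (ν * y + z * (1 - cos y))

/-- Derivative of `qB` in `z`. -/
def qB' (ν z : ℝ) : ℂ :=
  ∫ y in (0 : ℝ)..(π / 2), (Complex.I * ((1 - cos y : ℝ) : ℂ) * 1) * cis (ν * y + z * (1 - cos y))

lemma hasDerivAt_qB (ν z : ℝ) : HasDerivAt (qB ν) (qB' ν z) z :=
  hasDerivAt_integral_cis (k := fun _ => 1) (f := fun y => ν * y) (g := fun y => 1 - cos y)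
    continuous_const (by fun_prop) (by fun_prop) z

lemma continuous_qB' (ν : ℝ) : Continuous (qB' ν) :=
  continuous_iff_continuousAt.2 fun z =>
    (hasDerivAt_integral_cis (k := fun y => Complex.I * ((1 - cos y : ℝ) : ℂ) * 1)
      (f := fun y => ν * y) (g := fun y => 1 - cos y) (by fun_prop) (by fun_prop) (by fun_prop)
      z).continuousAt

/-- `qB` without its end point term. -/
def qt (ν z : ℝ) : ℂ := qB ν z + cis (ν * (π / 2) + z) * (Complex.I * ((z + ν)⁻¹ : ℝ))

/-- Derivative of `qt`. -/
def qt' (ν z : ℝ) : ℂ :=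
  qB' ν z + (cis (ν * (π / 2) + z) * ((1 : ℝ) * Complex.I) * (Complex.I * ((z + ν)⁻¹ : ℝ))
    + cis (ν * (π / 2) + z) * (Complex.I * (-1 / (z + ν) ^ 2 : ℝ)))

section
variable {ν z : ℝ}

lemma hasDerivAt_qt (hν : 0 < ν) (hz : 0 < z) : HasDerivAt (qt ν) (qt' ν z) z := by
  have i1 : HasDerivAt (fun z : ℝ => (z + ν)⁻¹) (-1 / (z + ν) ^ 2) z :=
    ((hasDerivAt_id z).add_const ν).fun_inv (by simp; positivity)
  exact (hasDerivAt_qB ν z).add ((hasDerivAt_cis_comp ((hasDerivAt_id z).const_add (ν * (π / 2)))).mul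
    (i1.ofReal_comp.const_mul Complex.I))

lemma continuousOn_qt' (hν : 0 < ν) : ContinuousOn (qt' ν) (Set.Ioi 0) := by
  have h0 : ∀ z ∈ Set.Ioi (0 : ℝ), z + ν ≠ 0 := fun z hz => by
    have : 0 < z := hz
    positivity
  have h2 : ∀ z ∈ Set.Ioi (0 : ℝ), (z + ν) ^ 2 ≠ 0 := fun z hz => pow_ne_zero _ (h0 z hz)
  have hof := Complex.continuous_ofReal
  have g1 : ContinuousOn (fun z => (((z + ν)⁻¹ : ℝ) : ℂ)) (Set.Ioi 0) :=
    hof.comp_continuousOn ((by fun_prop : ContinuousOn (fun z => z + ν) (Set.Ioi 0)).inv₀ h0)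
  have g2 : ContinuousOn (fun z => ((-1 / (z + ν) ^ 2 : ℝ) : ℂ)) (Set.Ioi 0) :=
    hof.comp_continuousOn (ContinuousOn.div (by fun_prop) (by fun_prop) h2)
  have := continuous_qB' ν
  unfold qt'
  fun_prop

lemma norm_qB_le (hν : 0 < ν) (hz : 1 ≤ z) {x : ℝ} (hx : x ∈ Set.Icc 0 (π / 2)) :
    ‖∫ y in (0 : ℝ)..x, cis (ν * y + z * (1 - cos y))‖ ≤ 23 / √z := by
  have hpi := pi_pos
  have hz0 : 0 < z := by linarith
  have hs := Real.sqrt_pos.2 hz0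
  have hph : ∀ a b, IsPhase (fun y => ν * y + z * (1 - cos y)) (fun y => ν + z * sin y)
      (fun y => z * cos y) a b := fun a b =>
    { d1 := fun y _ => (((hasDerivAt_id y).const_mul ν).add
        (((hasDerivAt_cos y).const_sub 1).const_mul z)).congr_deriv (by ring)
      d2 := fun y _ => (((hasDerivAt_sin y).const_mul z).const_add ν).congr_deriv (by ring)
      cont := by fun_prop }
  have i1 : ∀ x ∈ Set.Icc 0 (π / 3),
      ‖∫ y in (0 : ℝ)..x, cis (ν * y + z * (1 - cos y))‖ ≤ 10 * (√2 / √z) := fun x hx => by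
    refine vdc_second (η := z / 2) hx.1 (hph _ _) (fun y hy => ?_) (by positivity) ?_
    · refine le_trans ?_ (le_abs_self _)
      have : 1 / 2 ≤ cos y := by
        rw [← cos_pi_div_three]
        exact cos_le_cos_of_nonneg_of_le_pi hy.1 (by linarith) (hy.2.trans hx.2)
      nlinarith
    · rw [div_pow, Real.sq_sqrt (by norm_num), Real.sq_sqrt hz0.le]
      field_simp
      rfl
  have h2 : 10 * (√2 / √z) ≤ 15 / √z := by
    have : √2 ≤ 3 / 2 := by rw [Real.sqrt_le_left (by norm_num)]; norm_num
    rw [← mul_div_assoc]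
    gcongr
    linarith
  rcases le_total x (π / 3) with h | h
  · refine ((i1 x ⟨hx.1, h⟩).trans h2).trans ?_
    gcongr
    norm_num
  · have hi : ∀ a b, IntervalIntegrable (fun y => cis (ν * y + z * (1 - cos y))) volume a b :=
      fun a b => Continuous.intervalIntegrable (by fun_prop) _ _
    rw [← intervalIntegral.integral_add_adjacent_intervals (hi 0 (π / 3)) (hi _ _)]
    have h3 : ‖∫ y in (π / 3)..x, cis (ν * y + z * (1 - cos y))‖ ≤ 4 / (z / 2) := by
      refine vdc_first h (hph _ _) (Or.inl fun y hy => mul_nonneg hz0.le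
        (cos_nonneg_of_neg_pi_div_two_le_of_le (by linarith [hy.1]) (hy.2.trans hx.2)))
        (by positivity) fun y hy => ?_
      have : 1 / 2 ≤ sin y := by
        rw [← sin_pi_div_six]
        exact sin_le_sin_of_le_of_le_pi_div_two (by linarith) (hy.2.trans hx.2) (by linarith [hy.1])
      refine le_trans ?_ (le_abs_self _)
      nlinarith
    have h4 : 4 / (z / 2) ≤ 8 / √z := by
      rw [div_div_eq_mul_div]
      have : √z ≤ z := by
        rw [Real.sqrt_le_left (by linarith)]; nlinarith
      norm_num
      gcongr
    have h5 : 23 / √z = 15 / √z + 8 / √z := by ring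
    have h6 := i1 (π / 3) ⟨by positivity, le_rfl⟩
    refine (norm_add_le _ _).trans ?_
    linarith

lemma norm_qt_le (hν : 0 < ν) (hz : 1 ≤ z) : ‖qt ν z‖ ≤ 24 / √z := by
  have hz0 : 0 < z := by linarith
  have h := norm_qB_le hν hz (x := π / 2) ⟨by positivity, le_rfl⟩
  have : √z ≤ z := by rw [Real.sqrt_le_left (by linarith)]; nlinarith
  have hs := Real.sqrt_pos.2 hz0
  unfold qt
  refine (norm_add_le _ _).trans ?_
  rw [norm_mul, norm_cis, one_mul, norm_mul, Complex.norm_I, one_mul, Complex.norm_real,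
    Real.norm_of_nonneg (by positivity), qB]
  simp only [one_mul]
  have h2 : (z + ν)⁻¹ ≤ 1 / √z := by
    rw [one_div]; exact inv_anti₀ hs (by linarith)
  have h5 : 24 / √z = 23 / √z + 1 / √z := by ring
  linarith

lemma norm_qt'_le (hν : 0 < ν) (hz : 1 ≤ z) : ‖qt' ν z‖ ≤ 47 / (z * √z) := by
  have hpi := pi_pos
  have hz0 : 0 < z := by linarith
  have hs := Real.sqrt_pos.2 hz0
  have hsz : √z ≤ z := by rw [Real.sqrt_le_left (by linarith)]; nlinarith
  set Φ : ℝ → ℝ := fun y => ν * y + z * (1 - cos y) with hΦdef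
  have hΦ : ∀ y, HasDerivAt Φ (z * sin y + ν) y := fun y =>
    (((hasDerivAt_id y).const_mul ν).add
        (((hasDerivAt_cos y).const_sub 1).const_mul z)).congr_deriv (by ring)
  have hsin : ∀ y ∈ Set.Icc 0 (π / 2), 0 ≤ sin y := fun y hy =>
    sin_nonneg_of_nonneg_of_le_pi hy.1 (by linarith [hy.2])
  have hcos : ∀ y ∈ Set.Icc 0 (π / 2), 0 ≤ cos y := fun y hy =>
    cos_nonneg_of_neg_pi_div_two_le_of_le (by linarith [hy.1]) hy.2
  have hden : ∀ y ∈ Set.Icc 0 (π / 2), 0 < z * sin y + ν := fun y hy => by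
    have := hsin y hy; positivity
  set u : ℝ → ℝ := fun y => (1 - cos y) / (z * sin y + ν) with hu
  set u' : ℝ → ℝ := fun y => (z * (1 - cos y) + ν * sin y) / (z * sin y + ν) ^ 2 with hu'
  set u'' : ℝ → ℝ := fun y => (z ^ 2 * (1 - cos y) ^ 2 + z * ν * (sin y * (1 - cos y))
    + ν ^ 2 * cos y) / (z * sin y + ν) ^ 3 with hu''
  have hD : ∀ y, HasDerivAt (fun y => z * sin y + ν) (z * cos y) y := fun y =>
    ((hasDerivAt_sin y).const_mul z).add_const ν
  have du : ∀ y ∈ Set.Icc 0 (π / 2), HasDerivAt u (u' y) y := fun y hy => by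
    have hd := hden y hy
    refine (((hasDerivAt_cos y).const_sub 1).div (hD y) hd.ne').congr_deriv ?_
    simp only [hu']
    congr 1
    have := sin_sq_add_cos_sq y
    linear_combination z * this
  have du' : ∀ y ∈ Set.Icc 0 (π / 2), HasDerivAt u' (u'' y) y := fun y hy => by
    have hd := hden y hy
    refine (((((hasDerivAt_cos y).const_sub 1).const_mul z).add
      ((hasDerivAt_sin y).const_mul ν)).div ((hD y).pow 2) (pow_ne_zero _ hd.ne')).congr_deriv ?_
    simp only [hu'', Pi.add_apply, Pi.pow_apply]
    have := sin_sq_add_cos_sq y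
    rw [div_eq_div_iff (by positivity) (by positivity)]
    simp only [Nat.cast_ofNat, Nat.add_one_sub_one, pow_one]
    linear_combination (z ^ 2 * (z * sin y + ν) ^ 4) * this
  have hc0 : ContinuousOn u' (Set.Icc 0 (π / 2)) := fun y hy =>
    (du' y hy).continuousAt.continuousWithinAt
  have hc1 : ContinuousOn u'' (Set.Icc 0 (π / 2)) :=
    ContinuousOn.div (by fun_prop) (by fun_prop) fun y hy => pow_ne_zero _ (hden y hy).ne'
  have hpos : ∀ y ∈ Set.Icc 0 (π / 2), 0 ≤ u'' y := fun y hy => by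
    have h1 := hsin y hy
    have h2 := hcos y hy
    have h3 : 0 ≤ 1 - cos y := by linarith [cos_le_one y]
    have h4 := hden y hy
    simp only [hu'']
    positivity
  have hu0 : u 0 = 0 := by simp [hu]
  have hu1 : u (π / 2) = (z + ν)⁻¹ := by simp [hu]
  have hu'0 : u' 0 = 0 := by simp [hu']
  have hu'1 : u' (π / 2) = (z + ν)⁻¹ := by
    simp only [hu', sin_pi_div_two, cos_pi_div_two]
    field_simp
    ring
  have hqB' : qB' ν z = Complex.I * ∫ y in (0 : ℝ)..(π / 2),
      ((u y * (z * sin y + ν) : ℝ) : ℂ) * cis (Φ y) := by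
    rw [qB', ← intervalIntegral.integral_const_mul]
    refine intervalIntegral.integral_congr fun y hy => ?_
    rw [Set.uIcc_of_le (by positivity)] at hy
    simp only [hu, hΦdef]
    rw [div_mul_cancel₀ _ (hden y hy).ne']
    ring
  have hΦ1 : Φ (π / 2) = ν * (π / 2) + z := by simp [hΦdef]
  rw [integral_mul_deriv_cis (by positivity) (fun y _ => hΦ y) (by fun_prop) du hc0, hu0, hu1,
    hΦ1] at hqB'
  have hfin : qt' ν z = -(∫ y in (0 : ℝ)..(π / 2), (u' y : ℂ) * cis (Φ y))
      + cis (ν * (π / 2) + z) * (Complex.I * (-1 / (z + ν) ^ 2 : ℝ)) := by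
    unfold qt'
    rw [hqB']
    push_cast
    linear_combination (cis (ν * (π / 2) + z) * (z + ν : ℂ)⁻¹) * Complex.I_sq
  have hvar : ∫ y in (0 : ℝ)..(π / 2), ‖(u'' y : ℂ)‖ = (z + ν)⁻¹ := by
    have hftc : ∫ y in (0 : ℝ)..(π / 2), u'' y = u' (π / 2) - u' 0 :=
      intervalIntegral.integral_eq_sub_of_hasDerivAt
        (fun y hy => du' y (by rwa [Set.uIcc_of_le (by positivity)] at hy))
        (hc1.intervalIntegrable_of_Icc (by positivity))
    rw [hu'0, hu'1, sub_zero] at hftc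
    rw [← hftc]
    refine intervalIntegral.integral_congr fun y hy => ?_
    rw [Set.uIcc_of_le (by positivity)] at hy
    simp [abs_of_nonneg (hpos y hy)]
  have hI : ‖∫ y in (0 : ℝ)..(π / 2), (u' y : ℂ) * cis (Φ y)‖
      ≤ 23 / √z * (‖((u' (π / 2) : ℝ) : ℂ)‖ + ∫ y in (0 : ℝ)..(π / 2), ‖(u'' y : ℂ)‖) :=
    norm_integral_mul_le (by positivity) (by fun_prop) (fun x hx => norm_qB_le hν hz hx)
      (fun y hy => (du' y hy).ofReal_comp) (Complex.continuous_ofReal.comp_continuousOn hc1)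
  have hinv : (z + ν)⁻¹ ≤ 1 / z := by
    rw [one_div]; exact inv_anti₀ hz0 (by linarith)
  have hinv0 : 0 < (z + ν)⁻¹ := by positivity
  rw [hvar, hu'1, Complex.norm_real, Real.norm_of_nonneg hinv0.le] at hI
  rw [hfin]
  refine (norm_add_le _ _).trans ?_
  rw [norm_neg, norm_mul, norm_cis, one_mul, norm_mul, Complex.norm_I, one_mul, Complex.norm_real,
    norm_div, norm_neg, norm_one, Real.norm_of_nonneg (by positivity : 0 ≤ (z + ν) ^ 2)]
  calc _ ≤ 23 / √z * (1 / z + 1 / z) + 1 / (z * √z) := by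
        refine add_le_add (hI.trans (by gcongr)) ?_
        gcongr
        nlinarith
    _ = _ := by field_simp; norm_num

end

/-- The one-dimensional factor `∫ e^{-i(z cos x + ν x)} dx` over a period of the cosine. -/
def Gf (ν z : ℝ) : ℂ := ∫ x in (0 : ℝ)..(2 * π), cis (-(z * cos x + ν * x))

lemma cis_neg (t : ℝ) : cis (-t) = starRingEnd ℂ (cis t) := by
  simp only [cis, ← Complex.exp_conj, map_mul, Complex.conj_ofReal, Complex.conj_I]
  push_cast
  ring_nf

lemma Gf_neg (ν z : ℝ) : Gf (-ν) z = cis (2 * π * ν) * Gf ν z := by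
  unfold Gf
  rw [← intervalIntegral.integral_const_mul]
  have := intervalIntegral.integral_comp_sub_left (a := 0) (b := 2 * π)
    (fun x => cis (-(z * cos x + -ν * x))) (2 * π)
  rw [sub_self, sub_zero] at this
  rw [← this]
  refine intervalIntegral.integral_congr fun x _ => ?_
  simp only [cos_two_pi_sub, ← cis_add]
  congr 1
  ring

lemma norm_Gf_le (ν z : ℝ) : ‖Gf ν z‖ ≤ 2 * π := by
  have := norm_integral_cis_le (fun x => -(z * cos x + ν * x)) (by positivity : 0 ≤ 2 * π)
  simpa [Gf] using this

lemma continuous_Gf (ν : ℝ) : Continuous (Gf ν) := by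
  unfold Gf
  apply intervalIntegral.continuous_parametric_intervalIntegral_of_continuous'
  fun_prop

/-- Bessel-type decomposition of `Gf`. -/
lemma Gf_eq (ν z : ℝ) : Gf ν z = cis (-(ν * (π / 2))) * (bP ν z + starRingEnd ℂ (bP ν z))
    + (cis (-(2 * π * ν)) - 1) * (cis (-z) * qB ν z) := by
  set f : ℝ → ℂ := fun x => cis (-(z * cos x + ν * x)) with hf
  have hfc : Continuous f := by fun_prop
  have hi : ∀ a b, IntervalIntegrable f volume a b := fun a b => hfc.intervalIntegrable _ _
  have h1 : (∫ x in (0 : ℝ)..(2 * π), f x) = (∫ x in (-(π / 2))..(3 * π / 2), f x)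
      - (∫ x in (-(π / 2))..0, f x) + ∫ x in (3 * π / 2)..(2 * π), f x := by
    have a1 := intervalIntegral.integral_add_adjacent_intervals (hi (-(π / 2)) 0) (hi 0 (2 * π))
    have a2 := intervalIntegral.integral_add_adjacent_intervals (hi (-(π / 2)) (3 * π / 2))
      (hi (3 * π / 2) (2 * π))
    linear_combination a1 - a2
  have h2 : (∫ x in (3 * π / 2)..(2 * π), f x)
      = cis (-(2 * π * ν)) * ∫ x in (-(π / 2))..0, f x := by
    have := intervalIntegral.integral_comp_add_right (a := -(π / 2)) (b := 0) f (2 * π)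
    rw [show -(π / 2) + 2 * π = 3 * π / 2 by ring, zero_add] at this
    rw [← this, ← intervalIntegral.integral_const_mul]
    refine intervalIntegral.integral_congr fun x _ => ?_
    simp only [hf, cos_add_two_pi, ← cis_add]
    congr 1
    ring
  have h3 : (∫ x in (-(π / 2))..0, f x) = cis (-z) * qB ν z := by
    have := intervalIntegral.integral_comp_neg (a := 0) (b := π / 2) f
    rw [neg_zero] at this
    rw [← this, qB, ← intervalIntegral.integral_const_mul]
    refine intervalIntegral.integral_congr fun x _ => ?_
    simp only [hf, cos_neg, one_mul, ← cis_add]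
    congr 1
    ring
  have h4 : (∫ x in (-(π / 2))..(3 * π / 2), f x)
      = cis (-(ν * (π / 2))) * (bP ν z + starRingEnd ℂ (bP ν z)) := by
    set g : ℝ → ℂ := fun θ => cis (ν * θ + z * (-sin θ)) with hg
    have hgc : Continuous g := by fun_prop
    have hgi : ∀ a b, IntervalIntegrable g volume a b := fun a b => hgc.intervalIntegrable _ _
    have h5 := intervalIntegral.integral_comp_sub_left (a := -π) (b := π) f (π / 2)
    rw [show π / 2 - π = -(π / 2) by ring, show π / 2 - -π = 3 * π / 2 by ring] at h5
    have h6 : (∫ x in (-π)..π, f (π / 2 - x)) = cis (-(ν * (π / 2))) * ∫ x in (-π)..π, g x := by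
      rw [← intervalIntegral.integral_const_mul]
      refine intervalIntegral.integral_congr fun x _ => ?_
      simp only [hf, hg, cos_pi_div_two_sub, ← cis_add]
      congr 1
      ring
    have h7 : (∫ x in (-π)..0, g x) = starRingEnd ℂ (bP ν z) := by
      have := intervalIntegral.integral_comp_neg (a := 0) (b := π) g
      rw [neg_zero] at this
      rw [← this, bP_eq, intervalIntegral.integral_of_le pi_pos.le,
        intervalIntegral.integral_of_le pi_pos.le, ← integral_conj]
      refine integral_congr_ae (Filter.Eventually.of_forall fun x => ?_)
      simp only [hg, sin_neg, ← cis_neg]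
      congr 1
      ring
    have h8 := intervalIntegral.integral_add_adjacent_intervals (hgi (-π) 0) (hgi 0 π)
    rw [← h5, h6, ← h8, h7, bP_eq]
    ring
  change (∫ x in (0 : ℝ)..(2 * π), f x) = _
  rw [h1, h2, h3, h4]
  ring

/-- An oscillating wave `ℓ³ m^{-1/2} c e^{iφ}` on `[max (1/10) t₀, 2]`, with `φ' = ± λ m`. -/
structure Wave (lam l M : ℝ) where
  /-- starting point -/
  t0 : ℝ
  /-- squared frequency -/
  q : ℝ
  /-- direction -/
  e : ℝ
  /-- slowly varying amplitude -/
  c : ℝ → ℂ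
  /-- derivative of the amplitude -/
  c' : ℝ → ℂ
  /-- phase -/
  φ : ℝ → ℝ
  hq : 0 ≤ q
  he : e = 1 ∨ e = -1
  hdom : ∀ τ, 1 / 10 ≤ τ → t0 ≤ τ → q < 4 * τ ^ 2
  hφ : ∀ τ, 1 / 10 ≤ τ → t0 ≤ τ → HasDerivAt φ (lam * (e * mm q τ)) τ
  hc : max (1 / 10) t0 ≤ 2 → BVOn c c' (max (1 / 10) t0) 2 M

/-- The value of a wave, zero before its starting point. -/
def Wave.val {lam l M : ℝ} (W : Wave lam l M) (τ : ℝ) : ℂ :=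
  if τ < W.t0 then 0 else ((l ^ 3 * amp W.q τ : ℝ) : ℂ) * W.c τ * cis (W.φ τ)

/-- The weight `(1 + ℓ^{-4} |2τ - s|)^{-1/4}`. -/
def wt (l s τ : ℝ) : ℝ := (√√(1 + |2 * τ - s| / l ^ 4))⁻¹

lemma wt_pos (l s τ : ℝ) : 0 < wt l s τ := by unfold wt; positivity

lemma wt_pow_four (hl : l ≠ 0) : wt l s τ ^ 4 = l ^ 4 / (l ^ 4 + |2 * τ - s|) := by
  have h0 : 0 < l ^ 4 := by positivity
  have h : 0 ≤ 1 + |2 * τ - s| / l ^ 4 := by positivity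
  rw [wt, inv_pow, show √√(1 + |2 * τ - s| / l ^ 4) ^ 4
    = (√√(1 + |2 * τ - s| / l ^ 4) ^ 2) ^ 2 by ring, Real.sq_sqrt (Real.sqrt_nonneg _),
    Real.sq_sqrt h]
  field_simp

lemma wt_le_one (l s τ : ℝ) : wt l s τ ≤ 1 := by
  unfold wt
  refine inv_le_one_of_one_le₀ ?_
  rw [Real.one_le_sqrt, Real.one_le_sqrt]
  have : 0 ≤ |2 * τ - s| / l ^ 4 := by positivity
  linarith

lemma continuous_wt (l s : ℝ) : Continuous (wt l s) := by
  unfold wt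
  refine Continuous.inv₀ (by fun_prop) fun τ => ?_
  positivity

lemma BVOn.of_majorant {c c' : ℝ → ℂ} {H h : ℝ → ℝ} {a b M : ℝ} (hab : a ≤ b)
    (hc : ∀ x ∈ Set.Icc a b, HasDerivAt c (c' x) x) (hc' : ContinuousOn c' (Set.Icc a b))
    (hM : ∀ x ∈ Set.Icc a b, ‖c x‖ ≤ M) (hH : ∀ x ∈ Set.Icc a b, HasDerivAt H (h x) x)
    (hh : ContinuousOn h (Set.Icc a b)) (hle : ∀ x ∈ Set.Icc a b, ‖c' x‖ ≤ h x)
    (hv : H b - H a ≤ M) : BVOn c c' a b M := by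
  refine ⟨hc, hc', hM, le_trans ?_ hv⟩
  have hi := hh.intervalIntegrable_of_Icc (μ := volume) hab
  have hftc : ∫ x in a..b, h x = H b - H a :=
    intervalIntegral.integral_eq_sub_of_hasDerivAt
      (fun x hx => hH x (by rwa [Set.uIcc_of_le hab] at hx)) hi
  rw [← hftc]
  exact intervalIntegral.integral_mono_on hab (hc'.norm.intervalIntegrable_of_Icc hab) hi hle

lemma bvOn_inv_sqrt {a b : ℝ} (ha : 1 / 10 ≤ a) (hab : a ≤ b) :
    BVOn (fun τ => (((√τ)⁻¹ : ℝ) : ℂ)) (fun τ => ((-(1 / (2 * √τ)) / √τ ^ 2 : ℝ) : ℂ)) a b 4 := by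
  have hd : ∀ x ∈ Set.Icc a b, HasDerivAt (fun τ => (√τ)⁻¹) (-(1 / (2 * √x)) / √x ^ 2) x := by
    intro x hx
    have h0 : 0 < x := by linarith [hx.1]
    exact (Real.hasDerivAt_sqrt h0.ne').fun_inv (Real.sqrt_pos.2 h0).ne'
  have hpos : ∀ x ∈ Set.Icc a b, √x ≠ 0 := fun x hx =>
    (Real.sqrt_pos.2 (by linarith [hx.1])).ne'
  have hc : ContinuousOn (fun τ => -(1 / (2 * √τ)) / √τ ^ 2) (Set.Icc a b) := by
    refine ContinuousOn.div (ContinuousOn.neg (ContinuousOn.div (by fun_prop) (by fun_prop) ?_))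
      (by fun_prop) ?_
    · intro x hx; have := hpos x hx; positivity
    · intro x hx; have := hpos x hx; positivity
  have hb : ∀ x, a ≤ x → (√x)⁻¹ ≤ 4 := fun x hx => by
    have : (1 / 4 : ℝ) ≤ √x := Real.le_sqrt_of_sq_le (by linarith)
    calc (√x)⁻¹ ≤ (1 / 4 : ℝ)⁻¹ := inv_anti₀ (by norm_num) this
      _ = 4 := by norm_num
  refine BVOn.of_majorant hab (fun x hx => (hd x hx).ofReal_comp)
    (Complex.continuous_ofReal.comp_continuousOn hc) (fun x hx => ?_)
    (fun x hx => (hd x hx).neg) hc.neg (fun x hx => ?_) ?_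
  · rw [Complex.norm_real, Real.norm_of_nonneg (by positivity)]
    exact hb x hx.1
  · rw [Complex.norm_real, Real.norm_of_nonpos]
    rw [neg_div, neg_nonpos]
    positivity
  · have := hb a le_rfl
    have h0 : 0 ≤ (√b)⁻¹ := by positivity
    simp only [Pi.neg_apply]
    linarith

section
variable {lam l s : ℝ}

lemma lam_pos (hl : 0 < l) (hlam : lam * l ^ 6 = 1) : 0 < lam := by
  by_contra h
  have : 0 < l ^ 6 := by positivity
  nlinarith

lemma lam_eq (hl : 0 < l) (hlam : lam * l ^ 6 = 1) : lam = 1 / l ^ 6 := by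
  field_simp; linarith

lemma norm_am'_scaled_le (hl : 0 < l) (hlam : lam * l ^ 6 = 1) (hs : 0 ≤ s) {τ : ℝ} (hτ : τ ≤ 2)
    (h : s < 2 * τ) : ‖am' (lam * s) (2 * lam * τ)‖ * (2 * lam) ≤
      105 * l ^ 3 / √√(2 * τ - s) ^ 7 := by
  have hlp := lam_pos hl hlam
  have hνz : lam * s < 2 * lam * τ := by nlinarith
  have h1 := norm_am'_le (mul_nonneg hlp.le hs) hνz
  have hr := br_pos (mul_nonneg hlp.le hs) hνz
  have hrsq := br_sq (mul_nonneg hlp.le hs) hνz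
  set r := br (lam * s) (2 * lam * τ)
  have hB : 0 < √r := Real.sqrt_pos.2 hr
  have hBr : √r ^ 2 = r := Real.sq_sqrt hr.le
  set B := √r
  have hR : 0 < √√(2 * τ - s) := Real.sqrt_pos.2 (Real.sqrt_pos.2 (by linarith))
  have hR4 : √√(2 * τ - s) ^ 4 = 2 * τ - s := by
    rw [show √√(2 * τ - s) ^ 4 = (√√(2 * τ - s) ^ 2) ^ 2 by ring, Real.sq_sqrt (Real.sqrt_nonneg _),
      Real.sq_sqrt (by linarith)]
  set R := √√(2 * τ - s)
  have hτ0 : 0 < 2 * τ := by linarith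
  have hU : 0 < √√(2 * τ) := Real.sqrt_pos.2 (Real.sqrt_pos.2 hτ0)
  have hU4 : √√(2 * τ) ^ 4 = 2 * τ := by
    rw [show √√(2 * τ) ^ 4 = (√√(2 * τ) ^ 2) ^ 2 by ring, Real.sq_sqrt (Real.sqrt_nonneg _),
      Real.sq_sqrt hτ0.le]
  set U := √√(2 * τ)
  have hU2 : U ≤ 3 / 2 := by
    refine le_of_pow_le_pow_left₀ (n := 4) (by norm_num) (by norm_num) ?_
    rw [hU4]; norm_num; linarith
  have hle : R * U ≤ l ^ 3 * B := by
    refine le_of_pow_le_pow_left₀ (n := 4) (by norm_num) (by positivity) ?_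
    have hB4 : B ^ 4 = (2 * lam * τ - lam * s) * (2 * lam * τ + lam * s) := by
      rw [← hrsq, ← hBr]; ring
    rw [mul_pow, mul_pow, hR4, hU4, hB4]
    have : (l ^ 3) ^ 4 * ((2 * lam * τ - lam * s) * (2 * lam * τ + lam * s))
        = (lam * l ^ 6) ^ 2 * ((2 * τ - s) * (2 * τ + s)) := by ring
    rw [this, hlam]
    nlinarith
  have h7 : R ^ 7 * U ^ 7 ≤ l ^ 21 * B ^ 7 := by
    calc R ^ 7 * U ^ 7 = (R * U) ^ 7 := by ring
      _ ≤ (l ^ 3 * B) ^ 7 := by gcongr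
      _ = _ := by ring
  have hz : 2 * lam * τ = lam * U ^ 4 := by rw [hU4]; ring
  rw [hz, ← hBr] at h1
  rw [lam_eq hl hlam] at h1 ⊢
  rw [show 2 * (1 / l ^ 6) * τ = (1 / l ^ 6) * U ^ 4 by rw [hU4]; ring]
  calc _ ≤ 35 * (B * (1 / l ^ 6 * U ^ 4) ^ 2 / (B ^ 2) ^ 4) * (2 * (1 / l ^ 6)) := by gcongr
    _ = 70 * U ^ 8 / (l ^ 18 * B ^ 7) := by field_simp; norm_num
    _ = 70 * U ^ 8 * l ^ 3 / (l ^ 21 * B ^ 7) := by field_simp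
    _ ≤ 70 * U ^ 8 * l ^ 3 / (R ^ 7 * U ^ 7) := by gcongr
    _ = 70 * U * l ^ 3 / R ^ 7 := by field_simp
    _ ≤ _ := by
      gcongr
      linarith

lemma norm_am_scaled_le (hl : 0 < l) (hlam : lam * l ^ 6 = 1) (hs : 0 ≤ s) {τ : ℝ} (hτ : τ ≤ 2)
    (h : s + l ^ 4 ≤ 2 * τ) : ‖am (lam * s) (2 * lam * τ)‖ ≤ 83 := by
  have hlp := lam_pos hl hlam
  have hl4 : 0 < l ^ 4 := by positivity
  refine norm_am_le (mul_nonneg hlp.le hs) (by nlinarith) ?_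
  have : lam * l ^ 4 ≤ 2 * lam * τ - lam * s := by nlinarith
  have h3 : (lam * l ^ 4) ^ 3 ≤ (2 * lam * τ - lam * s) ^ 3 := by gcongr
  have h4 : (lam * l ^ 4) ^ 3 = lam := by
    calc (lam * l ^ 4) ^ 3 = (lam * l ^ 6) ^ 2 * lam := by ring
      _ = _ := by rw [hlam]; ring
  nlinarith

lemma bvOn_am (hl : 0 < l) (hlam : lam * l ^ 6 = 1) (hs : 0 ≤ s) {a : ℝ}
    (ha : s + l ^ 4 ≤ 2 * a) (ha2 : a ≤ 2) :
    BVOn (fun τ => am (lam * s) (2 * lam * τ))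
      (fun τ => ((2 * lam : ℝ) : ℂ) * am' (lam * s) (2 * lam * τ)) a 2 83 := by
  have hlp := lam_pos hl hlam
  have hl4 : 0 < l ^ 4 := by positivity
  have hgt : ∀ x, a ≤ x → s < 2 * x := fun x hx => by linarith
  have hRpos : ∀ x, a ≤ x → 0 < √√(2 * x - s) := fun x hx =>
    Real.sqrt_pos.2 (Real.sqrt_pos.2 (by linarith [hgt x hx]))
  have hνz : ∀ x, a ≤ x → lam * s < 2 * lam * x := fun x hx => by nlinarith [hgt x hx]
  have hν : 0 ≤ lam * s := by positivity
  refine BVOn.of_majorant ha2 (H := fun τ => -(70 * l ^ 3 * (√√(2 * τ - s) ^ 3)⁻¹))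
    (h := fun τ => 105 * l ^ 3 / √√(2 * τ - s) ^ 7) (fun x hx => ?_) ?_ (fun x hx => ?_)
    (fun x hx => ?_) ?_ (fun x hx => ?_) ?_
  · have := (hasDerivAt_am hν (hνz x hx.1)).scomp x ((hasDerivAt_id x).const_mul (2 * lam))
    refine this.congr_deriv ?_
    rw [Complex.real_smul, mul_one]
  · refine continuousOn_const.mul ((continuousOn_am' hν).comp (by fun_prop) ?_)
    exact fun x hx => hνz x hx.1
  · exact norm_am_scaled_le hl hlam hs hx.2 (by linarith [hx.1])
  · have h0 : 0 < 2 * x - s := by linarith [hgt x hx.1]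
    have hR := hRpos x hx.1
    have hS : 0 < √(2 * x - s) := Real.sqrt_pos.2 h0
    have d0 : HasDerivAt (fun τ => 2 * τ - s) 2 x := by
      simpa using ((hasDerivAt_id x).const_mul 2).sub_const s
    have d1 := ((((d0.sqrt h0.ne').sqrt hS.ne').fun_pow 3).fun_inv (pow_pos hR 3).ne').const_mul
      (70 * l ^ 3)
    refine d1.neg.congr_deriv ?_
    have hRS : √(2 * x - s) = √√(2 * x - s) ^ 2 := (Real.sq_sqrt hS.le).symm
    set R := √√(2 * x - s)
    rw [hRS]
    field_simp
    norm_num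
    ring
  · refine ContinuousOn.div (by fun_prop) (by fun_prop) fun x hx => ?_
    have := hRpos x hx.1
    positivity
  · rw [norm_mul, Complex.norm_real, Real.norm_of_nonneg (by positivity), mul_comm]
    exact norm_am'_scaled_le hl hlam hs hx.2 (hgt x hx.1)
  · have h1 : l ≤ √√(2 * a - s) := by
      refine Real.le_sqrt_of_sq_le (Real.le_sqrt_of_sq_le ?_)
      nlinarith
    have h2 : l ^ 3 * (√√(2 * a - s) ^ 3)⁻¹ ≤ 1 := by
      rw [← div_eq_mul_inv, div_le_one (by have := hRpos a le_rfl; positivity)]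
      gcongr
    have h3 : 0 ≤ l ^ 3 * (√√(2 * 2 - s) ^ 3)⁻¹ := by positivity
    linarith

end

section
variable {lam l s : ℝ}

lemma bvOn_qt (hl : 0 < l) (hl2 : l ≤ 1 / 2) (hlam : lam * l ^ 6 = 1) (hs : 0 < s) {a : ℝ}
    (ha : 1 / 10 ≤ a) (ha2 : a ≤ 2) :
    BVOn (fun τ => qt (lam * s) (2 * lam * τ))
      (fun τ => ((2 * lam : ℝ) : ℂ) * qt' (lam * s) (2 * lam * τ)) a 2 (2820 * l ^ 3) := by
  have hlp := lam_pos hl hlam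
  have hν : 0 < lam * s := by positivity
  have hl6 : 64 * l ^ 6 ≤ 1 := by
    have : l ^ 6 ≤ (1 / 2) ^ 6 := by gcongr
    linarith
  have hlam64 : 64 ≤ lam := by
    by_contra h
    have : 0 < l ^ 6 := by positivity
    nlinarith
  have hz : ∀ x, a ≤ x → lam / 5 ≤ 2 * lam * x := fun x hx => by nlinarith
  have hsq : ∀ x, a ≤ x → 1 / (3 * l ^ 3) ≤ √(2 * lam * x) := fun x hx => by
    refine Real.le_sqrt_of_sq_le ((?_ : _ ≤ lam / 5).trans (hz x hx))
    rw [lam_eq hl hlam]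
    field_simp
    norm_num
  refine BVOn.of_majorant ha2 (H := fun τ => 1410 * l ^ 3 * τ) (h := fun _ => 1410 * l ^ 3)
    (fun x hx => ?_) ?_ (fun x hx => ?_) (fun x hx => ?_) continuousOn_const (fun x hx => ?_) ?_
  · have h0 : 0 < 2 * lam * x := by linarith [hz x hx.1]
    have := (hasDerivAt_qt hν h0).scomp x ((hasDerivAt_id x).const_mul (2 * lam))
    refine this.congr_deriv ?_
    rw [Complex.real_smul, mul_one]
  · refine continuousOn_const.mul ((continuousOn_qt' hν).comp (by fun_prop) ?_)
    intro x hx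
    have := hz x hx.1
    exact (by linarith : 0 < 2 * lam * x)
  · have h1 := norm_qt_le hν (by linarith [hz x hx.1] : 1 ≤ 2 * lam * x)
    calc _ ≤ 24 / √(2 * lam * x) := h1
      _ ≤ 24 / (1 / (3 * l ^ 3)) := by gcongr; exact hsq x hx.1
      _ = 72 * l ^ 3 := by field_simp; norm_num
      _ ≤ _ := by gcongr; norm_num
  · simpa using (hasDerivAt_id x).const_mul (1410 * l ^ 3)
  · rw [norm_mul, Complex.norm_real, Real.norm_of_nonneg (by positivity)]
    have h1 := norm_qt'_le hν (by linarith [hz x hx.1] : 1 ≤ 2 * lam * x)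
    calc _ ≤ 2 * lam * (47 / (2 * lam * x * √(2 * lam * x))) := by gcongr
      _ ≤ 2 * lam * (47 / (lam / 5 * (1 / (3 * l ^ 3)))) := by
        gcongr
        · linarith [hz x hx.1]
        · exact hz x hx.1
        · exact hsq x hx.1
      _ = 1410 * l ^ 3 := by field_simp; norm_num
  · have : 0 < l ^ 3 := by positivity
    nlinarith

lemma br_scaled (hlam : 0 < lam) {τ : ℝ} (hτ : 0 < τ) :
    br (lam * s) (2 * lam * τ) = lam * τ * mm (s ^ 2) τ := by
  unfold br mm
  have : (2 * lam * τ) ^ 2 - (lam * s) ^ 2 = (lam * τ) ^ 2 * (4 - s ^ 2 / τ ^ 2) := by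
    field_simp
    ring
  rw [this, Real.sqrt_mul (by positivity), Real.sqrt_sq (by positivity)]

/-- The wave attached to the critical point of Bessel's half integral. -/
def waveA (hl : 0 < l) (hlam : lam * l ^ 6 = 1) (hs : 0 ≤ s) (κ : ℂ) (hκ : ‖κ‖ = 1) :
    Wave lam l 20000 where
  t0 := (s + l ^ 4) / 2
  q := s ^ 2
  e := -1
  c := fun τ => κ * (am (lam * s) (2 * lam * τ) * (((√τ)⁻¹ : ℝ) : ℂ))
  c' := fun τ => 0 * (am (lam * s) (2 * lam * τ) * (((√τ)⁻¹ : ℝ) : ℂ)) +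
    κ * (((2 * lam : ℝ) : ℂ) * am' (lam * s) (2 * lam * τ) * (((√τ)⁻¹ : ℝ) : ℂ)
      + am (lam * s) (2 * lam * τ) * ((-(1 / (2 * √τ)) / √τ ^ 2 : ℝ) : ℂ))
  φ := fun τ => -bph (lam * s) (2 * lam * τ)
  hq := by positivity
  he := Or.inr rfl
  hdom := fun τ _ h => by
    have : 0 < l ^ 4 := by positivity
    nlinarith
  hφ := fun τ h1 h => by
    have hlp := lam_pos hl hlam
    have h4 : 0 < l ^ 4 := by positivity
    have hz : lam * s < 2 * lam * τ := by nlinarith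
    have := (hasDerivAt_bph (by positivity) hz).comp τ ((hasDerivAt_id τ).const_mul (2 * lam))
    refine this.neg.congr_deriv ?_
    have hτ : 0 < τ := by linarith
    change -(br (lam * s) (2 * lam * τ) / (2 * lam * τ) * (2 * lam * 1)) = _
    rw [br_scaled hlp hτ]
    field_simp
  hc := fun h => by
    have h1 : s + l ^ 4 ≤ 2 * max (1 / 10) ((s + l ^ 4) / 2) := by
      linarith [le_max_right (1 / 10) ((s + l ^ 4) / 2)]
    exact ((BVOn.const κ _ _).mul h ((bvOn_am hl hlam hs h1 h).mul h
      (bvOn_inv_sqrt (le_max_left _ _) h))).le (by rw [hκ]; norm_num)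

/-- The wave produced by the endpoint stationary point at zero. -/
def waveQ (hl : 0 < l) (hl2 : l ≤ 1 / 2) (hlam : lam * l ^ 6 = 1) (hs : 0 < s) (κ : ℂ)
    (hκ : ‖κ‖ ≤ 2) : Wave lam l 20000 where
  t0 := 0
  q := 0
  e := -1
  c := fun τ => κ * (√2 / l ^ 3 : ℝ) * qt (lam * s) (2 * lam * τ)
  c' := fun τ => 0 * qt (lam * s) (2 * lam * τ)
    + κ * (√2 / l ^ 3 : ℝ) * (((2 * lam : ℝ) : ℂ) * qt' (lam * s) (2 * lam * τ))
  φ := fun τ => -(2 * lam * τ)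
  hq := le_rfl
  he := Or.inr rfl
  hdom := fun τ h1 _ => by positivity
  hφ := fun τ h1 h => by
    refine ((hasDerivAt_id τ).const_mul (2 * lam)).neg.congr_deriv ?_
    have : mm 0 τ = 2 := by
      rw [mm, zero_div, sub_zero, show (4 : ℝ) = 2 ^ 2 by norm_num, Real.sqrt_sq (by norm_num)]
    rw [this]
    ring
  hc := fun h => by
    refine ((BVOn.const _ _ _).mul h (bvOn_qt hl hl2 hlam hs (le_max_left _ _) h)).le ?_
    have h2 : √2 ≤ 3 / 2 := by rw [Real.sqrt_le_left (by norm_num)]; norm_num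
    rw [norm_mul, Complex.norm_real, Real.norm_of_nonneg (by positivity)]
    calc 2 * (‖κ‖ * (√2 / l ^ 3)) * (2820 * l ^ 3) = ‖κ‖ * √2 * 5640 := by field_simp; ring
      _ ≤ 2 * (3 / 2) * 5640 := by gcongr
      _ ≤ _ := by norm_num

/-- The zero wave. -/
def waveZ (lam l : ℝ) : Wave lam l 20000 where
  t0 := 0
  q := 0
  e := -1
  c := fun _ => 0
  c' := fun _ => 0
  φ := fun τ => -(2 * lam * τ)
  hq := le_rfl
  he := Or.inr rfl
  hdom := fun τ h1 _ => by positivity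
  hφ := fun τ h1 h => by
    refine ((hasDerivAt_id τ).const_mul (2 * lam)).neg.congr_deriv ?_
    have : mm 0 τ = 2 := by
      rw [mm, zero_div, sub_zero, show (4 : ℝ) = 2 ^ 2 by norm_num, Real.sqrt_sq (by norm_num)]
    rw [this]
    ring
  hc := fun h => (BVOn.const 0 _ _).le (by norm_num)

/-- Complex conjugate of a wave. -/
def Wave.conj {M : ℝ} (W : Wave lam l M) : Wave lam l M where
  t0 := W.t0
  q := W.q
  e := -W.e
  c := fun τ => starRingEnd ℂ (W.c τ)
  c' := fun τ => starRingEnd ℂ (W.c' τ)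
  φ := fun τ => -W.φ τ
  hq := W.hq
  he := by rcases W.he with h | h <;> simp [h]
  hdom := W.hdom
  hφ := fun τ h1 h => (W.hφ τ h1 h).neg.congr_deriv (by ring)
  hc := fun h => (W.hc h).conj

lemma Wave.conj_val {M : ℝ} (W : Wave lam l M) (τ : ℝ) :
    W.conj.val τ = starRingEnd ℂ (W.val τ) := by
  unfold Wave.val
  by_cases h : τ < W.t0
  · rw [if_pos h, if_pos (show τ < W.conj.t0 from h), map_zero]
  · rw [if_neg h, if_neg (show ¬ τ < W.conj.t0 from h), map_mul, map_mul, ← cis_neg,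
      Complex.conj_ofReal]
    rfl

lemma Wave.norm_val_le {M : ℝ} (hl : 0 < l) (W : Wave lam l M) {τ : ℝ} (h1 : 1 / 10 ≤ τ)
    (h2 : τ ≤ 2) (h : W.t0 ≤ τ) : ‖W.val τ‖ ≤ l ^ 3 * amp W.q τ * M := by
  rw [Wave.val, if_neg (not_lt.2 h), norm_mul, norm_mul, norm_cis, mul_one, Complex.norm_real,
    Real.norm_of_nonneg (mul_nonneg (by positivity) (amp_nonneg _ _))]
  have hm : max (1 / 10) W.t0 ≤ τ := max_le h1 h
  exact mul_le_mul_of_nonneg_left ((W.hc (hm.trans h2)).bound τ ⟨hm, h2⟩)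
    (mul_nonneg (by positivity) (amp_nonneg _ _))

lemma waveA_val (hl : 0 < l) (hlam : lam * l ^ 6 = 1) (hs : 0 ≤ s) (κ : ℂ) (hκ : ‖κ‖ = 1) {τ : ℝ}
    (h1 : 1 / 10 ≤ τ) (h : s + l ^ 4 ≤ 2 * τ) : (waveA hl hlam hs κ hκ).val τ =
      κ * (bP (lam * s) (2 * lam * τ)
        + cis (lam * s * π) * (Complex.I * ((lam * s + 2 * lam * τ)⁻¹ : ℝ))
        + Complex.I * ((2 * lam * τ - lam * s)⁻¹ : ℝ)) := by
  have hτ : 0 < τ := by linarith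
  have hlp := lam_pos hl hlam
  have h4 : 0 < l ^ 4 := by positivity
  have hm : 0 < mm (s ^ 2) τ := mm_pos hτ (by nlinarith)
  rw [Wave.val, if_neg (show ¬ τ < (waveA hl hlam hs κ hκ).t0 from
    not_lt.2 (show (s + l ^ 4) / 2 ≤ τ by linarith))]
  change ((l ^ 3 * amp (s ^ 2) τ : ℝ) : ℂ) * (κ * (am (lam * s) (2 * lam * τ) *
    (((√τ)⁻¹ : ℝ) : ℂ))) * cis (-bph (lam * s) (2 * lam * τ)) = _
  have hbr : √(br (lam * s) (2 * lam * τ)) * (l ^ 3 * amp (s ^ 2) τ * (√τ)⁻¹) = 1 := by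
    rw [br_scaled hlp hτ, Real.sqrt_mul (by positivity), Real.sqrt_mul (by positivity), amp]
    have hsl : √lam * l ^ 3 = 1 := by
      rw [← Real.sqrt_sq (by positivity : 0 ≤ l ^ 3), ← Real.sqrt_mul hlp.le,
        show lam * (l ^ 3) ^ 2 = lam * l ^ 6 by ring, hlam, Real.sqrt_one]
    have := Real.sqrt_pos.2 hm
    have := Real.sqrt_pos.2 hτ
    field_simp
    linarith
  have hc : ((√(br (lam * s) (2 * lam * τ)) : ℝ) : ℂ) *
      (((l ^ 3 * amp (s ^ 2) τ : ℝ) : ℂ) * (((√τ)⁻¹ : ℝ) : ℂ)) = 1 := by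
    rw [← Complex.ofReal_mul, ← Complex.ofReal_mul, hbr, Complex.ofReal_one]
  have hcis := cis_neg_mul (bph (lam * s) (2 * lam * τ))
  unfold am bt
  rw [cis_add]
  set p := cis (bph (lam * s) (2 * lam * τ))
  set p' := cis (-bph (lam * s) (2 * lam * τ))
  set B := bP (lam * s) (2 * lam * τ)
  set X := B + cis (lam * s * π) * (Complex.I * ((lam * s + 2 * lam * τ)⁻¹ : ℝ))
        + Complex.I * ((2 * lam * τ - lam * s)⁻¹ : ℝ) with hX
  linear_combination (κ * X * (p' * p)) * hc + κ * X * hcis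

lemma waveQ_val (hl : 0 < l) (hl2 : l ≤ 1 / 2) (hlam : lam * l ^ 6 = 1) (hs : 0 < s) (κ : ℂ)
    (hκ : ‖κ‖ ≤ 2) {τ : ℝ} (h1 : 1 / 10 ≤ τ) : (waveQ hl hl2 hlam hs κ hκ).val τ =
      κ * (cis (-(2 * lam * τ)) * qt (lam * s) (2 * lam * τ)) := by
  have hτ : 0 < τ := by linarith
  rw [Wave.val, if_neg (show ¬ τ < (waveQ hl hl2 hlam hs κ hκ).t0 from
    not_lt.2 hτ.le)]
  change ((l ^ 3 * amp 0 τ : ℝ) : ℂ) * (κ * (√2 / l ^ 3 : ℝ) * qt (lam * s) (2 * lam * τ))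
    * cis (-(2 * lam * τ)) = _
  have h : l ^ 3 * amp 0 τ * (√2 / l ^ 3) = 1 := by
    have : mm 0 τ = 2 := by
      rw [mm, zero_div, sub_zero, show (4 : ℝ) = 2 ^ 2 by norm_num, Real.sqrt_sq (by norm_num)]
    rw [amp, this]
    field_simp
  have hc : ((l ^ 3 * amp 0 τ : ℝ) : ℂ) * ((√2 / l ^ 3 : ℝ) : ℂ) = 1 := by
    rw [← Complex.ofReal_mul, h, Complex.ofReal_one]
  linear_combination κ * qt (lam * s) (2 * lam * τ) * cis (-(2 * lam * τ)) * hc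

end

section
variable {lam l s : ℝ}

lemma exists_endpoint_wave (hl : 0 < l) (hl2 : l ≤ 1 / 2) (hlam : lam * l ^ 6 = 1) (hs : 0 ≤ s) :
    ∃ W : Wave lam l 20000, ∀ τ ∈ Set.Icc (1 / 10 : ℝ) 2,
      W.val τ = (cis (-(2 * π * (lam * s))) - 1) * (cis (-(2 * lam * τ)) *
        qt (lam * s) (2 * lam * τ)) ∧ ‖W.val τ‖ ≤ 20000 * l ^ 3 := by
  rcases hs.eq_or_lt with rfl | hs
  · refine ⟨waveZ lam l, fun τ hτ => ?_⟩
    have : (waveZ lam l).val τ = 0 := by simp [Wave.val, waveZ]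
    rw [this]
    refine ⟨by simp [cis_zero], ?_⟩
    rw [norm_zero]
    positivity
  · have hκ : ‖cis (-(2 * π * (lam * s))) - 1‖ ≤ 2 := by
      refine (norm_sub_le _ _).trans ?_
      rw [norm_cis, norm_one]
      norm_num
    refine ⟨waveQ hl hl2 hlam hs _ hκ, fun τ hτ => ⟨waveQ_val hl hl2 hlam hs _ hκ hτ.1, ?_⟩⟩
    refine (Wave.norm_val_le hl _ hτ.1 hτ.2 ?_).trans ?_
    · exact (by linarith [hτ.1] : (0 : ℝ) ≤ τ)
    · have : amp 0 τ ≤ 1 / 1 := amp_le_of_le_sq one_pos (by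
        rw [mm, zero_div, sub_zero, show (4 : ℝ) = 2 ^ 2 by norm_num,
          Real.sqrt_sq (by norm_num)]
        norm_num)
      change l ^ 3 * amp 0 τ * 20000 ≤ _
      have h3 : 0 < l ^ 3 := by positivity
      nlinarith

lemma wt_pow_four_ge (hl : 0 < l) {τ : ℝ} (h : l ^ 4 ≤ |2 * τ - s|) :
    l ^ 4 / (2 * |2 * τ - s|) ≤ wt l s τ ^ 4 := by
  have h4 : 0 < l ^ 4 := by positivity
  rw [wt_pow_four hl.ne']
  gcongr
  linarith

lemma wt_pow_four_ge_half (hl : 0 < l) {τ : ℝ} (h : |2 * τ - s| ≤ l ^ 4) :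
    1 / 2 ≤ wt l s τ ^ 4 := by
  have h4 : 0 < l ^ 4 := by positivity
  have := abs_nonneg (2 * τ - s)
  rw [wt_pow_four hl.ne', div_le_div_iff₀ (by norm_num) (by positivity)]
  linarith

lemma amp_le_wt (hl : 0 < l) (hs : 0 ≤ s) {τ : ℝ} (hτ : 0 < τ) (hτ2 : τ ≤ 2)
    (h : s + l ^ 4 ≤ 2 * τ) : l * amp (s ^ 2) τ ≤ 2 * wt l s τ := by
  have h4 : 0 < l ^ 4 := by positivity
  have hρ : 0 < 2 * τ - s := by linarith
  have hw := wt_pow_four_ge (s := s) (τ := τ) hl (by rw [abs_of_pos hρ]; linarith)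
  rw [abs_of_pos hρ] at hw
  have hq : s ^ 2 < 4 * τ ^ 2 := by nlinarith
  have hm := mm_sq hτ hq
  have hm0 := mm_pos hτ hq
  have ha : amp (s ^ 2) τ ^ 4 = 1 / mm (s ^ 2) τ ^ 2 := by
    rw [show amp (s ^ 2) τ ^ 4 = (amp (s ^ 2) τ ^ 2) ^ 2 by ring, amp_sq]; field_simp
  refine le_of_pow_le_pow_left₀ (n := 4) (by norm_num)
    (mul_nonneg (by norm_num) (wt_pos l s τ).le) ?_
  rw [mul_pow, mul_pow, ha]
  refine le_trans ?_ (mul_le_mul_of_nonneg_left hw (by norm_num))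
  rw [mul_one_div, mul_div_assoc', div_le_div_iff₀ (by positivity) (by positivity)]
  have h8 : 2 * (2 * τ - s) ≤ 2 ^ 4 * mm (s ^ 2) τ ^ 2 := by
    rw [hm]
    have h9 : 2 ^ 4 * (4 - s ^ 2 / τ ^ 2) = 16 * ((2 * τ - s) * (2 * τ + s)) / τ ^ 2 := by
      field_simp; ring
    rw [h9, le_div_iff₀ (by positivity)]
    nlinarith [mul_nonneg hρ.le hs, mul_nonneg hρ.le (mul_nonneg hτ.le (sub_nonneg.2 hτ2))]
  nlinarith

/-- Each one-dimensional factor is a sum of three waves up to a small concentrated error. -/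
lemma exists_waves (hl : 0 < l) (hl2 : l ≤ 1 / 2) (hlam : lam * l ^ 6 = 1) (hs : 0 ≤ s) :
    ∃ W : Fin 3 → Wave lam l 20000, ∀ τ ∈ Set.Icc (1 / 10 : ℝ) 2,
      ‖Gf (lam * s) (2 * lam * τ) - ∑ k, (W k).val τ‖ ≤ 600 * l ^ 2 * wt l s τ ^ 4 ∧
      ∀ k, ‖(W k).val τ‖ ≤ 40000 * l ^ 2 * (wt l s τ + l) := by
  obtain ⟨W₀, hW₀⟩ := exists_endpoint_wave hl hl2 hlam hs
  have hlp := lam_pos hl hlam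
  have h4 : 0 < l ^ 4 := by positivity
  set ν := lam * s with hν
  have hν0 : 0 ≤ ν := by positivity
  set κ := cis (ν * (π / 2)) with hκ
  have hκ' : starRingEnd ℂ κ = cis (-(ν * (π / 2))) := (cis_neg _).symm
  have hκ1 : ‖κ‖ = 1 := norm_cis _
  have hκ2 : ‖starRingEnd ℂ κ‖ = 1 := by rw [RCLike.norm_conj, hκ1]
  set A := waveA hl hlam hs (starRingEnd ℂ κ) hκ2
  set B := waveA hl hlam hs κ hκ1
  refine ⟨![W₀, A, B.conj], fun τ hτ => ?_⟩
  have hτ0 : 0 < τ := by linarith [hτ.1]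
  have hw := wt_pos l s τ
  have hA0 : ∀ κ' hκ'', τ < (s + l ^ 4) / 2 → (waveA hl hlam hs κ' hκ'').val τ = 0 :=
    fun κ' hκ'' h => if_pos h
  obtain ⟨hv₀, hb₀⟩ := hW₀ τ hτ
  constructor
  · rw [Fin.sum_univ_three]
    change ‖Gf ν (2 * lam * τ) - (W₀.val τ + A.val τ + B.conj.val τ)‖ ≤ _
    rw [Wave.conj_val, hv₀, Gf_eq, ← hκ']
    have hqB : qB ν (2 * lam * τ) = qt ν (2 * lam * τ)
        - cis (ν * (π / 2) + 2 * lam * τ) * (Complex.I * ((2 * lam * τ + ν)⁻¹ : ℝ)) := by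
      rw [qt]; ring
    rw [hqB]
    set z := 2 * lam * τ with hz
    have hz0 : 0 < z := by positivity
    set D := cis (-(2 * π * ν)) - 1 with hD
    have hD2 : ‖D‖ ≤ 2 := by
      refine (norm_sub_le _ _).trans ?_
      rw [norm_cis, norm_one]
      norm_num
    set E := D * (cis (-z) * (cis (ν * (π / 2) + z) * (Complex.I * ((z + ν)⁻¹ : ℝ)))) with hE
    have hEn : ‖E‖ ≤ 2 * (z + ν)⁻¹ := by
      rw [hE, norm_mul, norm_mul, norm_cis, norm_mul, norm_cis, norm_mul, Complex.norm_I,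
        Complex.norm_real, Real.norm_of_nonneg (by positivity), one_mul, one_mul, one_mul]
      gcongr
    have hlρ : ∀ x : ℝ, lam * x ≠ 0 → (lam * x)⁻¹ = l ^ 6 / x := fun x hx => by
      rw [lam_eq hl hlam] at hx ⊢
      have : x ≠ 0 := right_ne_zero_of_mul hx
      field_simp
    by_cases hcase : τ < (s + l ^ 4) / 2
    · rw [hA0 _ _ hcase, hA0 _ _ hcase, map_zero, add_zero, add_zero]
      have heq : starRingEnd ℂ κ * (bP ν z + starRingEnd ℂ (bP ν z)) + D * (cis (-z) * (qt ν z
          - cis (ν * (π / 2) + z) * (Complex.I * ((z + ν)⁻¹ : ℝ)))) - D * (cis (-z) * qt ν z)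
          = starRingEnd ℂ κ * (bP ν z + starRingEnd ℂ (bP ν z)) - E := by rw [hE]; ring
      rw [heq]
      have hS : ‖starRingEnd ℂ κ * (bP ν z + starRingEnd ℂ (bP ν z)) - E‖
          ≤ 2 * ‖bP ν z‖ + 2 * (z + ν)⁻¹ := by
        refine (norm_sub_le _ _).trans (add_le_add ?_ hEn)
        rw [norm_mul, hκ2, one_mul]
        refine (norm_add_le _ _).trans ?_
        rw [RCLike.norm_conj]
        linarith
      refine hS.trans ?_
      rcases le_or_gt |2 * τ - s| (l ^ 4) with hc | hc
      · have hw4 := wt_pow_four_ge_half hl hc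
        have hz5 : 1 / (5 * l ^ 6) ≤ z := by
          have : lam / 5 ≤ z := by rw [hz]; nlinarith [hτ.1]
          rwa [lam_eq hl hlam, div_div, mul_comm (l ^ 6) 5] at this
        have hb : ‖bP ν z‖ ≤ 72 * (2 * l ^ 2) := by
          refine norm_bP_le_uniform hν0 (by positivity) (by nlinarith) ?_
          calc (1 : ℝ) ≤ 1 / (5 * l ^ 6) * (2 * l ^ 2) ^ 3 := by field_simp; norm_num
            _ ≤ _ := by gcongr
        have hi : (z + ν)⁻¹ ≤ 5 * l ^ 2 := by
          calc (z + ν)⁻¹ ≤ (1 / (5 * l ^ 6))⁻¹ := inv_anti₀ (by positivity) (by linarith)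
            _ = 5 * l ^ 2 * l ^ 4 := by field_simp
            _ ≤ 5 * l ^ 2 * 1 := by
              gcongr
              exact pow_le_one₀ hl.le (by linarith)
            _ = _ := by ring
        nlinarith [sq_nonneg l]
      · have hneg : 2 * τ - s < 0 := by
          by_contra hcon
          rw [abs_of_nonneg (not_lt.1 hcon)] at hc
          linarith
        have hlt : z < ν := by rw [hz, hν]; nlinarith
        have hw4 := wt_pow_four_ge hl hc.le
        have hνz : ν - z = lam * |2 * τ - s| := by rw [abs_of_neg hneg, hz, hν]; ring
        have hb := norm_bP_le_of_lt hz0.le hlt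
        have ht0 : 0 < |2 * τ - s| := h4.trans hc
        rw [hνz, div_eq_mul_inv, hlρ _ (by positivity)] at hb
        have hi : (z + ν)⁻¹ ≤ l ^ 6 / |2 * τ - s| := by
          rw [← hlρ _ (by positivity), ← hνz]
          exact inv_anti₀ (by linarith) (by linarith)
        calc _ ≤ 2 * (4 * (l ^ 6 / |2 * τ - s|)) + 2 * (l ^ 6 / |2 * τ - s|) := by gcongr
          _ = 20 * l ^ 2 * (l ^ 4 / (2 * |2 * τ - s|)) := by field_simp; norm_num
          _ ≤ 600 * l ^ 2 * wt l s τ ^ 4 := by gcongr; norm_num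
    · have hge : s + l ^ 4 ≤ 2 * τ := by linarith
      rw [waveA_val hl hlam hs _ hκ2 hτ.1 hge, waveA_val hl hlam hs _ hκ1 hτ.1 hge, ← hν, ← hz]
      have hρ : 0 < 2 * τ - s := by linarith
      have hzν : z - ν = lam * (2 * τ - s) := by rw [hz, hν]; ring
      have hlt : 0 < z - ν := by rw [hzν]; positivity
      set X := cis (ν * π) * (Complex.I * ((ν + z)⁻¹ : ℝ)) + Complex.I * ((z - ν)⁻¹ : ℝ) with hX
      have hXn : ‖X‖ ≤ 2 * (z - ν)⁻¹ := by
        refine (norm_add_le _ _).trans ?_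
        rw [norm_mul, norm_cis, norm_mul, norm_mul, Complex.norm_I, Complex.norm_real,
          Complex.norm_real, Real.norm_of_nonneg (by positivity),
          Real.norm_of_nonneg (by positivity)]
        have : (ν + z)⁻¹ ≤ (z - ν)⁻¹ := inv_anti₀ hlt (by linarith)
        linarith
      have heq : starRingEnd ℂ κ * (bP ν z + starRingEnd ℂ (bP ν z)) + D * (cis (-z) * (qt ν z
          - cis (ν * (π / 2) + z) * (Complex.I * ((z + ν)⁻¹ : ℝ)))) - (D * (cis (-z) * qt ν z)
          + starRingEnd ℂ κ * (bP ν z + cis (ν * π) * (Complex.I * ((ν + z)⁻¹ : ℝ))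
            + Complex.I * ((z - ν)⁻¹ : ℝ)) + starRingEnd ℂ (κ * (bP ν z
            + cis (ν * π) * (Complex.I * ((ν + z)⁻¹ : ℝ)) + Complex.I * ((z - ν)⁻¹ : ℝ))))
          = -(starRingEnd ℂ κ * X) - starRingEnd ℂ κ * starRingEnd ℂ X - E := by
        rw [add_assoc (bP ν z), ← hX, map_mul, map_add, hE]; ring
      rw [heq]
      have hi : (z + ν)⁻¹ ≤ (z - ν)⁻¹ := inv_anti₀ hlt (by linarith)
      have hw4 := wt_pow_four_ge (s := s) (τ := τ) hl (by rw [abs_of_pos hρ]; linarith)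
      rw [abs_of_pos hρ] at hw4
      calc _ ≤ 2 * (z - ν)⁻¹ + 2 * (z - ν)⁻¹ + 2 * (z - ν)⁻¹ := by
            refine (norm_sub_le _ _).trans (add_le_add ((norm_sub_le _ _).trans
              (add_le_add ?_ ?_)) (hEn.trans (by linarith)))
            · rwa [norm_neg, norm_mul, hκ2, one_mul]
            · rwa [norm_mul, hκ2, one_mul, RCLike.norm_conj]
        _ = 12 * l ^ 2 * (l ^ 4 / (2 * (2 * τ - s))) := by
          rw [hzν, hlρ _ (by positivity)]; field_simp; norm_num
        _ ≤ 600 * l ^ 2 * wt l s τ ^ 4 := by gcongr; norm_num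
  · have hAb : ∀ κ' hκ'', ‖(waveA hl hlam hs κ' hκ'').val τ‖
        ≤ 40000 * l ^ 2 * (wt l s τ + l) := fun κ' hκ'' => by
      by_cases hcase : τ < (s + l ^ 4) / 2
      · rw [hA0 _ _ hcase, norm_zero]; positivity
      · refine (Wave.norm_val_le hl _ hτ.1 hτ.2 (not_lt.1 hcase)).trans ?_
        have := amp_le_wt hl hs hτ0 hτ.2 (by linarith)
        change l ^ 3 * amp (s ^ 2) τ * 20000 ≤ _
        have hl2 : 0 < l ^ 2 := by positivity
        calc l ^ 3 * amp (s ^ 2) τ * 20000 = 20000 * l ^ 2 * (l * amp (s ^ 2) τ) := by ring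
          _ ≤ 20000 * l ^ 2 * (2 * wt l s τ) := by gcongr
          _ ≤ _ := by nlinarith [mul_pos hl2 hl]
    intro k
    fin_cases k
    · refine hb₀.trans ?_
      have : 0 < l ^ 3 := by positivity
      have : 0 < l ^ 2 * wt l s τ := by positivity
      nlinarith
    · exact hAb _ hκ2
    · change ‖B.conj.val τ‖ ≤ _
      rw [Wave.conj_val, RCLike.norm_conj]
      exact hAb _ hκ1

end

lemma wt_pow_six (l s τ : ℝ) :
    wt l s τ ^ 6 = (1 + ‖2 / l ^ 4 * (τ - s / 2)‖) ^ (-(3 / 2 : ℝ)) := by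
  have h1 : ‖2 / l ^ 4 * (τ - s / 2)‖ = |2 * τ - s| / l ^ 4 := by
    rw [Real.norm_eq_abs, show 2 / l ^ 4 * (τ - s / 2) = (2 * τ - s) / l ^ 4 by ring, abs_div,
      abs_of_nonneg (by positivity : 0 ≤ l ^ 4)]
  rw [h1, wt]
  set x := 1 + |2 * τ - s| / l ^ 4
  have hx : 0 < x := by positivity
  rw [Real.sqrt_eq_rpow, Real.sqrt_eq_rpow, ← Real.rpow_mul hx.le, inv_pow, ← Real.rpow_natCast,
    ← Real.rpow_mul hx.le, ← Real.rpow_neg hx.le]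
  norm_num

lemma exists_integral_wt_le : ∃ K : ℝ, 0 < K ∧ ∀ l s : ℝ, 0 < l → l ≤ 1 / 2 →
    ∫ τ in (1 / 10 : ℝ)..2, (wt l s τ + l) ^ 6 ≤ K * l ^ 4 := by
  have hint : Integrable (fun x : ℝ => (1 + ‖x‖) ^ (-(3 / 2 : ℝ))) volume :=
    integrable_one_add_norm (by simp; norm_num)
  set K₀ := ∫ x : ℝ, (1 + ‖x‖) ^ (-(3 / 2 : ℝ)) with hK₀
  have hK₀0 : 0 ≤ K₀ := integral_nonneg fun x => by positivity
  refine ⟨16 * K₀ + 64, by positivity, fun l s hl hl2 => ?_⟩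
  have hl4 : 0 < l ^ 4 := by positivity
  have hcomp : ∫ τ, wt l s τ ^ 6 = l ^ 4 / 2 * K₀ := by
    simp only [wt_pow_six]
    rw [integral_sub_right_eq_self (fun y => (1 + ‖2 / l ^ 4 * y‖) ^ (-(3 / 2 : ℝ))) (s / 2),
      Measure.integral_comp_mul_left (fun y => (1 + ‖y‖) ^ (-(3 / 2 : ℝ))) (2 / l ^ 4), ← hK₀,
      smul_eq_mul, abs_of_pos (by positivity)]
    field_simp
  have hwi : Integrable (fun τ => wt l s τ ^ 6) volume := by
    simp only [wt_pow_six]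
    exact (hint.comp_mul_left' (by positivity : 2 / l ^ 4 ≠ 0)).comp_sub_right (s / 2)
  have hle : ∫ τ in (1 / 10 : ℝ)..2, wt l s τ ^ 6 ≤ l ^ 4 / 2 * K₀ := by
    rw [← hcomp, intervalIntegral.integral_of_le (by norm_num)]
    exact setIntegral_le_integral hwi
      (Filter.Eventually.of_forall fun x => pow_nonneg (wt_pos l s x).le 6)
  have hwc := continuous_wt l s
  have hpt : ∀ τ, (wt l s τ + l) ^ 6 ≤ 32 * wt l s τ ^ 6 + 32 * l ^ 6 := fun τ => by
    have := add_pow_le (wt_pos l s τ).le hl.le 6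
    norm_num at this
    linarith
  calc ∫ τ in (1 / 10 : ℝ)..2, (wt l s τ + l) ^ 6
      ≤ ∫ τ in (1 / 10 : ℝ)..2, (32 * wt l s τ ^ 6 + 32 * l ^ 6) :=
        intervalIntegral.integral_mono_on (by norm_num)
          (Continuous.intervalIntegrable (by fun_prop) _ _)
          (Continuous.intervalIntegrable (by fun_prop) _ _) fun τ _ => hpt τ
    _ = 32 * (∫ τ in (1 / 10 : ℝ)..2, wt l s τ ^ 6) + (2 - 1 / 10) * (32 * l ^ 6) := by
        rw [intervalIntegral.integral_add (Continuous.intervalIntegrable (by fun_prop) _ _)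
          (Continuous.intervalIntegrable (by fun_prop) _ _), intervalIntegral.integral_const_mul,
          intervalIntegral.integral_const, smul_eq_mul]
    _ ≤ 32 * (l ^ 4 / 2 * K₀) + 2 * (32 * l ^ 4) := by
        have h6 : l ^ 6 ≤ l ^ 4 := pow_le_pow_of_le_one hl.le (by linarith) (by norm_num)
        have : 0 < l ^ 6 := by positivity
        gcongr
        norm_num
    _ = _ := by ring

lemma pow_four_mul_mul_le {x y z : ℝ} (hx : 0 ≤ x) (hy : 0 ≤ y) (hz : 0 ≤ z) :
    x ^ 4 * y * z ≤ x ^ 6 + y ^ 6 + z ^ 6 := by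
  set M := max x (max y z) with hM
  have h1 : x ≤ M := le_max_left _ _
  have h2 : y ≤ M := (le_max_left _ _).trans (le_max_right _ _)
  have h3 : z ≤ M := (le_max_right _ _).trans (le_max_right _ _)
  have hM6 : M ^ 6 ≤ x ^ 6 + y ^ 6 + z ^ 6 := by
    have := pow_nonneg hx 6
    have := pow_nonneg hy 6
    have := pow_nonneg hz 6
    rcases max_choice x (max y z) with h | h
    · rw [hM, h]; linarith
    · rcases max_choice y z with h' | h' <;> rw [hM, h, h'] <;> linarith
  calc x ^ 4 * y * z ≤ M ^ 4 * M * M := by gcongr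
    _ = M ^ 6 := by ring
    _ ≤ _ := hM6

section
variable {lam l : ℝ}

/-- The phase `λ (7τ + 1/(4τ))` produced by the subordination formula. -/
def hph (lam τ : ℝ) : ℝ := lam * (7 * τ + 1 / (4 * τ))

lemma hasDerivAt_hph {τ : ℝ} (hτ : 0 < τ) :
    HasDerivAt (hph lam) (lam * (7 - 1 / (4 * τ ^ 2))) τ := by
  have h1 : HasDerivAt (fun t : ℝ => 1 / (4 * t)) (-(1 / (4 * τ ^ 2))) τ := by
    have := (hasDerivAt_const τ (1 : ℝ)).fun_div ((hasDerivAt_id τ).const_mul 4)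
      (by simp; positivity)
    refine this.congr_deriv ?_
    simp only [id]
    field_simp
    norm_num
  have := ((((hasDerivAt_id τ).const_mul 7).add h1).const_mul lam)
  exact this.congr_deriv (by ring)

lemma wave_product_bound (hl : 0 < l) (hl2 : l ≤ 1 / 2) (hlam : lam * l ^ 6 = 1)
    (W : Fin 3 → Wave lam l 20000) {α α' : ℝ → ℂ} {M : ℝ} (hα : BVOn α α' (1 / 10) 2 M) :
    IntervalIntegrable (fun τ => α τ * cis (hph lam τ) * ∏ j, (W j).val τ) volume (1 / 10) 2 ∧
    ‖∫ τ in (1 / 10 : ℝ)..2, α τ * cis (hph lam τ) * ∏ j, (W j).val τ‖ ≤ 10 ^ 23 * M * l ^ 10 := by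
  have hM : 0 ≤ M := (norm_nonneg _).trans (hα.bound 2 (by norm_num))
  set F : ℝ → ℂ := fun τ => α τ * cis (hph lam τ) * ∏ j, (W j).val τ with hF
  set T := max (1 / 10) (max (W 0).t0 (max (W 1).t0 (W 2).t0)) with hT
  have hT1 : 1 / 10 ≤ T := le_max_left _ _
  have hTj : ∀ j, (W j).t0 ≤ T := by
    intro j
    fin_cases j
    · exact (le_max_left _ _).trans (le_max_right _ _)
    · exact (le_max_left _ _).trans ((le_max_right _ _).trans (le_max_right _ _))
    · exact (le_max_right _ _).trans ((le_max_right _ _).trans (le_max_right _ _))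
  have hzero : ∀ τ, 1 / 10 ≤ τ → τ < T → F τ = 0 := by
    intro τ h1 h2
    have : ∃ j, τ < (W j).t0 := by
      rcases lt_max_iff.1 h2 with h | h
      · linarith
      rcases lt_max_iff.1 h with h | h
      · exact ⟨0, h⟩
      rcases lt_max_iff.1 h with h | h
      · exact ⟨1, h⟩
      · exact ⟨2, h⟩
    obtain ⟨j, hj⟩ := this
    have hv : (W j).val τ = 0 := if_pos hj
    simp only [hF]
    rw [Finset.prod_eq_zero (Finset.mem_univ j) hv, mul_zero]
  rcases lt_or_ge 2 T with hT2 | hT2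
  · have hz : Set.EqOn (fun _ => (0 : ℂ)) F (Set.uIoc (1 / 10) 2) := fun τ hτ => by
      rw [Set.uIoc_of_le (by norm_num)] at hτ
      exact (hzero τ hτ.1.le (hτ.2.trans_lt hT2)).symm
    refine ⟨(intervalIntegrable_const (c := (0 : ℂ))).congr hz, ?_⟩
    rw [← intervalIntegral.integral_congr_uIoo (fun τ hτ => hz (Set.Ioo_subset_Ioc_self hτ))]
    simp
    positivity
  set Φ : ℝ → ℝ := fun τ => hph lam τ + ∑ j, (W j).φ τ with hΦ
  set A : ℝ → ℂ := fun τ => α τ * ((W 0).c τ * ((W 1).c τ * (W 2).c τ)) with hA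
  set B : ℝ → ℂ := fun τ => ((∏ j, amp ((W j).q) τ : ℝ) : ℂ) * cis (Φ τ) with hB
  have hlow : ∀ x, T ≤ x → 0 < x := fun x hx => by linarith
  have hqx : ∀ j x, T ≤ x → (W j).q < 4 * x ^ 2 := fun j x hx =>
    (W j).hdom x (hT1.trans hx) ((hTj j).trans hx)
  have hFg : ∀ τ ∈ Set.Icc T 2, F τ = (l ^ 9 : ℝ) * (A τ * B τ) := by
    intro τ hτ
    have hv : ∀ j, (W j).val τ
        = ((l ^ 3 * amp (W j).q τ : ℝ) : ℂ) * (W j).c τ * cis ((W j).φ τ) := fun j =>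
      if_neg (not_lt.2 ((hTj j).trans hτ.1))
    simp only [hF, hA, hB, hΦ, Fin.sum_univ_three, Fin.prod_univ_three, hv, cis_add]
    push_cast
    ring
  have hΦd : ∀ x, T ≤ x → HasDerivAt Φ
      (lam * (7 - 1 / (4 * x ^ 2) + ∑ j, (W j).e * mm ((W j).q) x)) x := by
    intro x hx
    have h1 := HasDerivAt.fun_sum (u := Finset.univ) (fun j _ => (W j).hφ x (hT1.trans hx)
      ((hTj j).trans hx))
    refine ((hasDerivAt_hph (hlow x hx)).add h1).congr_deriv ?_
    rw [← Finset.mul_sum]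
    ring
  have hBc : ContinuousOn B (Set.Icc T 2) := by
    refine ContinuousOn.mul (Complex.continuous_ofReal.comp_continuousOn ?_)
      (continuous_cis.comp_continuousOn fun x hx =>
        (hΦd x hx.1).continuousAt.continuousWithinAt)
    refine continuousOn_finsetProd _ fun j _ x hx => ?_
    exact (hasDerivAt_amp (hlow x hx.1) (hqx j x hx.1)).continuousAt.continuousWithinAt
  have hcj : ∀ j, BVOn (W j).c (W j).c' T 2 20000 := fun j =>
    ((W j).hc ((max_le hT1 (hTj j)).trans hT2)).mono (max_le hT1 (hTj j)) hT2 le_rfl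
  have hAbv := (hα.mono hT1 hT2 le_rfl).mul hT2 ((hcj 0).mul hT2 ((hcj 1).mul hT2 (hcj 2)))
  have hK : ∀ x ∈ Set.Icc T 2, ‖∫ y in T..x, B y‖ ≤ 4 * 10 ^ 7 * l := fun x hx =>
    core_bound_perm hl hl2 hlam (fun j => (W j).hq) (fun j => (W j).he) hT1 hx.1 hx.2
      (fun j => hqx j T le_rfl) (fun y hy => hΦd y hy.1)
  have hmain := hAbv.norm_integral_mul_le hT2 hBc hK
  have hgc : ContinuousOn (fun τ => ((l ^ 9 : ℝ) : ℂ) * (A τ * B τ)) (Set.Icc T 2) :=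
    continuousOn_const.mul (hAbv.continuousOn.mul hBc)
  have i1 : IntervalIntegrable F volume (1 / 10) T := by
    refine (intervalIntegrable_const (c := (0 : ℂ))).congr_uIoo ?_
    intro τ hτ
    rw [Set.uIoo_of_le hT1] at hτ
    exact (hzero τ hτ.1.le hτ.2).symm
  have i2 : IntervalIntegrable F volume T 2 := by
    refine (hgc.intervalIntegrable_of_Icc hT2).congr ?_
    intro τ hτ
    rw [Set.uIoc_of_le hT2] at hτ
    exact (hFg τ ⟨hτ.1.le, hτ.2⟩).symm
  refine ⟨i1.trans i2, ?_⟩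
  have e1 : ∫ τ in (1 / 10 : ℝ)..T, F τ = 0 := by
    rw [intervalIntegral.integral_congr_Ioo_of_le (g := fun _ => (0 : ℂ)) hT1
      (fun τ hτ => hzero τ hτ.1.le hτ.2)]
    simp
  have e2 : ∫ τ in T..2, F τ = (l ^ 9 : ℝ) * ∫ τ in T..2, A τ * B τ := by
    rw [← intervalIntegral.integral_const_mul]
    refine intervalIntegral.integral_congr fun τ hτ => ?_
    rw [Set.uIcc_of_le hT2] at hτ
    exact hFg τ hτ
  rw [← intervalIntegral.integral_add_adjacent_intervals i1 i2, e1, e2, zero_add, norm_mul,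
    Complex.norm_real, Real.norm_of_nonneg (by positivity)]
  calc _ ≤ l ^ 9 * (2 * (4 * 10 ^ 7 * l) * (2 * M * (2 * 20000 * (2 * 20000 * 20000)))) := by
        gcongr
    _ = 512 * 10 ^ 19 * (M * l ^ 10) := by ring
    _ ≤ 10 ^ 23 * (M * l ^ 10) := by gcongr; norm_num
    _ = _ := by ring

end

section
variable {lam l : ℝ}

lemma norm_mul_sub_mul_le {G A : Fin 3 → ℂ} {e : Fin 3 → ℝ} {l : ℝ}
    (he : ∀ j, 0 ≤ e j) (he2 : ∀ j, e j ≤ 2)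
    (hS : ∀ j, ‖G j - A j‖ ≤ 600 * l ^ 2 * e j ^ 4)
    (hA : ∀ j, ‖A j‖ ≤ 120000 * l ^ 2 * e j) :
    ‖∏ j, G j - ∏ j, A j‖ ≤ 10 ^ 14 * l ^ 6 * (e 0 ^ 6 + e 1 ^ 6 + e 2 ^ 6) := by
  have hG : ∀ j, ‖G j‖ ≤ 130000 * l ^ 2 * e j := fun j => by
    have h3 : e j ^ 3 ≤ 2 ^ 3 := pow_le_pow_left₀ (he j) (he2 j) 3
    calc ‖G j‖ = ‖(G j - A j) + A j‖ := by ring_nf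
      _ ≤ 600 * l ^ 2 * e j ^ 4 + 120000 * l ^ 2 * e j := norm_add_le_of_le (hS j) (hA j)
      _ = l ^ 2 * e j * (600 * e j ^ 3 + 120000) := by ring
      _ ≤ l ^ 2 * e j * 130000 := by
          have := he j
          gcongr
          linarith
      _ = _ := by ring
  have hA' : ∀ j, ‖A j‖ ≤ 130000 * l ^ 2 * e j := fun j => (hA j).trans (by
    have := he j
    gcongr
    norm_num)
  have key : ∀ i j k, ∀ y z : ℂ, ‖y‖ ≤ 130000 * l ^ 2 * e j → ‖z‖ ≤ 130000 * l ^ 2 * e k →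
      ‖(G i - A i) * y * z‖ ≤ 2 * 10 ^ 13 * l ^ 6 * (e i ^ 6 + e j ^ 6 + e k ^ 6) := by
    intro i j k y z hy hz
    have := he i
    have := he j
    have := he k
    rw [norm_mul, norm_mul]
    calc _ ≤ (600 * l ^ 2 * e i ^ 4) * (130000 * l ^ 2 * e j) * (130000 * l ^ 2 * e k) := by
          gcongr
          exact hS i
      _ = 1014 * 10 ^ 10 * l ^ 6 * (e i ^ 4 * e j * e k) := by ring
      _ ≤ 1014 * 10 ^ 10 * l ^ 6 * (e i ^ 6 + e j ^ 6 + e k ^ 6) := by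
          gcongr
          exact pow_four_mul_mul_le (he i) (he j) (he k)
      _ ≤ 2 * 10 ^ 13 * l ^ 6 * (e i ^ 6 + e j ^ 6 + e k ^ 6) :=
          mul_le_mul_of_nonneg_right
            (mul_le_mul_of_nonneg_right (by norm_num) (by positivity)) (by positivity)
  have hsplit : ∏ j, G j - ∏ j, A j = (G 0 - A 0) * G 1 * G 2 + (G 1 - A 1) * A 0 * G 2
      + (G 2 - A 2) * A 0 * A 1 := by
    simp only [Fin.prod_univ_three]
    ring
  rw [hsplit]
  have k0 := key 0 1 2 _ _ (hG 1) (hG 2)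
  have k1 := key 1 0 2 _ _ (hA' 0) (hG 2)
  have k2 := key 2 0 1 _ _ (hA' 0) (hA' 1)
  have p : 0 ≤ l ^ 6 * (e 0 ^ 6 + e 1 ^ 6 + e 2 ^ 6) := by
    have := he 0
    have := he 1
    have := he 2
    positivity
  refine (norm_add_le_of_le (norm_add_le_of_le k0 k1) k2).trans ?_
  nlinarith

lemma exists_norm_integral_le_of_nonneg : ∃ K : ℝ, 0 < K ∧ ∀ (lam l : ℝ) (s : Fin 3 → ℝ)
    (α α' : ℝ → ℂ) (M : ℝ), 0 < l → l ≤ 1 / 2 → lam * l ^ 6 = 1 → (∀ j, 0 ≤ s j) →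
    BVOn α α' (1 / 10) 2 M →
    ‖∫ τ in (1 / 10 : ℝ)..2, α τ * cis (hph lam τ) * ∏ j, Gf (lam * s j) (2 * lam * τ)‖
      ≤ K * M * l ^ 10 := by
  obtain ⟨K, hK0, hK⟩ := exists_integral_wt_le
  refine ⟨27 * 10 ^ 23 + 3 * 10 ^ 14 * K, by positivity, ?_⟩
  intro lam l s α α' M hl hl2 hlam hs hα
  have hM : 0 ≤ M := (norm_nonneg _).trans (hα.bound 2 (by norm_num))
  choose W hW using fun j => exists_waves hl hl2 hlam (hs j)
  set P : ℝ → ℂ := fun τ => α τ * cis (hph lam τ) with hP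
  set G : Fin 3 → ℝ → ℂ := fun j τ => Gf (lam * s j) (2 * lam * τ)
  set A : Fin 3 → ℝ → ℂ := fun j τ => ∑ k, (W j k).val τ
  have hexp : ∀ τ, P τ * ∏ j, A j τ = ∑ f : Fin 3 → Fin 3, P τ * ∏ j, (W j (f j)).val τ := by
    intro τ
    rw [Finset.prod_univ_sum, Finset.mul_sum, Fintype.piFinset_univ]
  have hw := fun f : Fin 3 → Fin 3 => wave_product_bound hl hl2 hlam (fun j => W j (f j)) hα
  have hAi : IntervalIntegrable (fun τ => P τ * ∏ j, A j τ) volume (1 / 10) 2 := by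
    simp only [hexp]
    have := IntervalIntegrable.sum Finset.univ fun f _ => (hw f).1
    refine this.congr ?_
    intro τ _
    simp [hP]
  have hmain : ‖∫ τ in (1 / 10 : ℝ)..2, P τ * ∏ j, A j τ‖ ≤ 27 * (10 ^ 23 * M * l ^ 10) := by
    simp only [hexp]
    rw [intervalIntegral.integral_finsetSum fun f _ => (hw f).1]
    refine (norm_sum_le_of_le _ fun f _ => (hw f).2).trans ?_
    simp
  have hPc : ContinuousOn P (Set.Icc (1 / 10) 2) := by
    refine hα.continuousOn.mul (continuous_cis.comp_continuousOn ?_)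
    intro x hx
    exact (hasDerivAt_hph (lam := lam) (by linarith [hx.1])).continuousAt.continuousWithinAt
  have hGi : IntervalIntegrable (fun τ => P τ * ∏ j, G j τ) volume (1 / 10) 2 := by
    refine ContinuousOn.intervalIntegrable_of_Icc (by norm_num) (hPc.mul ?_)
    refine continuousOn_finsetProd _ fun j _ => ?_
    exact ((continuous_Gf (lam * s j)).comp (by fun_prop : Continuous fun τ => 2 * lam * τ)).continuousOn
  have hwt : ∀ j τ, 0 ≤ wt l (s j) τ + l ∧ wt l (s j) τ + l ≤ 2 := fun j τ =>
    ⟨by have := wt_pos l (s j) τ; linarith, by have := wt_le_one l (s j) τ; linarith⟩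
  have hdiff : ∀ τ ∈ Set.Icc (1 / 10 : ℝ) 2, ‖P τ * ∏ j, G j τ - P τ * ∏ j, A j τ‖ ≤
      M * 10 ^ 14 * l ^ 6 * ((wt l (s 0) τ + l) ^ 6 + (wt l (s 1) τ + l) ^ 6
        + (wt l (s 2) τ + l) ^ 6) := by
    intro τ hτ
    rw [← mul_sub, norm_mul, hP, norm_mul, norm_cis, mul_one, mul_assoc M, mul_assoc M]
    refine mul_le_mul (hα.bound τ hτ) ?_ (norm_nonneg _) hM
    refine norm_mul_sub_mul_le (G := fun j => G j τ) (A := fun j => A j τ)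
      (e := fun j => wt l (s j) τ + l)
      (fun j => (hwt j τ).1) (fun j => (hwt j τ).2) (fun j => ?_) (fun j => ?_)
    · refine ((hW j τ hτ).1).trans ?_
      have := wt_pos l (s j) τ
      gcongr
      linarith
    · refine (norm_sum_le_of_le _ fun k _ => (hW j τ hτ).2 k).trans ?_
      simp
      apply le_of_eq
      ring
  have hwc : ∀ j, IntervalIntegrable (fun τ => (wt l (s j) τ + l) ^ 6) volume (1 / 10) 2 :=
    fun j => by
      have := continuous_wt l (s j)
      exact Continuous.intervalIntegrable (by fun_prop) _ _
  have herr : ‖∫ τ in (1 / 10 : ℝ)..2, (P τ * ∏ j, G j τ - P τ * ∏ j, A j τ)‖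
      ≤ M * 10 ^ 14 * l ^ 6 * (3 * (K * l ^ 4)) := by
    refine (intervalIntegral.norm_integral_le_of_norm_le (by norm_num)
      (Filter.Eventually.of_forall fun τ hτ => hdiff τ (Set.Ioc_subset_Icc_self hτ))
      ((((hwc 0).add (hwc 1)).add (hwc 2)).const_mul _)).trans ?_
    rw [intervalIntegral.integral_const_mul,
      intervalIntegral.integral_add ((hwc 0).add (hwc 1)) (hwc 2),
      intervalIntegral.integral_add (hwc 0) (hwc 1)]
    have h0 := hK l (s 0) hl hl2
    have h1 := hK l (s 1) hl hl2
    have h2 := hK l (s 2) hl hl2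
    gcongr
    linarith
  rw [intervalIntegral.integral_sub hGi hAi] at herr
  calc ‖∫ τ in (1 / 10 : ℝ)..2, P τ * ∏ j, G j τ‖
      = ‖((∫ τ in (1 / 10 : ℝ)..2, P τ * ∏ j, G j τ) - ∫ τ in (1 / 10 : ℝ)..2, P τ * ∏ j, A j τ)
        + ∫ τ in (1 / 10 : ℝ)..2, P τ * ∏ j, A j τ‖ := by rw [sub_add_cancel]
    _ ≤ _ := norm_add_le_of_le herr hmain
    _ = _ := by ring

lemma exists_norm_integral_prod_Gf_le : ∃ K : ℝ, 0 < K ∧ ∀ (lam l : ℝ) (s : Fin 3 → ℝ)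
    (α α' : ℝ → ℂ) (M : ℝ), 0 < l → l ≤ 1 / 2 → lam * l ^ 6 = 1 → BVOn α α' (1 / 10) 2 M →
    ‖∫ τ in (1 / 10 : ℝ)..2, α τ * cis (hph lam τ) * ∏ j, Gf (lam * s j) (2 * lam * τ)‖
      ≤ K * M * l ^ 10 := by
  obtain ⟨K, hK0, hK⟩ := exists_norm_integral_le_of_nonneg
  refine ⟨K, hK0, fun lam l s α α' M hl hl2 hlam hα => ?_⟩
  have habs : ∀ j, ∃ c : ℂ, ‖c‖ = 1 ∧ ∀ z, Gf (lam * s j) z = c * Gf (lam * |s j|) z := fun j => by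
    rcases le_total 0 (s j) with h | h
    · exact ⟨1, by simp, fun z => by rw [abs_of_nonneg h, one_mul]⟩
    · refine ⟨cis (2 * π * (lam * -s j)), by simp, fun z => ?_⟩
      rw [abs_of_nonpos h, ← Gf_neg]
      ring_nf
  choose c hc1 hc using habs
  have := hK lam l (fun j => |s j|) α α' M hl hl2 hlam (fun j => abs_nonneg _) hα
  simp only [hc, Finset.prod_mul_distrib]
  rw [intervalIntegral.integral_congr (g := fun τ => (∏ j, c j) *
    (α τ * cis (hph lam τ) * ∏ j, Gf (lam * |s j|) (2 * lam * τ))) (fun τ _ => by ring),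
    intervalIntegral.integral_const_mul, norm_mul, norm_prod]
  simpa [hc1] using this

end

section
variable {lam τ : ℝ} {f : ℝ → ℂ}

/-- Smooth functions supported in `[1/2, 21/5]`. -/
structure IsTest (f : ℝ → ℂ) : Prop where
  smooth : ContDiff ℝ (⊤ : ℕ∞) f
  supp : tsupport f ⊆ Set.Icc (1 / 2) (21 / 5)

namespace IsTest

lemma deriv (h : IsTest f) : IsTest (deriv f) where
  smooth := (contDiff_infty_iff_deriv.1 h.smooth).2
  supp := (closure_minimal support_deriv_subset (isClosed_tsupport f)).trans h.supp

lemma hasDerivAt (h : IsTest f) (x : ℝ) : HasDerivAt f (_root_.deriv f x) x :=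
  ((contDiff_infty_iff_deriv.1 h.smooth).1 x).hasDerivAt

lemma continuous (h : IsTest f) : Continuous f := h.smooth.continuous

lemma eq_zero (h : IsTest f) {x : ℝ} (hx : x ∉ Set.Icc (1 / 2 : ℝ) (21 / 5)) : f x = 0 :=
  image_eq_zero_of_notMem_tsupport fun hx' => hx (h.supp hx')

lemma left_eq_zero (h : IsTest f) : f (2 / 5) = 0 := h.eq_zero (by norm_num)

lemma right_eq_zero (h : IsTest f) : f (43 / 10) = 0 := h.eq_zero (by norm_num)

lemma exists_bound (h : IsTest f) : ∃ D, 0 ≤ D ∧ ∀ x, ‖f x‖ ≤ D := by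
  have hc : HasCompactSupport f := isCompact_Icc.of_isClosed_subset (isClosed_tsupport f) h.supp
  obtain ⟨D, hD⟩ := hc.exists_bound_of_continuous h.continuous
  exact ⟨D, (norm_nonneg _).trans (hD 0), hD⟩

end IsTest

/-- The subordination phase. -/
def sph (lam τ r : ℝ) : ℝ := lam * (r - τ * r ^ 2)

lemma hasDerivAt_sph (lam τ r : ℝ) : HasDerivAt (sph lam τ) (lam * (1 - 2 * τ * r)) r := by
  have := ((hasDerivAt_id r).sub (((hasDerivAt_id r).pow 2).const_mul τ)).const_mul lam
  exact this.congr_deriv (by simp only [id]; push_cast; ring)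

lemma continuous_sph (lam τ : ℝ) : Continuous (sph lam τ) := by
  unfold sph
  fun_prop

/-- The subordination kernel with amplitude `f`. -/
def Bt (f : ℝ → ℂ) (lam τ : ℝ) : ℂ := ∫ r in (2 / 5 : ℝ)..(43 / 10), f r * cis (sph lam τ r)

lemma hasDerivAt_Bt (hf : Continuous f) (lam τ : ℝ) :
    HasDerivAt (Bt f lam) (Bt (fun r => -(lam * r ^ 2 * Complex.I) * f r) lam τ) τ := by
  have hcis := continuous_cis
  have := intervalIntegral.hasDerivAt_integral_of_dominated_loc_of_deriv_le
    (μ := volume) (a := 2 / 5) (b := 43 / 10) (x₀ := τ) (s := Set.univ)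
    (F := fun τ r => f r * cis (sph lam τ r))
    (F' := fun τ r => -(lam * r ^ 2 * Complex.I) * f r * cis (sph lam τ r))
    (bound := fun r => ‖-(lam * r ^ 2 * Complex.I) * f r‖) Filter.univ_mem
    (Filter.Eventually.of_forall fun t => by
      have := continuous_sph lam t
      exact Continuous.aestronglyMeasurable (by fun_prop))
    (by
      have := continuous_sph lam τ
      exact Continuous.intervalIntegrable (by fun_prop) _ _)
    (by
      have := continuous_sph lam τ
      exact Continuous.aestronglyMeasurable (by fun_prop))
    (Filter.Eventually.of_forall fun r _ t _ => by rw [norm_mul, norm_cis, mul_one])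
    (Continuous.intervalIntegrable (by fun_prop) _ _)
    (Filter.Eventually.of_forall fun r _ t _ => by
      have h1 : HasDerivAt (fun t => sph lam t r) (-(lam * r ^ 2)) t := by
        have := ((hasDerivAt_const t r).sub ((hasDerivAt_id t).mul_const (r ^ 2))).const_mul lam
        exact this.congr_deriv (by ring)
      refine ((hasDerivAt_cis_comp h1).const_mul (f r)).congr_deriv ?_
      push_cast
      ring)
  exact this.2

lemma continuous_Bt (hf : Continuous f) (lam : ℝ) : Continuous (Bt f lam) :=
  continuous_iff_continuousAt.2 fun τ => (hasDerivAt_Bt hf lam τ).continuousAt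

lemma norm_Bt_le_of_bound {D : ℝ} (hD : ∀ x, ‖f x‖ ≤ D) : ‖Bt f lam τ‖ ≤ 4 * D := by
  have hD0 : 0 ≤ D := (norm_nonneg _).trans (hD 0)
  have := intervalIntegral.norm_integral_le_of_norm_le_const
    (a := 2 / 5) (b := 43 / 10) (f := fun r => f r * cis (sph lam τ r)) (C := D)
    fun r _ => by rw [norm_mul, norm_cis, mul_one]; exact hD r
  refine this.trans ?_
  norm_num [abs_of_pos]
  linarith

/-- Stationary phase bound for the subordination kernel. -/
lemma norm_Bt_le_of_bvOn {g g' : ℝ → ℂ} {M : ℝ} (hlam : 0 < lam) (hτ : 1 / 10 ≤ τ)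
    (hg : BVOn g g' (2 / 5) (43 / 10) M) : ‖Bt g lam τ‖ ≤ 60 * M / √lam := by
  have hsq : 0 < √lam := Real.sqrt_pos.2 hlam
  have hph : IsPhase (sph lam τ) (fun r => lam * (1 - 2 * τ * r)) (fun _ => -(2 * lam * τ))
      (2 / 5) (43 / 10) :=
    ⟨fun r _ => hasDerivAt_sph lam τ r, fun r _ => by
      have := ((hasDerivAt_const r (1 : ℝ)).sub ((hasDerivAt_id r).const_mul (2 * τ))).const_mul lam
      exact this.congr_deriv (by ring), continuousOn_const⟩
  have := hg.norm_integral_mul_le (f := fun r => cis (sph lam τ r)) (K := 10 * (3 / √lam))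
    (by norm_num) ((continuous_cis.comp (continuous_sph lam τ)).continuousOn) fun x hx => by
      refine vdc_second (η := lam / 5) hx.1 (hph.mono le_rfl hx.2) (fun _ _ => ?_) (by positivity) ?_
      · rw [abs_neg, abs_of_nonneg (by positivity)]
        nlinarith
      · rw [div_pow, Real.sq_sqrt hlam.le]
        field_simp
        norm_num
  refine this.trans (le_of_eq ?_)
  ring

lemma bvOn_of_deriv_le {c c' : ℝ → ℂ} {a b D M : ℝ} (hab : a ≤ b)
    (hd : ∀ x ∈ Set.Icc a b, HasDerivAt c (c' x) x) (hc : ContinuousOn c' (Set.Icc a b))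
    (h1 : ∀ x ∈ Set.Icc a b, ‖c x‖ ≤ M) (h2 : ∀ x ∈ Set.Icc a b, ‖c' x‖ ≤ D)
    (hDM : D * (b - a) ≤ M) : BVOn c c' a b M := by
  refine ⟨hd, hc, h1, ?_⟩
  have := intervalIntegral.norm_integral_le_of_norm_le_const (a := a) (b := b)
    (f := fun x => ‖c' x‖) (C := D) fun x hx => by
      rw [Set.uIoc_of_le hab] at hx
      simpa using h2 x (Set.Ioc_subset_Icc_self hx)
  rw [abs_of_nonneg (by linarith)] at this
  exact (le_abs_self _).trans (this.trans hDM)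

lemma IsTest.exists_norm_Bt_le (h : IsTest f) :
    ∃ M, 0 ≤ M ∧ ∀ lam τ, 0 < lam → 1 / 10 ≤ τ → ‖Bt f lam τ‖ ≤ M / √lam := by
  obtain ⟨D, hD0, hD⟩ := h.exists_bound
  obtain ⟨D', hD'0, hD'⟩ := h.deriv.exists_bound
  refine ⟨60 * (D + 4 * D'), by positivity, fun lam τ hl hτ => ?_⟩
  refine norm_Bt_le_of_bvOn hl hτ (bvOn_of_deriv_le (by norm_num) (fun x _ => h.hasDerivAt x)
    h.deriv.continuous.continuousOn (fun x _ => ?_) (fun x _ => hD' x) ?_)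
  · linarith [hD x]
  · linarith

/-- The amplitude remaining after the stationary phase factor is removed from `Bt`. -/
def alp (f : ℝ → ℂ) (lam τ : ℝ) : ℂ := √lam * cis (-(lam / (4 * τ))) * Bt f lam τ

lemma IsTest.Bt_ibp (h : IsTest f) {w w' : ℝ → ℝ}
    (hw : ∀ r ∈ Set.Icc (2 / 5 : ℝ) (43 / 10), HasDerivAt w (w' r) r)
    (hw' : ContinuousOn w' (Set.Icc (2 / 5) (43 / 10))) (lam τ : ℝ) :
    Bt (fun r => lam * (1 - 2 * τ * r) * Complex.I * (f r * w r)) lam τ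
      = -Bt (fun r => _root_.deriv f r * w r + f r * w' r) lam τ := by
  have hcis := continuous_cis
  have hs := continuous_sph lam τ
  have hwc : ContinuousOn w (Set.Icc (2 / 5) (43 / 10)) := fun r hr =>
    (hw r hr).continuousAt.continuousWithinAt
  have hwc1 := Complex.continuous_ofReal.comp_continuousOn hwc
  have hwc2 := Complex.continuous_ofReal.comp_continuousOn hw'
  have hf := h.continuous
  have hf' := h.deriv.continuous
  have hu : Set.uIcc (2 / 5 : ℝ) (43 / 10) = Set.Icc (2 / 5) (43 / 10) :=
    Set.uIcc_of_le (by norm_num)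
  have := intervalIntegral.integral_mul_deriv_eq_deriv_mul (a := 2 / 5) (b := 43 / 10)
    (u := fun r => f r * w r) (u' := fun r => _root_.deriv f r * w r + f r * w' r)
    (v := fun r => cis (sph lam τ r))
    (v' := fun r => cis (sph lam τ r) * ((lam * (1 - 2 * τ * r) : ℝ) * Complex.I))
    (fun r hr => (h.hasDerivAt r).mul (hw r (hu ▸ hr)).ofReal_comp)
    (fun r _ => hasDerivAt_cis_comp (hasDerivAt_sph lam τ r))
    (ContinuousOn.intervalIntegrable_of_Icc (by norm_num)
      ((hf'.continuousOn.mul hwc1).add (hf.continuousOn.mul hwc2)))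
    (Continuous.intervalIntegrable (by fun_prop) _ _)
  rw [h.left_eq_zero, h.right_eq_zero] at this
  simp only [zero_mul, sub_self, zero_sub] at this
  unfold Bt
  rw [← this]
  refine intervalIntegral.integral_congr fun r _ => ?_
  simp only
  push_cast
  ring

end

section
variable {lam τ : ℝ} {f : ℝ → ℂ}

lemma IsTest.id_mul (h : IsTest f) : IsTest (fun r => (r : ℂ) * f r) where
  smooth := (Complex.ofRealCLM.contDiff).mul h.smooth
  supp := (tsupport_mul_subset_right (f := fun r : ℝ => (r : ℂ)) (g := f)).trans h.supp

lemma Bt_add {g : ℝ → ℂ} (hf : ContinuousOn f (Set.Icc (2 / 5) (43 / 10)))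
    (hg : ContinuousOn g (Set.Icc (2 / 5) (43 / 10))) :
    Bt (fun r => f r + g r) lam τ = Bt f lam τ + Bt g lam τ := by
  have hc : ContinuousOn (fun r => cis (sph lam τ r)) (Set.Icc (2 / 5) (43 / 10)) :=
    (continuous_cis.comp (continuous_sph lam τ)).continuousOn
  unfold Bt
  rw [← intervalIntegral.integral_add ((hf.fun_mul hc).intervalIntegrable_of_Icc (by norm_num))
    ((hg.fun_mul hc).intervalIntegrable_of_Icc (by norm_num))]
  simp only [add_mul]

lemma Bt_const_mul (c : ℂ) : Bt (fun r => c * f r) lam τ = c * Bt f lam τ := by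
  unfold Bt
  rw [← intervalIntegral.integral_const_mul]
  simp only [mul_assoc]

lemma IsTest.exists_bvOn_alp (h : IsTest f) :
    ∃ M, ∀ lam, 0 < lam → ∃ α', BVOn (alp f lam) α' (1 / 10) 2 M := by
  obtain ⟨M₀, hM₀0, hM₀⟩ := h.exists_norm_Bt_le
  obtain ⟨M₁, hM₁0, hM₁⟩ := h.deriv.exists_norm_Bt_le
  obtain ⟨M₂, hM₂0, hM₂⟩ := h.deriv.id_mul.exists_norm_Bt_le
  have hf := h.continuous
  have hf' := h.deriv.continuous
  refine ⟨2 * (25 * M₁ + 5 * M₂ + 5 * M₀) + M₀, fun lam hl => ?_⟩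
  have hsq : 0 < √lam := Real.sqrt_pos.2 hl
  set E : ℝ → ℂ := fun τ => cis (-(lam / (4 * τ))) with hE
  set B₂ : ℝ → ℂ := Bt (fun r => -(lam * r ^ 2 * Complex.I) * f r) lam with hB₂
  have hEd : ∀ τ, 0 < τ → HasDerivAt E (E τ * ((lam / (4 * τ ^ 2) : ℝ) * Complex.I)) τ := by
    intro τ hτ
    refine hasDerivAt_cis_comp ?_
    have := ((hasDerivAt_const τ lam).fun_div ((hasDerivAt_id τ).const_mul 4)
      (by simp only [id]; positivity)).fun_neg
    refine this.congr_deriv ?_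
    simp only [id]
    field_simp
    norm_num
  have hB := continuous_Bt hf lam
  have hBd := hasDerivAt_Bt hf lam
  have hB₂c : Continuous B₂ := continuous_Bt (by fun_prop) lam
  refine ⟨fun τ => √lam * (E τ * ((lam / (4 * τ ^ 2) : ℝ) * Complex.I)) * Bt f lam τ
    + √lam * E τ * B₂ τ, bvOn_of_deriv_le (D := 25 * M₁ + 5 * M₂ + 5 * M₀) (by norm_num)
      (fun τ hτ => ?_) ?_ (fun τ hτ => ?_) (fun τ hτ => ?_) ?_⟩
  · exact ((hEd τ (by linarith [hτ.1])).const_mul _).mul (hBd τ)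
  · intro τ hτ
    have hτ0 : τ ≠ 0 := by linarith [hτ.1]
    have hEc : ContinuousAt E τ := (hEd τ (by linarith [hτ.1])).continuousAt
    have h1 : ContinuousAt (fun τ : ℝ => ((lam / (4 * τ ^ 2) : ℝ) : ℂ)) τ :=
      Complex.continuous_ofReal.continuousAt.comp
        (continuousAt_const.div (by fun_prop) (by positivity))
    have hBc := hB.continuousAt (x := τ)
    have hB₂c := hB₂c.continuousAt (x := τ)
    exact ContinuousAt.continuousWithinAt (by fun_prop)
  · have := hM₀ lam τ hl hτ.1
    rw [alp, norm_mul, norm_mul, norm_cis, mul_one, Complex.norm_real,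
      Real.norm_of_nonneg hsq.le]
    rw [le_div_iff₀ hsq] at this
    linarith
  · have hτ0 : 0 < τ := by linarith [hτ.1]
    have hτC : (τ : ℂ) ≠ 0 := by exact_mod_cast hτ0.ne'
    have hw : ∀ r : ℝ, HasDerivAt (fun r => 1 / (4 * τ ^ 2) + 1 / (2 * τ) * r) (1 / (2 * τ)) r :=
      fun r => by
        have := ((hasDerivAt_id r).const_mul (1 / (2 * τ))).const_add (1 / (4 * τ ^ 2))
        exact this.congr_deriv (by ring)
    have hibp := h.Bt_ibp (fun r _ => hw r) continuousOn_const lam τ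
    have e1 : ((lam / (4 * τ ^ 2) : ℝ) * Complex.I) * Bt f lam τ + B₂ τ
        = Bt (fun r => lam * (1 - 2 * τ * r) * Complex.I *
          (f r * (1 / (4 * τ ^ 2) + 1 / (2 * τ) * r : ℝ))) lam τ := by
      rw [hB₂, ← Bt_const_mul, ← Bt_add (by fun_prop) (by fun_prop)]
      congr 1
      ext r
      push_cast
      field_simp
      ring
    have e2 : Bt (fun r => _root_.deriv f r * (1 / (4 * τ ^ 2) + 1 / (2 * τ) * r : ℝ)
          + f r * (1 / (2 * τ) : ℝ)) lam τ
        = (1 / (4 * τ ^ 2) : ℝ) * Bt (_root_.deriv f) lam τ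
          + (1 / (2 * τ) : ℝ) * Bt (fun r => r * _root_.deriv f r) lam τ
          + (1 / (2 * τ) : ℝ) * Bt f lam τ := by
      rw [← Bt_const_mul, ← Bt_const_mul, ← Bt_const_mul, ← Bt_add (by fun_prop) (by fun_prop),
        ← Bt_add (by fun_prop) (by fun_prop)]
      congr 1
      ext r
      push_cast
      ring
    have e3 : √lam * (E τ * ((lam / (4 * τ ^ 2) : ℝ) * Complex.I)) * Bt f lam τ
        + √lam * E τ * B₂ τ = √lam * E τ * (-((1 / (4 * τ ^ 2) : ℝ) * Bt (_root_.deriv f) lam τ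
          + (1 / (2 * τ) : ℝ) * Bt (fun r => r * _root_.deriv f r) lam τ
          + (1 / (2 * τ) : ℝ) * Bt f lam τ)) := by
      rw [← e2, ← hibp, ← e1]
      ring
    have hc1 : 1 / (4 * τ ^ 2) ≤ 25 := by
      rw [div_le_iff₀ (by positivity)]
      nlinarith [hτ.1]
    have hc2 : 1 / (2 * τ) ≤ 5 := by
      rw [div_le_iff₀ (by positivity)]
      linarith [hτ.1]
    rw [e3, norm_mul, norm_mul, norm_neg, hE, norm_cis, mul_one, Complex.norm_real,
      Real.norm_of_nonneg hsq.le]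
    have key : ∀ (c C : ℝ) (z : ℂ) (M : ℝ), 0 ≤ c → c ≤ C → ‖z‖ ≤ M / √lam →
        ‖(c : ℂ) * z‖ ≤ C * (M / √lam) := fun c C z M h0 h1 h2 => by
      rw [norm_mul, Complex.norm_real, Real.norm_of_nonneg h0]
      exact mul_le_mul h1 h2 (norm_nonneg _) (h0.trans h1)
    have hn := norm_add_le_of_le (norm_add_le_of_le
      (key _ _ _ _ (by positivity) hc1 (hM₁ lam τ hl hτ.1))
      (key _ _ _ _ (by positivity) hc2 (hM₂ lam τ hl hτ.1)))
      (key _ _ _ _ (by positivity) hc2 (hM₀ lam τ hl hτ.1))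
    refine (mul_le_mul_of_nonneg_left hn hsq.le).trans (le_of_eq ?_)
    field_simp
  · nlinarith

end

section
variable {lam τ : ℝ} {f : ℝ → ℂ}

lemma Bt_congr {g : ℝ → ℂ} (h : ∀ r ∈ Set.Icc (2 / 5 : ℝ) (43 / 10), f r = g r) :
    Bt f lam τ = Bt g lam τ := by
  refine intervalIntegral.integral_congr fun r hr => ?_
  rw [Set.uIcc_of_le (by norm_num)] at hr
  simp only [h r hr]

lemma le_abs_one_sub (hτ : τ ∉ Set.Icc (1 / 10 : ℝ) 2) {r : ℝ}
    (hr : r ∈ Set.Icc (2 / 5 : ℝ) (43 / 10)) : (1 + |τ|) / 10 ≤ |1 - 2 * τ * r| := by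
  obtain ⟨h1, h2⟩ := hr
  rcases lt_or_ge τ 0 with h0 | h0
  · rw [abs_of_neg h0, abs_of_nonneg (by nlinarith)]
    nlinarith
  · rw [abs_of_nonneg h0]
    rcases lt_or_ge τ (1 / 10) with h | h
    · rw [abs_of_nonneg (by nlinarith)]
      nlinarith
    · have h3 : 2 < τ := not_le.1 fun h3 => hτ ⟨h, h3⟩
      rw [abs_of_nonpos (by nlinarith)]
      nlinarith

lemma IsTest.exists_norm_Bt_weight_le (N : ℕ) : ∀ {f : ℝ → ℂ}, IsTest f → ∀ m l : ℕ,
    ∃ C, 0 ≤ C ∧ ∀ lam τ, 0 < lam → τ ∉ Set.Icc (1 / 10 : ℝ) 2 →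
      ‖Bt (fun r => f r * (τ ^ m * ((1 - 2 * τ * r)⁻¹) ^ (m + l) : ℝ)) lam τ‖
        ≤ C * (lam ^ N * (1 + |τ|) ^ (l + N))⁻¹ := by
  induction N with
  | zero =>
    intro f h m l
    obtain ⟨D, hD0, hD⟩ := h.exists_bound
    refine ⟨4 * D * 10 ^ (m + l), by positivity, fun lam τ hl hτ => ?_⟩
    have := intervalIntegral.norm_integral_le_of_norm_le_const (a := 2 / 5) (b := 43 / 10)
      (f := fun r => f r * (τ ^ m * ((1 - 2 * τ * r)⁻¹) ^ (m + l) : ℝ) * cis (sph lam τ r))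
      (C := D * (10 ^ (m + l) * ((1 + |τ|) ^ l)⁻¹)) fun r hr => by
        rw [Set.uIoc_of_le (by norm_num)] at hr
        have hlow := le_abs_one_sub hτ (Set.Ioc_subset_Icc_self hr)
        have hinv : |(1 - 2 * τ * r)⁻¹| ≤ 10 * (1 + |τ|)⁻¹ := by
          rw [abs_inv]
          refine (inv_anti₀ (by positivity) hlow).trans (le_of_eq ?_)
          rw [inv_div, div_eq_mul_inv]
        rw [norm_mul, norm_cis, mul_one, norm_mul, Complex.norm_real, norm_mul, norm_pow, norm_pow,
          Real.norm_eq_abs, Real.norm_eq_abs]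
        refine mul_le_mul (hD r) ?_ (by positivity) hD0
        calc |τ| ^ m * |(1 - 2 * τ * r)⁻¹| ^ (m + l)
            ≤ (1 + |τ|) ^ m * (10 * (1 + |τ|)⁻¹) ^ (m + l) := by
              gcongr
              linarith
          _ = 10 ^ (m + l) * ((1 + |τ|) ^ l)⁻¹ := by
              rw [mul_pow, inv_pow, pow_add (1 + |τ|)]
              field_simp
    refine this.trans ?_
    rw [abs_of_pos (by norm_num : (0 : ℝ) < 43 / 10 - 2 / 5)]
    have : 0 ≤ D * (10 ^ (m + l) * ((1 + |τ|) ^ l)⁻¹) := by positivity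
    simp only [pow_zero, one_mul, add_zero]
    linarith
  | succ N ih =>
    intro f h m l
    obtain ⟨C₁, hC₁0, hC₁⟩ := ih h.deriv m (l + 1)
    obtain ⟨C₂, hC₂0, hC₂⟩ := ih h (m + 1) (l + 1)
    refine ⟨C₁ + 2 * (m + l + 1) * C₂, by positivity, fun lam τ hl hτ => ?_⟩
    have hne : ∀ r ∈ Set.Icc (2 / 5 : ℝ) (43 / 10), 1 - 2 * τ * r ≠ 0 := fun r hr => by
      have := le_abs_one_sub hτ hr
      exact abs_pos.1 (lt_of_lt_of_le (by positivity) this)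
    have hu : ∀ r ∈ Set.Icc (2 / 5 : ℝ) (43 / 10), HasDerivAt (fun r => (1 - 2 * τ * r)⁻¹)
        (2 * τ * ((1 - 2 * τ * r)⁻¹) ^ 2) r := fun r hr => by
      have h1 : HasDerivAt (fun r : ℝ => 1 - 2 * τ * r) (-(2 * τ)) r := by
        have := (hasDerivAt_const r (1 : ℝ)).fun_sub ((hasDerivAt_id r).const_mul (2 * τ))
        exact this.congr_deriv (by ring)
      refine (h1.fun_inv (hne r hr)).congr_deriv ?_
      rw [neg_neg, inv_pow, div_eq_mul_inv]
    have hw : ∀ r ∈ Set.Icc (2 / 5 : ℝ) (43 / 10),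
        HasDerivAt (fun r => τ ^ m * ((1 - 2 * τ * r)⁻¹) ^ (m + (l + 1)))
          (2 * (m + l + 1) * (τ ^ (m + 1) * ((1 - 2 * τ * r)⁻¹) ^ (m + 1 + (l + 1)))) r := by
      intro r hr
      refine (((hu r hr).fun_pow (m + (l + 1))).const_mul (τ ^ m)).congr_deriv ?_
      rw [show m + (l + 1) - 1 = m + l by omega]
      push_cast
      ring
    have hucont : ContinuousOn (fun r => (1 - 2 * τ * r)⁻¹) (Set.Icc (2 / 5 : ℝ) (43 / 10)) :=
      fun r hr => (hu r hr).continuousAt.continuousWithinAt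
    have hcont : ∀ (c : ℝ) (p : ℕ), ContinuousOn (fun r => ((c * ((1 - 2 * τ * r)⁻¹) ^ p : ℝ) : ℂ))
        (Set.Icc (2 / 5 : ℝ) (43 / 10)) := fun c p =>
      Complex.continuous_ofReal.comp_continuousOn (continuousOn_const.mul (hucont.pow p))
    have hibp := h.Bt_ibp hw (continuousOn_const.mul (continuousOn_const.mul (hucont.pow _))) lam τ
    have hlC : (lam : ℂ) ≠ 0 := by exact_mod_cast hl.ne'
    have e1 : Bt (fun r => lam * (1 - 2 * τ * r) * Complex.I *
          (f r * (τ ^ m * ((1 - 2 * τ * r)⁻¹) ^ (m + (l + 1)) : ℝ))) lam τ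
        = lam * Complex.I *
          Bt (fun r => f r * (τ ^ m * ((1 - 2 * τ * r)⁻¹) ^ (m + l) : ℝ)) lam τ := by
      rw [← Bt_const_mul]
      refine Bt_congr fun r hr => ?_
      have : (1 - 2 * τ * r : ℂ) ≠ 0 := by exact_mod_cast hne r hr
      rw [← add_assoc, pow_succ]
      push_cast
      field_simp
    have e2 : Bt (fun r => _root_.deriv f r * (τ ^ m * ((1 - 2 * τ * r)⁻¹) ^ (m + (l + 1)) : ℝ)
          + f r * (2 * (m + l + 1) * (τ ^ (m + 1) * ((1 - 2 * τ * r)⁻¹) ^ (m + 1 + (l + 1))) : ℝ))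
          lam τ
        = Bt (fun r => _root_.deriv f r * (τ ^ m * ((1 - 2 * τ * r)⁻¹) ^ (m + (l + 1)) : ℝ)) lam τ
          + (2 * (m + l + 1) : ℝ) *
            Bt (fun r => f r * (τ ^ (m + 1) * ((1 - 2 * τ * r)⁻¹) ^ (m + 1 + (l + 1)) : ℝ)) lam τ := by
      rw [← Bt_const_mul, ← Bt_add (h.deriv.continuous.continuousOn.fun_mul (hcont _ _))
        (continuousOn_const.fun_mul (h.continuous.continuousOn.fun_mul (hcont _ _)))]
      refine Bt_congr fun r _ => ?_
      push_cast
      ring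
    rw [e1, e2] at hibp
    have hn := congrArg norm hibp
    rw [norm_neg, norm_mul, norm_mul, Complex.norm_I, mul_one, Complex.norm_real,
      Real.norm_of_nonneg hl.le] at hn
    have h1 := hC₁ lam τ hl hτ
    have h2 := hC₂ lam τ hl hτ
    have h3 : ‖((2 * (m + l + 1) : ℝ) : ℂ) *
          Bt (fun r => f r * (τ ^ (m + 1) * ((1 - 2 * τ * r)⁻¹) ^ (m + 1 + (l + 1)) : ℝ)) lam τ‖
        ≤ 2 * (m + l + 1) * (C₂ * (lam ^ N * (1 + |τ|) ^ (l + 1 + N))⁻¹) := by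
      rw [norm_mul, Complex.norm_real, Real.norm_of_nonneg (by positivity)]
      gcongr
    have h4 := norm_add_le_of_le h1 h3
    rw [← hn] at h4
    rw [← mul_le_mul_iff_right₀ hl]
    refine h4.trans (le_of_eq ?_)
    have hne0 : (1 + |τ|) ^ (l + (N + 1)) ≠ 0 := by positivity
    rw [show l + 1 + N = l + (N + 1) by ring, pow_succ lam]
    generalize (1 + |τ|) ^ (l + (N + 1)) = X at hne0
    field_simp

lemma IsTest.exists_norm_Bt_decay (h : IsTest f) :
    ∃ C, 0 ≤ C ∧ ∀ lam τ, 0 < lam → τ ∉ Set.Icc (1 / 10 : ℝ) 2 →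
      ‖Bt f lam τ‖ ≤ C * (lam ^ 3 * (1 + |τ|) ^ 3)⁻¹ := by
  obtain ⟨C, hC0, hC⟩ := IsTest.exists_norm_Bt_weight_le 3 h 0 0
  exact ⟨C, hC0, fun lam τ hl hτ => by simpa using hC lam τ hl hτ⟩

end

/-- A smooth cutoff equal to `1` on `[1, 37/10]`. -/
def bump : ContDiffBump (47 / 20 : ℝ) := ⟨27 / 20, 37 / 20, by norm_num, by norm_num⟩

lemma bump_eq_one {r : ℝ} (hr : r ∈ Set.Icc (1 : ℝ) (37 / 10)) : bump r = 1 :=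
  bump.one_of_mem_closedBall (by
    rw [Metric.mem_closedBall, Real.dist_eq, abs_le]
    change -(27 / 20) ≤ _ ∧ _ ≤ (27 / 20 : ℝ)
    constructor <;> linarith [hr.1, hr.2])

lemma bump_eq_zero {r : ℝ} (hr : r ∉ Set.Ioo (1 / 2 : ℝ) (21 / 5)) : bump r = 0 := by
  refine bump.zero_of_le_dist ?_
  rw [Real.dist_eq]
  change (37 / 20 : ℝ) ≤ _
  rcases le_or_gt r (1 / 2) with h | h
  · rw [abs_of_nonpos (by linarith)]
    linarith
  · have : 21 / 5 ≤ r := not_lt.1 fun h' => hr ⟨h, h'⟩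
    rw [abs_of_nonneg (by linarith)]
    linarith

/-- The amplitude `2 r χ(r)` of the subordination formula. -/
def psi (r : ℝ) : ℂ := ((2 * r * bump r : ℝ) : ℂ)

lemma isTest_psi : IsTest psi where
  smooth := by
    have : ContDiff ℝ (⊤ : ℕ∞) (fun r : ℝ => 2 * r * bump r) :=
      (contDiff_const.mul contDiff_id).mul bump.contDiff
    exact Complex.ofRealCLM.contDiff.comp this
  supp := by
    refine closure_minimal (fun r hr => ?_) isClosed_Icc
    by_contra h
    refine hr ?_
    have : bump r = 0 := bump_eq_zero fun h' => h (Set.Ioo_subset_Icc_self h')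
    simp [psi, this]

/-- The cut-off half-wave symbol as a function of the energy. -/
def HE (lam E : ℝ) : ℂ := bump (√E) * cis (lam * √E)

lemma continuous_HE (lam : ℝ) : Continuous (HE lam) := by
  have hb := bump.continuous
  have hc := continuous_cis
  unfold HE
  fun_prop

lemma HE_eq_zero {lam E : ℝ} (h : E ∉ Set.Ioc ((2 / 5 : ℝ) ^ 2) ((43 / 10) ^ 2)) : HE lam E = 0 := by
  have : bump (√E) = 0 := bump_eq_zero fun h' => h ⟨?_, ?_⟩
  · simp [HE, this]
  · refine (Real.lt_sqrt (by norm_num)).1 ?_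
    linarith [h'.1]
  · refine (Real.sqrt_le_left (by norm_num)).1 ?_
    linarith [h'.2]

lemma integrable_HE (lam : ℝ) : Integrable (HE lam) :=
  (continuous_HE lam).integrable_of_hasCompactSupport
    (HasCompactSupport.intro (isCompact_Icc (a := (2 / 5 : ℝ) ^ 2) (b := (43 / 10) ^ 2))
      fun _ h => HE_eq_zero fun h' => h (Set.Ioc_subset_Icc_self h'))

lemma integral_cis_mul_HE (lam τ : ℝ) :
    ∫ E, cis (-(lam * τ * E)) * HE lam E = Bt psi lam τ := by
  have hc := continuous_cis
  have hH := continuous_HE lam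
  rw [← setIntegral_eq_integral_of_forall_compl_eq_zero
    (s := Set.Ioc ((2 / 5 : ℝ) ^ 2) ((43 / 10) ^ 2)) (fun E hE => by rw [HE_eq_zero hE, mul_zero]),
    ← intervalIntegral.integral_of_le (by norm_num),
    ← intervalIntegral.integral_deriv_smul_comp (f := fun r : ℝ => r ^ 2) (f' := fun r => 2 * r)
      (fun r _ => by simpa using hasDerivAt_pow 2 r) (by fun_prop) (by fun_prop)]
  refine intervalIntegral.integral_congr fun r hr => ?_
  rw [Set.uIcc_of_le (by norm_num)] at hr
  have hr0 : 0 ≤ r := by linarith [hr.1]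
  simp only [Function.comp, HE, Real.sqrt_sq hr0, psi, sph, Complex.real_smul]
  rw [show lam * (r - τ * r ^ 2) = -(lam * τ * r ^ 2) + lam * r by ring, cis_add]
  push_cast
  ring

lemma exists_norm_Bt_psi_le : ∃ C, 0 ≤ C ∧ ∀ lam, 1 ≤ lam → ∀ τ,
    ‖Bt psi lam τ‖ ≤ C * (1 + ‖τ‖) ^ (-(3 : ℝ)) := by
  obtain ⟨C, hC0, hC⟩ := isTest_psi.exists_norm_Bt_decay
  obtain ⟨D, hD0, hD⟩ := isTest_psi.exists_bound
  refine ⟨C + 108 * D, by positivity, fun lam hl τ => ?_⟩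
  have hr : (1 + ‖τ‖) ^ (-(3 : ℝ)) = ((1 + |τ|) ^ 3)⁻¹ := by
    rw [Real.rpow_neg (by positivity), Real.norm_eq_abs]
    norm_cast
  rw [hr, add_mul]
  have hX : 0 < ((1 + |τ|) ^ 3)⁻¹ := by positivity
  by_cases h : τ ∈ Set.Icc (1 / 10 : ℝ) 2
  · refine (norm_Bt_le_of_bound hD).trans ?_
    have : 1 / 27 ≤ ((1 + |τ|) ^ 3)⁻¹ := by
      rw [← one_div]
      refine one_div_le_one_div_of_le (by positivity) ?_
      have : |τ| ≤ 2 := abs_le.2 ⟨by linarith [h.1], h.2⟩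
      calc (1 + |τ|) ^ 3 ≤ (1 + 2) ^ 3 := by gcongr
        _ = 27 := by norm_num
    have := mul_le_mul_of_nonneg_left this hD0
    have := mul_nonneg hC0 hX.le
    linarith
  · refine (hC lam τ (by linarith) h).trans ?_
    have : (lam ^ 3 * (1 + |τ|) ^ 3)⁻¹ ≤ ((1 + |τ|) ^ 3)⁻¹ := by
      refine inv_anti₀ (by positivity) ?_
      exact le_mul_of_one_le_left (by positivity) (one_le_pow₀ hl)
    have := mul_le_mul_of_nonneg_left this hC0
    have := mul_nonneg hD0 hX.le
    linarith

lemma integrable_Bt_psi {lam : ℝ} (hl : 1 ≤ lam) : Integrable (Bt psi lam) := by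
  obtain ⟨C, _, hC⟩ := exists_norm_Bt_psi_le
  exact ((integrable_one_add_norm (μ := volume) (E := ℝ) (r := 3) (by simp)).const_mul C).mono'
    (continuous_Bt isTest_psi.continuous lam).aestronglyMeasurable
    (Filter.Eventually.of_forall (hC lam hl))

open scoped FourierTransform in
/-- The subordination formula. -/
lemma cis_eq_integral {lam w : ℝ} (hl : 1 ≤ lam) (hw : w ∈ Set.Icc (1 : ℝ) (37 / 10)) :
    cis (lam * w) = (lam / (2 * π) : ℝ) * ∫ τ, Bt psi lam τ * cis (lam * τ * w ^ 2) := by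
  have hl0 : 0 < lam := by linarith
  have hF : 𝓕 (HE lam) = fun ξ => Bt psi lam (2 * π / lam * ξ) := by
    ext ξ
    rw [← integral_cis_mul_HE, Real.fourier_real_eq_integral_exp_smul]
    refine integral_congr_ae (Filter.Eventually.of_forall fun E => ?_)
    simp only [smul_eq_mul, cis]
    congr 3
    field_simp
  have hFi : Integrable (𝓕 (HE lam)) := by
    rw [hF]
    exact (integrable_Bt_psi hl).comp_mul_left' (by positivity)
  have hinv := congrFun ((continuous_HE lam).fourierInv_fourier_eq (integrable_HE lam) hFi) (w ^ 2)
  have hHw : HE lam (w ^ 2) = cis (lam * w) := by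
    rw [HE, Real.sqrt_sq (by linarith [hw.1]), bump_eq_one hw]
    simp
  rw [hHw, Real.fourierInv_eq', hF] at hinv
  rw [← hinv]
  have := Measure.integral_comp_mul_left (fun τ => Bt psi lam τ * cis (lam * τ * w ^ 2))
    (2 * π / lam)
  rw [abs_of_pos (by positivity), inv_div, Complex.real_smul] at this
  rw [← this]
  refine integral_congr_ae (Filter.Eventually.of_forall fun ξ => ?_)
  have e : 2 * π * inner ℝ ξ (w ^ 2) = lam * (2 * π / lam * ξ) * w ^ 2 := by
    simp only [RCLike.inner_apply, conj_trivial]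
    field_simp
  simp only [smul_eq_mul, cis, e]
  rw [mul_comm]

section
variable {d : ℕ} {lam : ℝ} {s : Fin 3 → ℝ}

lemma cube_eq_pi (d : ℕ) : cube d = Set.univ.pi fun _ => Set.Icc 0 (2 * π) := by
  ext x
  simp [cube, Pi.le_def]

lemma volume_restrict_cube (d : ℕ) : (volume : Measure (Fin d → ℝ)).restrict (cube d)
    = Measure.pi fun _ => (volume : Measure ℝ).restrict (Set.Icc 0 (2 * π)) := by
  rw [cube_eq_pi, volume_pi, Measure.restrict_pi_pi]

instance isFiniteMeasure_restrict_cube :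
    IsFiniteMeasure ((volume : Measure (Fin d → ℝ)).restrict (cube d)) := by
  rw [volume_restrict_cube]
  infer_instance

lemma oscIntJ_eq (d : ℕ) (lam : ℝ) (s : Fin d → ℝ) :
    oscIntJ d lam s = ∫ x in cube d, cis (lam * (omegaKG d x - ∑ j, s j * x j)) := by
  simp only [oscIntJ, cis, mul_comm Complex.I]

lemma continuous_omegaKG : Continuous (omegaKG d) := by
  unfold omegaKG
  fun_prop

lemma norm_oscIntJ_le (lam : ℝ) (s : Fin d → ℝ) :
    ‖oscIntJ d lam s‖ ≤ volume.real (cube d) := by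
  rw [oscIntJ_eq]
  have := norm_integral_le_of_norm_le_const (μ := volume.restrict (cube d)) (C := 1)
    (f := fun x => cis (lam * (omegaKG d x - ∑ j, s j * x j)))
    (Filter.Eventually.of_forall fun x => by simp)
  simpa using this

lemma norm_oscIntJ_neg (lam : ℝ) (s : Fin d → ℝ) : ‖oscIntJ d (-lam) s‖ = ‖oscIntJ d lam s‖ := by
  rw [oscIntJ_eq, oscIntJ_eq]
  simp only [neg_mul, cis_neg]
  rw [integral_conj, RCLike.norm_conj]

lemma sq_omegaKG_three (x : Fin 3 → ℝ) : omegaKG 3 x ^ 2 = 7 - ∑ j, 2 * cos (x j) := by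
  rw [omegaKG, Real.sq_sqrt]
  · simp only [Fin.sum_univ_three]
    ring
  · have : 0 ≤ ∑ j : Fin 3, 2 * (1 - cos (x j)) :=
      Finset.sum_nonneg fun j _ => by linarith [cos_le_one (x j)]
    linarith

lemma omegaKG_three_mem (x : Fin 3 → ℝ) : omegaKG 3 x ∈ Set.Icc (1 : ℝ) (37 / 10) := by
  have h0 : 0 ≤ omegaKG 3 x := Real.sqrt_nonneg _
  have h := sq_omegaKG_three x
  simp only [Fin.sum_univ_three] at h
  have a0 := cos_le_one (x 0)
  have a1 := cos_le_one (x 1)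
  have a2 := cos_le_one (x 2)
  have b0 := neg_one_le_cos (x 0)
  have b1 := neg_one_le_cos (x 1)
  have b2 := neg_one_le_cos (x 2)
  constructor <;> nlinarith

lemma cis_sum {ι : Type*} (S : Finset ι) (f : ι → ℝ) : cis (∑ j ∈ S, f j) = ∏ j ∈ S, cis (f j) := by
  simp only [cis, ← Complex.exp_sum, Complex.ofReal_sum, Finset.sum_mul]

lemma integral_cube_cis (lam τ : ℝ) (s : Fin 3 → ℝ) :
    ∫ x in cube 3, cis (lam * τ * omegaKG 3 x ^ 2 - lam * ∑ j, s j * x j)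
      = cis (7 * lam * τ) * ∏ j, Gf (lam * s j) (2 * lam * τ) := by
  have h1 : ∀ x : Fin 3 → ℝ, cis (lam * τ * omegaKG 3 x ^ 2 - lam * ∑ j, s j * x j)
      = cis (7 * lam * τ) * ∏ j, cis (-(2 * lam * τ * cos (x j) + lam * s j * x j)) := fun x => by
    rw [← cis_sum, ← cis_add, sq_omegaKG_three]
    congr 1
    simp only [Fin.sum_univ_three]
    ring
  simp only [h1]
  rw [integral_const_mul, volume_restrict_cube,
    integral_fintype_prod_eq_prod (fun j y => cis (-(2 * lam * τ * cos y + lam * s j * y)))]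
  simp only [Gf, integral_Icc_eq_integral_Ioc,
    ← intervalIntegral.integral_of_le (show (0 : ℝ) ≤ 2 * π by positivity)]

lemma oscIntJ_three_eq (hl : 1 ≤ lam) (s : Fin 3 → ℝ) :
    oscIntJ 3 lam s = (lam / (2 * π) : ℝ) *
      ∫ τ, Bt psi lam τ * (cis (7 * lam * τ) * ∏ j, Gf (lam * s j) (2 * lam * τ)) := by
  have hcis := continuous_cis
  have hom := continuous_omegaKG (d := 3)
  have h1 : ∀ x : Fin 3 → ℝ, cis (lam * (omegaKG 3 x - ∑ j, s j * x j))
      = (lam / (2 * π) : ℝ) * ∫ τ, Bt psi lam τ *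
        cis (lam * τ * omegaKG 3 x ^ 2 - lam * ∑ j, s j * x j) := fun x => by
    rw [mul_sub, sub_eq_add_neg, cis_add, cis_eq_integral hl (omegaKG_three_mem x), mul_assoc,
      ← integral_mul_const]
    congr 2
    ext τ
    rw [mul_assoc, ← cis_add, ← sub_eq_add_neg]
  rw [oscIntJ_eq]
  simp only [h1]
  rw [integral_const_mul, integral_integral_swap]
  · simp only [integral_const_mul, integral_cube_cis]
  · have hb : Integrable (fun z : (Fin 3 → ℝ) × ℝ => (1 : ℂ) * Bt psi lam z.2)
        ((volume.restrict (cube 3)).prod volume) :=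
      (integrable_const (1 : ℂ)).mul_prod (integrable_Bt_psi hl)
    have hB := continuous_Bt isTest_psi.continuous lam
    refine hb.mono (Continuous.aestronglyMeasurable ?_) (Filter.Eventually.of_forall fun z => ?_)
    · simp only [Function.uncurry_def]
      fun_prop
    · simp [Function.uncurry]

lemma norm_prod_Gf_le (ν z : Fin 3 → ℝ) : ‖∏ j, Gf (ν j) (z j)‖ ≤ (2 * π) ^ 3 := by
  rw [norm_prod]
  calc ∏ j, ‖Gf (ν j) (z j)‖ ≤ ∏ _j : Fin 3, 2 * π :=
        Finset.prod_le_prod (fun _ _ => norm_nonneg _) fun j _ => norm_Gf_le _ _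
    _ = (2 * π) ^ 3 := by simp

lemma exists_norm_oscIntJ_three_le : ∃ C, 0 ≤ C ∧ ∀ (lam l : ℝ) (s : Fin 3 → ℝ), 0 < l →
    l ≤ 1 / 2 → lam * l ^ 6 = 1 → ‖oscIntJ 3 lam s‖ ≤ C * l ^ 7 := by
  obtain ⟨K, hK0, hK⟩ := exists_norm_integral_prod_Gf_le
  obtain ⟨M, hM⟩ := isTest_psi.exists_bvOn_alp
  obtain ⟨C, hC0, hC⟩ := isTest_psi.exists_norm_Bt_decay
  set R := ∫ τ : ℝ, (1 + ‖τ‖) ^ (-(3 : ℝ)) with hR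
  have hRi : Integrable (fun τ : ℝ => (1 + ‖τ‖) ^ (-(3 : ℝ))) volume :=
    integrable_one_add_norm (by simp)
  have hR0 : 0 ≤ R := integral_nonneg fun τ => by positivity
  have hM0 : 0 ≤ M := by
    obtain ⟨α', h⟩ := hM 1 one_pos
    exact (norm_nonneg _).trans (h.bound 2 (by norm_num))
  refine ⟨K * M + C * (2 * π) ^ 3 * R, by positivity, fun lam l s hl hl2 hlam => ?_⟩
  have hlp := lam_pos hl hlam
  have hl6 : l ^ 6 ≤ 1 := pow_le_one₀ hl.le (by linarith)
  have hl1 : 1 ≤ lam := by nlinarith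
  have hsq : √lam * l ^ 3 = 1 := by
    rw [← Real.sqrt_sq (by positivity : 0 ≤ l ^ 3), ← Real.sqrt_mul hlp.le, ← pow_mul, hlam,
      Real.sqrt_one]
  obtain ⟨α', hα⟩ := hM lam hlp
  set F : ℝ → ℂ := fun τ =>
    Bt psi lam τ * (cis (7 * lam * τ) * ∏ j, Gf (lam * s j) (2 * lam * τ)) with hF
  have hpt : ∀ τ, ‖F τ‖ ≤ (2 * π) ^ 3 * ‖Bt psi lam τ‖ := fun τ => by
    rw [hF, norm_mul, norm_mul, norm_cis, one_mul, mul_comm]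
    exact mul_le_mul_of_nonneg_right (norm_prod_Gf_le _ fun _ => 2 * lam * τ) (norm_nonneg _)
  have hFc : Continuous F := by
    have hB := continuous_Bt isTest_psi.continuous lam
    have hG : ∀ j, Continuous fun τ => Gf (lam * s j) (2 * lam * τ) := fun j =>
      (continuous_Gf (lam * s j)).comp (by fun_prop : Continuous fun τ => 2 * lam * τ)
    have hcis := continuous_cis
    fun_prop
  have hFi : Integrable F :=
    ((integrable_Bt_psi hl1).norm.const_mul _).mono' hFc.aestronglyMeasurable
      (Filter.Eventually.of_forall hpt)
  have hin : ‖∫ τ in Set.Icc (1 / 10 : ℝ) 2, F τ‖ ≤ l ^ 3 * (K * M * l ^ 10) := by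
    have e : ∀ τ ∈ Set.Ioc (1 / 10 : ℝ) 2, F τ = (l ^ 3 : ℝ) *
        (alp psi lam τ * cis (hph lam τ) * ∏ j, Gf (lam * s j) (2 * lam * τ)) := fun τ hτ => by
      have h1 : ((l ^ 3 : ℝ) : ℂ) * (√lam : ℂ) = 1 := by
        rw [← Complex.ofReal_mul, mul_comm, hsq, Complex.ofReal_one]
      have h2 : cis (-(lam / (4 * τ))) * cis (hph lam τ) = cis (7 * lam * τ) := by
        rw [← cis_add, hph]
        congr 1
        ring
      rw [hF, alp]
      simp only
      rw [← h2]
      linear_combination (-(Bt psi lam τ * (cis (-(lam / (4 * τ))) * cis (hph lam τ) *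
        ∏ j, Gf (lam * s j) (2 * lam * τ)))) * h1
    rw [integral_Icc_eq_integral_Ioc, setIntegral_congr_fun measurableSet_Ioc e,
      integral_const_mul, norm_mul, Complex.norm_real, Real.norm_of_nonneg (by positivity),
      ← intervalIntegral.integral_of_le (by norm_num)]
    exact mul_le_mul_of_nonneg_left (hK lam l s _ _ M hl hl2 hlam hα) (by positivity)
  have hout : ‖∫ τ in (Set.Icc (1 / 10 : ℝ) 2)ᶜ, F τ‖ ≤ (2 * π) ^ 3 * C * (lam ^ 3)⁻¹ * R := by
    calc _ ≤ ∫ τ in (Set.Icc (1 / 10 : ℝ) 2)ᶜ,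
          (2 * π) ^ 3 * C * (lam ^ 3)⁻¹ * (1 + ‖τ‖) ^ (-(3 : ℝ)) := by
          refine norm_integral_le_of_norm_le (hRi.const_mul _).integrableOn ?_
          refine (ae_restrict_iff' measurableSet_Icc.compl).2 (Filter.Eventually.of_forall ?_)
          intro τ hτ
          refine (hpt τ).trans ?_
          refine (mul_le_mul_of_nonneg_left (hC lam τ hlp hτ) (by positivity)).trans (le_of_eq ?_)
          rw [Real.rpow_neg (by positivity), Real.norm_eq_abs, mul_inv]
          norm_cast
          ring
      _ ≤ ∫ τ, (2 * π) ^ 3 * C * (lam ^ 3)⁻¹ * (1 + ‖τ‖) ^ (-(3 : ℝ)) :=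
          setIntegral_le_integral (hRi.const_mul _)
            (Filter.Eventually.of_forall fun τ => by simp only [Pi.zero_apply]; positivity)
      _ = _ := by rw [integral_const_mul]
  have htot := norm_add_le_of_le hin hout
  rw [integral_add_compl measurableSet_Icc hFi] at htot
  rw [oscIntJ_three_eq hl1, norm_mul, Complex.norm_real, Real.norm_of_nonneg (by positivity)]
  have hlam' : lam = 1 / l ^ 6 := by field_simp; exact hlam
  calc lam / (2 * π) * ‖∫ τ, F τ‖
      ≤ lam * (l ^ 3 * (K * M * l ^ 10) + (2 * π) ^ 3 * C * (lam ^ 3)⁻¹ * R) := by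
        refine mul_le_mul ?_ htot (norm_nonneg _) hlp.le
        exact div_le_self hlp.le (by linarith [pi_gt_three])
    _ = K * M * l ^ 7 + C * (2 * π) ^ 3 * R * l ^ 12 := by
        rw [hlam']
        field_simp
    _ ≤ K * M * l ^ 7 + C * (2 * π) ^ 3 * R * l ^ 7 := by
        have : l ^ 12 ≤ l ^ 7 := pow_le_pow_of_le_one hl.le (by linarith) (by norm_num)
        gcongr
    _ = _ := by ring

end

end KG

/-- Sharp decay of the oscillatory integral with the `d = 3` discrete Klein--Gordon
phase `Φ(x,s) = ω(x) − s·x`, uniformly in the velocity parameter `s`. -/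
theorem oscillatory_decay_d3 :
    ∃ C > 0, ∀ (lam : ℝ) (s : Fin 3 → ℝ),
      ‖oscIntJ 3 lam s‖ ≤ C * (1 + |lam|) ^ (-(7 : ℝ)/6) := by
  obtain ⟨C, hC0, hC⟩ := KG.exists_norm_oscIntJ_three_le
  set V := volume.real (cube 3) with hV
  have hV0 : 0 ≤ V := measureReal_nonneg
  refine ⟨65 ^ 2 * V + 4 * C + 1, by positivity, fun lam s => ?_⟩
  wlog hlam : 0 ≤ lam generalizing lam
  · have := this (-lam) (by linarith)
    rwa [KG.norm_oscIntJ_neg, abs_neg] at this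
  rw [abs_of_nonneg hlam]
  have hX : 0 < (1 + lam) ^ (-(7 : ℝ) / 6) := by positivity
  rcases lt_or_ge lam 64 with h | h
  · have h1 : (65 ^ 2 : ℝ)⁻¹ ≤ (1 + lam) ^ (-(7 : ℝ) / 6) := by
      calc (65 ^ 2 : ℝ)⁻¹ = (65 : ℝ) ^ (-2 : ℝ) := by
            rw [Real.rpow_neg (by norm_num)]
            norm_num
        _ ≤ (65 : ℝ) ^ (-(7 : ℝ) / 6) :=
            Real.rpow_le_rpow_of_exponent_le (by norm_num) (by norm_num)
        _ ≤ _ := Real.rpow_le_rpow_of_nonpos (by positivity) (by linarith) (by norm_num)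
    calc _ ≤ V := KG.norm_oscIntJ_le lam s
      _ = 65 ^ 2 * V * (65 ^ 2 : ℝ)⁻¹ := by field_simp
      _ ≤ (65 ^ 2 * V + 4 * C + 1) * (1 + lam) ^ (-(7 : ℝ) / 6) :=
          mul_le_mul (by linarith) h1 (by positivity) (by positivity)
  · have hlp : 0 < lam := by linarith
    have hpow : ∀ n : ℕ, (lam ^ (-(1 : ℝ) / 6)) ^ n = lam ^ (-(n : ℝ) / 6) := fun n => by
      rw [← Real.rpow_natCast, ← Real.rpow_mul hlp.le]
      congr 1
      ring
    have hl2 : lam ^ (-(1 : ℝ) / 6) ≤ 1 / 2 := by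
      calc lam ^ (-(1 : ℝ) / 6) ≤ (64 : ℝ) ^ (-(1 : ℝ) / 6) :=
            Real.rpow_le_rpow_of_nonpos (by norm_num) h (by norm_num)
        _ = 1 / 2 := by
            rw [show (64 : ℝ) = 2 ^ (6 : ℝ) by norm_num, ← Real.rpow_mul (by norm_num)]
            norm_num [Real.rpow_neg_one]
    have hl6 : lam * (lam ^ (-(1 : ℝ) / 6)) ^ 6 = 1 := by
      rw [hpow]
      norm_num [Real.rpow_neg_one]
      exact mul_inv_cancel₀ hlp.ne'
    have h2 : (2 : ℝ) ^ (-(2 : ℝ)) ≤ (2 : ℝ) ^ (-(7 : ℝ) / 6) :=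
      Real.rpow_le_rpow_of_exponent_le (by norm_num) (by norm_num)
    have h4 : lam ^ (-(7 : ℝ) / 6) ≤ 4 * (1 + lam) ^ (-(7 : ℝ) / 6) := by
      have h3 : (2 * lam) ^ (-(7 : ℝ) / 6) ≤ (1 + lam) ^ (-(7 : ℝ) / 6) :=
        Real.rpow_le_rpow_of_nonpos (by positivity) (by linarith) (by norm_num)
      rw [Real.mul_rpow (by norm_num) hlp.le] at h3
      have h5 : (2 : ℝ) ^ (-(2 : ℝ)) = 1 / 4 := by
        rw [Real.rpow_neg (by norm_num)]
        norm_num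
      have := Real.rpow_pos_of_pos hlp (-(7 : ℝ) / 6)
      nlinarith
    have := hC lam _ s (by positivity) hl2 hl6
    rw [hpow] at this
    push_cast at this
    calc _ ≤ C * lam ^ (-(7 : ℝ) / 6) := this
      _ ≤ C * (4 * (1 + lam) ^ (-(7 : ℝ) / 6)) := by gcongr
      _ ≤ _ := by nlinarith [mul_nonneg hV0 hX.le]
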